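/- arXiv:2510.03084 — 2 statements merged into one kernel-verified Lean document; each statement's English description precedes it below -/
import Mathlib

section
/- For every integer k ≥ 3 and every α > 0, there exist constants C, c > 0 such that for all n and all p with p > C n^{-1/(k-1)}, the binomial random set [n]_p is (α,k)-Sz with probability at least 1 − e^{−c n p}. -/
/-- `A` contains the `k`-term arithmetic progression with first term `a` and
common difference `d ≥ 1`. -/
def APIn (k : ℕ) (A : Finset ℕ) (a d : ℕ) : Prop :=
  1 ≤ d ∧ ∀ i < k, a + i * d ∈ A

/-- The colouring `χ` is constant on the `k`-AP with first term `a` and difference `d`. -/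
def MonoOn (k : ℕ) (χ : ℕ → ℕ) (a d : ℕ) : Prop :=
  ∀ i < k, ∀ j < k, χ (a + i * d) = χ (a + j * d)

/-- The colouring `χ` is injective (rainbow) on the `k`-AP with first term `a`
and difference `d`. -/
def RainbowOn (k : ℕ) (χ : ℕ → ℕ) (a d : ℕ) : Prop :=
  ∀ i < k, ∀ j < k, i ≠ j → χ (a + i * d) ≠ χ (a + j * d)

/-- `A` is `(α,k)`-Sz: every `B ⊆ A` with `|B| ≥ α|A|` contains a `k`-AP. -/
def IsSz (α : ℝ) (k : ℕ) (A : Finset ℕ) : Prop :=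
  ∀ B ⊆ A, α * A.card ≤ (B.card : ℝ) → ∃ a d : ℕ, APIn k B a d

open scoped Classical in
/-- The probability that the binomial random subset `[n]_p` of `{1,…,n}` (each element kept
independently with probability `p`) satisfies the predicate `P`. -/
noncomputable def binomProb (n : ℕ) (p : ℝ) (P : Finset ℕ → Prop) : ℝ :=
  ∑ A ∈ (Finset.Icc 1 n).powerset,
    if P A then p ^ A.card * (1 - p) ^ (n - A.card) else 0

/-! ### Averages and densities on finite types -/

open Combinatorics

namespace Avg

variable {Ω Ω' : Type*}

/-- The average of a real function over a finite type. -/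
noncomputable def avg (f : Ω → ℝ) : ℝ := (∑ᶠ x, f x) / Nat.card Ω

/-- The density of a subset of a finite type. -/
noncomputable def dens (A : Set Ω) : ℝ := avg (A.indicator 1)

theorem avg_eq [Fintype Ω] (f : Ω → ℝ) : avg f = (∑ x, f x) / Fintype.card Ω := by
  rw [avg, finsum_eq_sum_of_fintype, Nat.card_eq_fintype_card]

theorem avg_add [Finite Ω] (f g : Ω → ℝ) : avg (fun x => f x + g x) = avg f + avg g := by
  have := Fintype.ofFinite Ω
  simp only [avg_eq, Finset.sum_add_distrib, add_div]

theorem avg_sub [Finite Ω] (f g : Ω → ℝ) : avg (fun x => f x - g x) = avg f - avg g := by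
  have := Fintype.ofFinite Ω
  simp only [avg_eq, Finset.sum_sub_distrib, sub_div]

theorem avg_mul_left [Finite Ω] (c : ℝ) (f : Ω → ℝ) : avg (fun x => c * f x) = c * avg f := by
  have := Fintype.ofFinite Ω
  simp only [avg_eq, ← Finset.mul_sum, mul_div_assoc]

theorem avg_const [Finite Ω] [Nonempty Ω] (c : ℝ) : avg (fun _ : Ω => c) = c := by
  have := Fintype.ofFinite Ω
  simp [avg_eq]

theorem avg_mono [Finite Ω] {f g : Ω → ℝ} (h : ∀ x, f x ≤ g x) : avg f ≤ avg g := by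
  have := Fintype.ofFinite Ω
  simp only [avg_eq]
  gcongr with x
  exact h x

theorem avg_nonneg [Finite Ω] {f : Ω → ℝ} (h : ∀ x, 0 ≤ f x) : 0 ≤ avg f := by
  have := Fintype.ofFinite Ω
  rw [avg_eq]
  have := Finset.sum_nonneg (s := Finset.univ) fun x _ => h x
  positivity

theorem avg_of_isEmpty [IsEmpty Ω] (f : Ω → ℝ) : avg f = 0 := by simp [avg]

theorem avg_le_of_le [Finite Ω] {f : Ω → ℝ} {c : ℝ} (hc : 0 ≤ c) (h : ∀ x, f x ≤ c) :
    avg f ≤ c := by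
  cases isEmpty_or_nonempty Ω
  · simpa [avg_of_isEmpty] using hc
  · exact (avg_mono h).trans_eq (avg_const c)

theorem exists_le_of_le_avg [Finite Ω] [Nonempty Ω] {f : Ω → ℝ} {c : ℝ} (h : c ≤ avg f) :
    ∃ x, c ≤ f x := by
  by_contra! hlt
  have := Fintype.ofFinite Ω
  rw [avg_eq, le_div_iff₀ (by positivity)] at h
  have h2 : ∑ x, f x < ∑ _x : Ω, c :=
    Finset.sum_lt_sum_of_nonempty Finset.univ_nonempty fun x _ => hlt x
  simp at h2
  linarith

theorem avg_comp_equiv (e : Ω ≃ Ω') (f : Ω' → ℝ) : avg (fun x => f (e x)) = avg f := by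
  rw [avg, avg, Nat.card_congr e, finsum_comp_equiv e]

theorem avg_prod [Finite Ω] [Finite Ω'] (f : Ω × Ω' → ℝ) :
    avg f = avg fun x => avg fun y => f (x, y) := by
  have := Fintype.ofFinite Ω
  have := Fintype.ofFinite Ω'
  simp only [avg_eq, Fintype.sum_prod_type, ← Finset.sum_div, div_div, Fintype.card_prod]
  push_cast
  rw [mul_comm]

theorem avg_comm [Finite Ω] [Finite Ω'] (f : Ω → Ω' → ℝ) :
    (avg fun x => avg fun y => f x y) = avg fun y => avg fun x => f x y := by
  rw [← avg_prod fun p : Ω × Ω' => f p.1 p.2, ← avg_prod fun p : Ω' × Ω => f p.2 p.1,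
    ← avg_comp_equiv (Equiv.prodComm Ω Ω')]
  rfl

theorem dens_nonneg [Finite Ω] (A : Set Ω) : 0 ≤ dens A :=
  avg_nonneg fun x => Set.indicator_nonneg (by simp) x

theorem indicator_one_le (A : Set Ω) (x : Ω) : A.indicator (1 : Ω → ℝ) x ≤ 1 :=
  Set.indicator_le_self' (by simp) x

theorem dens_le_one [Finite Ω] (A : Set Ω) : dens A ≤ 1 :=
  avg_le_of_le zero_le_one (indicator_one_le A)

theorem dens_mono [Finite Ω] {A B : Set Ω} (h : A ⊆ B) : dens A ≤ dens B :=
  avg_mono fun x => Set.indicator_le_indicator_of_subset h (by simp) x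

theorem dens_empty : dens (∅ : Set Ω) = 0 := by simp [dens, avg]

theorem nonempty_of_dens_pos {A : Set Ω} (h : 0 < dens A) : A.Nonempty := by
  rw [Set.nonempty_iff_ne_empty]
  rintro rfl
  simp [dens_empty] at h

theorem inv_card_le_dens [Finite Ω] {A : Set Ω} (h : A.Nonempty) :
    (Nat.card Ω : ℝ)⁻¹ ≤ dens A := by
  classical
  have := Fintype.ofFinite Ω
  obtain ⟨a, ha⟩ := h
  rw [dens, avg_eq, Nat.card_eq_fintype_card, inv_eq_one_div]
  gcongr
  refine le_trans ?_ (Finset.single_le_sum (f := A.indicator (1 : Ω → ℝ))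
    (fun x _ => Set.indicator_nonneg (by simp) x) (Finset.mem_univ a))
  simp [ha]

/-- Markov's inequality for functions bounded by `1`. -/
theorem le_dens_of_le_avg [Finite Ω] {f : Ω → ℝ} {δ : ℝ} (hδ : 0 < δ) (hf : ∀ x, f x ≤ 1)
    (h : δ ≤ avg f) : δ / 2 ≤ dens {x | δ / 2 ≤ f x} := by
  have h1 : avg f ≤ avg fun x => {x | δ / 2 ≤ f x}.indicator (1 : Ω → ℝ) x + δ / 2 := by
    refine avg_mono fun x => ?_
    by_cases hx : δ / 2 ≤ f x
    · rw [Set.indicator_of_mem (by exact hx)]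
      have := hf x
      simp only [Pi.one_apply]
      linarith
    · rw [Set.indicator_of_notMem (by exact hx)]
      linarith
  rw [avg_add] at h1
  have h2 : avg (fun _ : Ω => δ / 2) ≤ δ / 2 := avg_le_of_le (by linarith) fun _ => le_rfl
  rw [dens]
  linarith

theorem exists_dens_fiber_ge [Finite Ω] {K : Type*} [Finite K] [Nonempty K] (E : Set Ω)
    (c : Ω → K) : ∃ k, dens E / Nat.card K ≤ dens {x | x ∈ E ∧ c x = k} := by
  classical
  have := Fintype.ofFinite K
  have := Fintype.ofFinite Ω
  have h : dens E ≤ ∑ k, dens {x | x ∈ E ∧ c x = k} := by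
    simp only [dens, avg_eq, ← Finset.sum_div]
    rw [Finset.sum_comm]
    gcongr with x
    by_cases hx : x ∈ E
    · rw [Set.indicator_of_mem hx]
      refine le_trans ?_ (Finset.single_le_sum
        (f := fun k => {x | x ∈ E ∧ c x = k}.indicator (1 : Ω → ℝ) x)
        (fun k _ => Set.indicator_nonneg (by simp) x) (Finset.mem_univ (c x)))
      simp [hx]
    · rw [Set.indicator_of_notMem hx]
      exact Finset.sum_nonneg fun k _ => Set.indicator_nonneg (by simp) x
  by_contra! hlt
  have h2 : ∑ k, dens {x | x ∈ E ∧ c x = k} < ∑ _k : K, dens E / Nat.card K :=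
    Finset.sum_lt_sum_of_nonempty Finset.univ_nonempty fun k _ => hlt k
  rw [Finset.sum_const, Finset.card_univ, nsmul_eq_mul, Nat.card_eq_fintype_card,
    mul_div_cancel₀ _ (by positivity)] at h2
  linarith

theorem exists_avg_add_le_of_lt {Ω : Type*} [Finite Ω] {f : Ω → ℝ} {ε : ℝ} (x₀ : Ω)
    (h : f x₀ < avg f - ε) : ∃ x, avg f + ε / Nat.card Ω ≤ f x := by
  classical
  have := Fintype.ofFinite Ω
  by_contra! hlt
  have : Nonempty Ω := ⟨x₀⟩
  have h1 : 0 < avg fun x => (avg f + ε / Nat.card Ω - f x) := by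
    rw [avg_eq]
    exact div_pos (Finset.sum_pos (fun x _ => sub_pos.2 (hlt x)) Finset.univ_nonempty)
      (by positivity)
  have h2 : (ε + ε / Nat.card Ω) / Nat.card Ω < avg fun x => (avg f + ε / Nat.card Ω - f x) := by
    rw [avg_eq, Nat.card_eq_fintype_card]
    gcongr
    have := Finset.single_le_sum (f := fun x => avg f + ε / Nat.card Ω - f x)
      (fun x _ => (sub_pos.2 (hlt x)).le) (Finset.mem_univ x₀)
    rw [Nat.card_eq_fintype_card] at this
    linarith
  rw [avg_sub, avg_const, add_div] at h2
  rw [avg_sub, avg_const] at h1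
  rcases le_total 0 ε with hε | hε
  · have : 0 ≤ ε / Nat.card Ω / Nat.card Ω := by positivity
    linarith
  · have : ε / Nat.card Ω ≤ 0 := div_nonpos_of_nonpos_of_nonneg hε (by positivity)
    linarith

end Avg

/-! ### The density Hales-Jewett theorem and Varnavides' theorem -/

open Avg

namespace Cube

variable {X Y η η' ι : Type}

open scoped Classical in
/-- Combine two words on complementary coordinate sets. -/
noncomputable def glue (p : ι → Prop) (x : {i // p i} → X) (z : {i // ¬ p i} → X) : ι → X :=
  fun i => if h : p i then x ⟨i, h⟩ else z ⟨i, h⟩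

theorem glue_pos {p : ι → Prop} (x : {i // p i} → X) (z : {i // ¬ p i} → X) {i : ι} (h : p i) :
    glue p x z i = x ⟨i, h⟩ := by simp [glue, h]

theorem glue_neg {p : ι → Prop} (x : {i // p i} → X) (z : {i // ¬ p i} → X) {i : ι}
    (h : ¬ p i) : glue p x z i = z ⟨i, h⟩ := by simp [glue, h]

open scoped Classical in
theorem avg_split (p : ι → Prop) [Finite ι] [Finite X] (f : (ι → X) → ℝ) :
    avg f = avg fun z => avg fun x => f (glue p x z) := by
  rw [avg_comm, ← avg_prod fun q : ({i // p i} → X) × ({i // ¬ p i} → X) => f (glue p q.1 q.2),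
    ← avg_comp_equiv (Equiv.piEquivPiSubtypeProd p fun _ => X).symm f]
  rfl

theorem avg_split' (p : ι → Prop) [Finite ι] [Finite X] (f : (ι → X) → ℝ) :
    avg f = avg fun x => avg fun z => f (glue p x z) := by
  rw [avg_split p, avg_comm]

theorem dens_split (p : ι → Prop) [Finite ι] [Finite X] (A : Set (ι → X)) :
    dens A = avg fun z => dens {x | glue p x z ∈ A} := avg_split p _

theorem dens_split' (p : ι → Prop) [Finite ι] [Finite X] (A : Set (ι → X)) :
    dens A = avg fun x => dens {z | glue p x z ∈ A} := avg_split' p _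

theorem exists_card_subtype [Finite ι] {m : ℕ} (h : m ≤ Nat.card ι) :
    ∃ p : ι → Prop, Nat.card {i // p i} = m ∧ Nat.card {i // ¬ p i} = Nat.card ι - m := by
  classical
  have := Fintype.ofFinite ι
  rw [Nat.card_eq_fintype_card, ← Finset.card_univ] at h
  obtain ⟨s, -, hs⟩ := Finset.exists_subset_card_eq h
  refine ⟨fun i => i ∈ s, by simpa using hs, ?_⟩
  rw [Nat.card_eq_fintype_card, Nat.card_eq_fintype_card, Fintype.card_subtype_compl]
  simp [hs]

/-- Composition of subspaces. -/
def comp (V : Subspace η X ι) (U : Subspace η' X η) : Subspace η' X ι where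
  idxFun i := (V.idxFun i).elim Sum.inl U.idxFun
  proper e := by
    obtain ⟨j, hj⟩ := U.proper e
    obtain ⟨i, hi⟩ := V.proper j
    exact ⟨i, by simp [hi, hj]⟩

@[simp] theorem comp_apply (V : Subspace η X ι) (U : Subspace η' X η) (x : η' → X) :
    comp V U x = V (U x) := by
  funext i
  cases h : V.idxFun i <;> simp [Subspace.coe_apply, comp, h]

/-- The image of a line under a subspace. -/
def compLine (V : Subspace η X ι) (L : Line X η) : Line X ι where
  idxFun i := (V.idxFun i).elim some L.idxFun
  proper := by
    obtain ⟨j, hj⟩ := L.proper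
    obtain ⟨i, hi⟩ := V.proper j
    exact ⟨i, by simp [hi, hj]⟩

@[simp] theorem compLine_apply (V : Subspace η X ι) (L : Line X η) (a : X) :
    compLine V L a = V (L a) := by
  funext i
  cases h : V.idxFun i <;> simp [Subspace.coe_apply, compLine, h]

/-- Extend the alphabet of a subspace. -/
def mapSub (g : X → Y) (V : Subspace η X ι) : Subspace η Y ι where
  idxFun i := (V.idxFun i).map g id
  proper e := by
    obtain ⟨i, hi⟩ := V.proper e
    exact ⟨i, by simp [hi]⟩

/-- Regard a subspace in some of the coordinates as one in all coordinates, by fixing the others. -/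
noncomputable def extendLeft (p : ι → Prop) (U : Subspace η X {i // p i}) (z : {i // ¬ p i} → X) :
    Subspace η X ι where
  idxFun := glue p U.idxFun (Sum.inl ∘ z)
  proper e := by
    obtain ⟨i, hi⟩ := U.proper e
    exact ⟨i, by rw [glue_pos _ _ i.2, hi]⟩

@[simp] theorem extendLeft_apply (p : ι → Prop) (U : Subspace η X {i // p i})
    (z : {i // ¬ p i} → X) (x : η → X) : extendLeft p U z x = glue p (U x) z := by
  funext i
  by_cases h : p i <;> simp [Subspace.coe_apply, extendLeft, glue, h]

/-- Regard a subspace in some of the coordinates as one in all coordinates, by fixing the others. -/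
noncomputable def extendRight (p : ι → Prop) (x : {i // p i} → X) (V : Subspace η X {i // ¬ p i}) :
    Subspace η X ι where
  idxFun := glue p (Sum.inl ∘ x) V.idxFun
  proper e := by
    obtain ⟨i, hi⟩ := V.proper e
    exact ⟨i, by rw [glue_neg _ _ i.2, hi]⟩

@[simp] theorem extendRight_apply (p : ι → Prop) (x : {i // p i} → X)
    (V : Subspace η X {i // ¬ p i}) (y : η → X) : extendRight p x V y = glue p x (V y) := by
  funext i
  by_cases h : p i <;> simp [Subspace.coe_apply, extendRight, glue, h]

/-- The product of a line and a subspace in complementary sets of coordinates. -/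
noncomputable def lineProd {m : ℕ} (p : ι → Prop) (L : Line X {i // p i})
    (V : Subspace (Fin m) X {i // ¬ p i}) : Subspace (Fin (m + 1)) X ι where
  idxFun := glue p (fun i => (L.idxFun i).elim (Sum.inr 0) Sum.inl)
    fun i => (V.idxFun i).map id Fin.succ
  proper e := by
    refine Fin.cases ?_ (fun e => ?_) e
    · obtain ⟨i, hi⟩ := L.proper
      exact ⟨i, by rw [glue_pos _ _ i.2, hi]; rfl⟩
    · obtain ⟨i, hi⟩ := V.proper e
      exact ⟨i, by rw [glue_neg _ _ i.2, hi]; rfl⟩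

@[simp] theorem lineProd_apply {m : ℕ} (p : ι → Prop) (L : Line X {i // p i})
    (V : Subspace (Fin m) X {i // ¬ p i}) (x : Fin (m + 1) → X) :
    lineProd p L V x = glue p (L (x 0)) (V fun e => x e.succ) := by
  funext i
  by_cases h : p i
  · cases h2 : L.idxFun ⟨i, h⟩ <;> simp [Subspace.coe_apply, lineProd, glue, h, h2]
  · cases h2 : V.idxFun ⟨i, h⟩ <;> simp [Subspace.coe_apply, lineProd, glue, h, h2]

/-- A point, as a zero-dimensional subspace. -/
def pointSub (x : ι → X) : Subspace (Fin 0) X ι where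
  idxFun i := Sum.inl (x i)
  proper e := e.elim0

@[simp] theorem pointSub_apply (x : ι → X) (y : Fin 0 → X) : pointSub x y = x := rfl

/-- A bijection of coordinates, as a subspace. -/
def ofEquiv (e : ι ≃ η) : Subspace η X ι where
  idxFun i := Sum.inr (e i)
  proper j := ⟨e.symm j, by simp⟩

@[simp] theorem ofEquiv_apply (e : ι ≃ η) (x : η → X) : (ofEquiv e : Subspace η X ι) x = x ∘ e :=
  rfl

/-- An average over a cube is an average of averages over subspaces of a given smaller
dimension. -/
theorem avg_nonpos_of_subspace [Finite ι] [Finite X] {m : ℕ} (hm : m ≤ Nat.card ι)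
    (f : (ι → X) → ℝ) (h : ∀ V : Subspace (Fin m) X ι, avg (fun x => f (V x)) ≤ 0) :
    avg f ≤ 0 := by
  obtain ⟨p, hp, -⟩ := exists_card_subtype hm
  rw [avg_split p]
  refine avg_le_of_le le_rfl fun z => ?_
  have := hp ▸ Finite.equivFin {i // p i}
  refine le_trans (le_of_eq ?_) (h (extendLeft p (ofEquiv this) z))
  rw [← avg_comp_equiv (this.arrowCongr (Equiv.refl X)).symm]
  simp
  rfl

/-- There are finitely many lines in a finite cube. -/
instance [Finite X] [Finite ι] : Finite (Line X ι) :=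
  Finite.of_injective (fun L : Line X ι => L.idxFun) fun _ _ h => Line.ext h

/-- There are finitely many subspaces of a given dimension in a finite cube. -/
instance [Finite X] [Finite ι] [Finite η] : Finite (Subspace η X ι) :=
  Finite.of_injective (fun L : Subspace η X ι => L.idxFun) fun _ _ h => Subspace.ext h

/-- The density Hales–Jewett property of an alphabet. -/
def DHJ (X : Type) : Prop :=
  ∀ δ : ℝ, 0 < δ → ∃ N : ℕ, ∀ (ι : Type) [Finite ι], N ≤ Nat.card ι → ∀ A : Set (ι → X),
    δ ≤ dens A → ∃ L : Line X ι, ∀ a, L a ∈ A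

theorem card_line_le [Finite X] [Finite ι] :
    Nat.card (Line X ι) ≤ (Nat.card X + 1) ^ Nat.card ι := by
  have : Nat.card (Line X ι) ≤ Nat.card (ι → Option X) :=
    Nat.card_le_card_of_injective (fun L : Line X ι => L.idxFun) fun _ _ h => Line.ext h
  refine this.trans_eq ?_
  have := Fintype.ofFinite X
  rw [Nat.card_fun]
  simp [Nat.card_eq_fintype_card]

/-- The multidimensional density Hales–Jewett theorem follows from the one-dimensional one. -/
theorem DHJ.multidim [Finite X] (hX : DHJ X) (m : ℕ) : ∀ δ : ℝ, 0 < δ → ∃ N : ℕ, ∀ (ι : Type)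
    [Finite ι], N ≤ Nat.card ι → ∀ A : Set (ι → X), δ ≤ dens A →
    ∃ V : Subspace (Fin m) X ι, ∀ x, V x ∈ A := by
  induction m with
  | zero =>
    refine fun δ hδ => ⟨0, fun ι _ _ A hA => ?_⟩
    obtain ⟨x, hx⟩ := nonempty_of_dens_pos (hδ.trans_le hA)
    exact ⟨pointSub x, fun _ => hx⟩
  | succ m ih =>
    intro δ hδ
    obtain ⟨M, hM⟩ := hX (δ / 2) (by positivity)
    set K : ℕ := (Nat.card X + 1) ^ M with hK
    obtain ⟨N, hN⟩ := ih (δ / 2 / K) (by positivity)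
    refine ⟨M + N, fun ι _ hι A hA => ?_⟩
    obtain ⟨p, hp, hp'⟩ := exists_card_subtype (show M ≤ Nat.card ι by omega)
    rw [dens_split p] at hA
    have hE := le_dens_of_le_avg hδ (fun _ => dens_le_one _) hA
    set E : Set ({i // ¬ p i} → X) := {z | δ / 2 ≤ dens {x | glue p x z ∈ A}} with hEdef
    have hline : ∀ z ∈ E, ∃ L : Line X {i // p i}, ∀ a, glue p (L a) z ∈ A := fun z hz =>
      hM _ hp.ge {x | glue p x z ∈ A} hz
    obtain ⟨z₀, hz₀⟩ := nonempty_of_dens_pos ((half_pos hδ).trans_le hE)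
    obtain ⟨L₀, -⟩ := hline z₀ hz₀
    have : Nonempty (Line X {i // p i}) := ⟨L₀⟩
    choose! c hc using hline
    obtain ⟨L, hL⟩ := exists_dens_fiber_ge E c
    have hcard : (Nat.card (Line X {i // p i}) : ℝ) ≤ K := by
      rw [hK, ← hp]
      exact_mod_cast card_line_le
    have hcard0 : 0 < (Nat.card (Line X {i // p i}) : ℝ) := by
      exact_mod_cast Nat.card_pos
    have hE0 : 0 ≤ dens E := dens_nonneg E
    obtain ⟨V, hV⟩ := hN {i // ¬ p i} (by omega) {z | z ∈ E ∧ c z = L} (by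
      refine le_trans ?_ hL
      gcongr)
    refine ⟨lineProd p L V, fun x => ?_⟩
    rw [lineProd_apply]
    obtain ⟨h1, h2⟩ := hV fun e => x e.succ
    have := hc _ h1 (x 0)
    rwa [h2] at this

/-- A family of events of probability bounded below indexed by a large cube contains a line of
events whose intersection has probability bounded below. -/
theorem DHJ.exists_line_inter [Finite X] [Nonempty X] (hX : DHJ X) {δ : ℝ} (hδ : 0 < δ) :
    ∃ N : ℕ, ∃ θ : ℝ, 0 < θ ∧ ∀ (ι : Type) [Finite ι], N ≤ Nat.card ι →
      ∀ (Ω : Type) [Finite Ω] (B : (ι → X) → Set Ω), (∀ z, δ ≤ dens (B z)) →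
        ∃ L : Line X ι, θ ≤ dens {ω | ∀ a, ω ∈ B (L a)} := by
  obtain ⟨M, hM⟩ := hX (δ / 2) (by positivity)
  set K : ℕ := (Nat.card X + 1) ^ M with hK
  refine ⟨M, δ / 2 / K, by positivity, fun ι _ hι Ω _ B hB => ?_⟩
  obtain ⟨p, hp, -⟩ := exists_card_subtype hι
  obtain ⟨z⟩ : Nonempty ({i // ¬ p i} → X) := inferInstance
  have h1 : δ ≤ avg fun ω : Ω => dens {x | ω ∈ B (glue p x z)} := by
    have : ∀ x : {i // p i} → X, δ ≤ avg fun ω : Ω => (B (glue p x z)).indicator 1 ω :=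
      fun x => hB _
    have h2 := avg_mono this
    rw [avg_const, avg_comm] at h2
    exact h2
  have hE := le_dens_of_le_avg hδ (fun _ => dens_le_one _) h1
  set E : Set Ω := {ω | δ / 2 ≤ dens {x | ω ∈ B (glue p x z)}} with hEdef
  have hline : ∀ ω ∈ E, ∃ L : Line X {i // p i}, ∀ a, ω ∈ B (glue p (L a) z) := fun ω hω =>
    hM _ hp.ge {x | ω ∈ B (glue p x z)} hω
  obtain ⟨ω₀, hω₀⟩ := nonempty_of_dens_pos ((half_pos hδ).trans_le hE)
  obtain ⟨L₀, -⟩ := hline ω₀ hω₀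
  have : Nonempty (Line X {i // p i}) := ⟨L₀⟩
  choose! c hc using hline
  obtain ⟨L, hL⟩ := exists_dens_fiber_ge E c
  have hcard : (Nat.card (Line X {i // p i}) : ℝ) ≤ K := by
    rw [hK, ← hp]
    exact_mod_cast card_line_le
  have hcard0 : 0 < (Nat.card (Line X {i // p i}) : ℝ) := by
    exact_mod_cast Nat.card_pos
  have hE0 : 0 ≤ dens E := dens_nonneg E
  refine ⟨compLine (extendLeft p (ofEquiv (Equiv.refl _)) z) L, ?_⟩
  refine le_trans (le_trans (by gcongr) hL) (dens_mono ?_)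
  rintro ω ⟨h1, rfl⟩ a
  simpa using hc ω h1 a

theorem exists_line_mono (X κ : Type) [Finite X] [Nonempty X] [Finite κ] : ∃ N : ℕ, ∀ (ι : Type)
    [Finite ι], N ≤ Nat.card ι → ∀ c : (ι → X) → κ, ∃ L : Line X ι, L.IsMono c := by
  obtain ⟨ι₀, _, h⟩ := Line.exists_mono_in_high_dimension X κ
  refine ⟨Nat.card ι₀, fun ι _ hι c => ?_⟩
  obtain ⟨p, hp, -⟩ := exists_card_subtype hι
  obtain ⟨z⟩ : Nonempty ({i // ¬ p i} → X) := inferInstance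
  let e : {i // p i} ≃ ι₀ := Classical.choice (Finite.card_eq.1 hp)
  let V : Subspace ι₀ X ι := extendLeft p (ofEquiv e) z
  obtain ⟨L, k, hk⟩ := h fun y => c (V y)
  exact ⟨compLine V L, k, fun x => by rw [compLine_apply]; exact hk x⟩

theorem mapSub_lineProd {m : ℕ} (p : ι → Prop) (L : Line X {i // p i})
    (V : Subspace (Fin m) X {i // ¬ p i}) (w : Fin (m + 1) → Option X) :
    mapSub some (lineProd p L V) w =
      glue p (fun i => (L.idxFun i).elim (w 0) some) (mapSub some V fun e => w e.succ) := by
  funext i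
  by_cases h : p i
  · cases h2 : L.idxFun ⟨i, h⟩ <;> simp [Subspace.coe_apply, lineProd, mapSub, glue, h, h2]
  · cases h2 : V.idxFun ⟨i, h⟩ <;> simp [Subspace.coe_apply, lineProd, mapSub, glue, h, h2]

theorem mapSub_comp_apply (g : X → Y) (V : Subspace η X ι) (U : Subspace η' X η) (w : η' → Y) :
    mapSub g (comp V U) w = mapSub g V (mapSub g U w) := by
  funext i
  cases h : V.idxFun i <;> simp [Subspace.coe_apply, comp, mapSub, h]

/-- For every finite colouring of the words with a blank symbol there is a subspace in which the
colour of a word is determined by the positions of the blanks. -/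
theorem exists_subspace_color_eq (X : Type) [Finite X] [Nonempty X] (m : ℕ) :
    ∀ (κ : Type) [Finite κ], ∃ N : ℕ, ∀ (ι : Type) [Finite ι], N ≤ Nat.card ι →
      ∀ c : (ι → Option X) → κ, ∃ U : Subspace (Fin m) X ι, ∀ w w' : Fin m → Option X,
        (∀ e, w e = none ↔ w' e = none) → c (mapSub some U w) = c (mapSub some U w') := by
  induction m with
  | zero =>
    refine fun κ _ => ⟨0, fun ι _ _ c => ?_⟩
    obtain ⟨x⟩ : Nonempty (ι → X) := inferInstance
    exact ⟨pointSub x, fun w w' _ => by rw [Subsingleton.elim w w']⟩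
  | succ m ih =>
    intro κ _
    obtain ⟨N', hN'⟩ := ih (κ × κ)
    obtain ⟨N₁, hN₁⟩ := exists_line_mono X ((Fin N' → Option X) → κ)
    refine ⟨N₁ + N', fun ι _ hι c => ?_⟩
    obtain ⟨p, hp, hp'⟩ := exists_card_subtype (show Nat.card ι - N' ≤ Nat.card ι by omega)
    have hp'' : Nat.card {i // ¬ p i} = Nat.card (Fin N') := by
      rw [hp', Nat.card_fin]; omega
    let e : {i // ¬ p i} ≃ Fin N' := Classical.choice (Finite.card_eq.1 hp'')
    obtain ⟨L, k, hk⟩ := hN₁ {i // p i} (by omega)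
      fun y v => c (glue p (fun i => some (y i)) fun i => v (e i))
    obtain ⟨a₀⟩ : Nonempty X := inferInstance
    have hL : ∀ a v, c (glue p (fun i => some (L a i)) v) =
        c (glue p (fun i => some (L a₀ i)) v) := by
      intro a v
      have := congrFun ((hk a).trans (hk a₀).symm) (v ∘ e.symm)
      simpa using this
    obtain ⟨U, hU⟩ := hN' {i // ¬ p i} (by rw [hp'', Nat.card_fin])
      fun v => (c (glue p (fun i => some (L a₀ i)) v), c (glue p L.idxFun v))
    refine ⟨lineProd p L U, fun w w' hw => ?_⟩
    have hU' := hU (fun e => w e.succ) (fun e => w' e.succ) fun e => hw e.succ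
    rw [Prod.mk.injEq] at hU'
    have key : ∀ (w : Fin (m + 1) → Option X), c (mapSub some (lineProd p L U) w) =
        if w 0 = none then c (glue p L.idxFun (mapSub some U fun e => w e.succ))
        else c (glue p (fun i => some (L a₀ i)) (mapSub some U fun e => w e.succ)) := by
      intro w
      rw [mapSub_lineProd]
      cases h : w 0 with
      | none =>
        simp only [if_true]
        congr 2
        funext i
        cases h2 : L.idxFun i <;> simp
      | some a =>
        rw [if_neg (by simp), ← hL a]
        congr 2
        funext i
        cases h2 : L.idxFun i <;> simp [h2]
    rw [key, key, hU'.1, hU'.2]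
    simp only [hw 0]

/-- For every finite colouring of the subsets of a large set there are nonempty pairwise disjoint
sets for which the colour of a union is determined by the least index involved. -/
theorem exists_disjoint_color_eq_min (κ : Type) [Finite κ] (n : ℕ) : ∃ M : ℕ,
    ∀ c : Set (Fin M) → κ, ∃ S : Fin n → Set (Fin M), (∀ i, (S i).Nonempty) ∧
      (∀ i j x, x ∈ S i → x ∈ S j → i = j) ∧ ∃ g : Fin n → κ, ∀ (T : Set (Fin n)) (i : Fin n),
        i ∈ T → (∀ j ∈ T, i ≤ j) → c {x | ∃ j ∈ T, x ∈ S j} = g i := by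
  classical
  induction n with
  | zero => exact ⟨0, fun c => ⟨Fin.elim0, fun i => i.elim0, fun i => i.elim0, Fin.elim0,
      fun T i => i.elim0⟩⟩
  | succ n ih =>
    obtain ⟨M, hM⟩ := ih
    obtain ⟨N, hN⟩ := Subspace.exists_mono_in_high_dimension_fin Bool κ (Fin (M + 1))
    refine ⟨N, fun c => ?_⟩
    obtain ⟨l, k, hl⟩ := hN fun w => c {i | w i = true}
    obtain ⟨S, hS, hdisj, g, hg⟩ := hM fun T => c {x | ∃ e ∈ T, l.idxFun x = Sum.inr e.succ}
    refine ⟨Fin.cons {x | l.idxFun x = Sum.inl true ∨ l.idxFun x = Sum.inr 0}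
      fun j => {x | ∃ e ∈ S j, l.idxFun x = Sum.inr e.succ}, ?_, ?_, Fin.cons k g, ?_⟩
    · refine Fin.cases ?_ fun j => ?_
      · obtain ⟨x, hx⟩ := l.proper 0
        exact ⟨x, Or.inr hx⟩
      · obtain ⟨e, he⟩ := hS j
        obtain ⟨x, hx⟩ := l.proper e.succ
        exact ⟨x, e, he, hx⟩
    · refine Fin.cases (Fin.cases (fun _ _ _ => rfl) fun j x => ?_)
        fun i => Fin.cases (fun x => ?_) fun j x => ?_
      · rintro (h | h) ⟨e, -, he⟩ <;> simp [h, Fin.ext_iff] at he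
      · rintro ⟨e, -, he⟩ (h | h) <;> simp [h, Fin.ext_iff] at he
      · rintro ⟨e, he, h⟩ ⟨e', he', h'⟩
        rw [h, Sum.inr.injEq, Fin.succ_inj] at h'
        subst h'
        rw [hdisj i j e he he']
    · intro T i hi hmin
      induction i using Fin.cases with
      | zero =>
        rw [Fin.cons_zero, ← hl (Fin.cons true fun e => decide (∃ j, j.succ ∈ T ∧ e ∈ S j))]
        congr 1
        ext x
        simp only [Set.mem_ofPred_eq, Subspace.coe_apply]
        constructor
        · rintro ⟨j, hj, hx⟩
          induction j using Fin.cases with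
          | zero => rcases hx with h | h <;> simp [h]
          | succ j =>
            obtain ⟨e, he, h⟩ := hx
            simp only [h, Sum.elim_inr, Fin.cons_succ, decide_eq_true_eq]
            exact ⟨j, hj, he⟩
        · intro h
          cases h2 : l.idxFun x with
          | inl b => exact ⟨0, hi, Or.inl (by simpa [h2] using h)⟩
          | inr e =>
            induction e using Fin.cases with
            | zero => exact ⟨0, hi, Or.inr h2⟩
            | succ e =>
              simp only [h2, Sum.elim_inr, Fin.cons_succ, decide_eq_true_eq] at h
              obtain ⟨j, hj, he⟩ := h
              exact ⟨j.succ, hj, e, he, h2⟩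
      | succ i =>
        rw [Fin.cons_succ, ← hg {j | j.succ ∈ T} i hi fun j hj => by simpa using hmin _ hj]
        congr 1
        ext x
        constructor
        · rintro ⟨j, hj, hx⟩
          induction j using Fin.cases with
          | zero => exact absurd (hmin _ hj) (by simp)
          | succ j =>
            obtain ⟨e, he, h⟩ := hx
            exact ⟨e, ⟨j, hj, he⟩, h⟩
        · rintro ⟨e, ⟨j, hj, he⟩, h⟩
          exact ⟨j.succ, hj, e, he, h⟩

/-- The finite unions theorem. -/
theorem exists_disjoint_color_eq (κ : Type) [Finite κ] [Nonempty κ] (n : ℕ) : ∃ M : ℕ,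
    ∀ c : Set (Fin M) → κ, ∃ S : Fin n → Set (Fin M), (∀ i, (S i).Nonempty) ∧
      (∀ i j x, x ∈ S i → x ∈ S j → i = j) ∧ ∃ k : κ, ∀ T : Set (Fin n), T.Nonempty →
        c {x | ∃ j ∈ T, x ∈ S j} = k := by
  classical
  have := Fintype.ofFinite κ
  obtain ⟨M, hM⟩ := exists_disjoint_color_eq_min κ (Fintype.card κ * n)
  refine ⟨M, fun c => ?_⟩
  obtain ⟨S, hS, hdisj, g, hg⟩ := hM c
  obtain ⟨k, hk⟩ := Fintype.exists_le_card_fiber_of_mul_le_card g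
    (n := n) (by simp)
  obtain ⟨s, hs, hsn⟩ := Finset.exists_subset_card_eq hk
  let σ : Fin n ≃ s := (Finset.equivFinOfCardEq hsn).symm
  refine ⟨fun i => S (σ i).1, fun i => hS _, fun i j x hi hj => ?_, k, fun T hT => ?_⟩
  · exact σ.injective (Subtype.ext (hdisj _ _ x hi hj))
  · have hfin : ((fun i => (σ i).1) '' T).Finite := Set.toFinite _
    obtain ⟨i, hi, hmin⟩ := Set.exists_min_image _ id hfin (hT.image _)
    have h1 := hg _ i hi hmin
    obtain ⟨j, hj, rfl⟩ := hi
    have h2 : g (σ j).1 = k := by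
      have := hs (σ j).2
      simpa using this
    rw [← h2, ← h1]
    congr 1
    ext x
    simp

/-- The Graham–Rothschild theorem for lines: words with at least one blank are lines. -/
theorem exists_subspace_line_color_eq (X κ : Type) [Finite X] [Nonempty X] [Finite κ] (d : ℕ) :
    ∃ N : ℕ, ∀ (ι : Type) [Finite ι], N ≤ Nat.card ι →
      ∀ c : (ι → Option X) → κ, ∃ U : Subspace (Fin d) X ι, ∃ k : κ, ∀ w : Fin d → Option X,
        (∃ e, w e = none) → c (mapSub some U w) = k := by
  classical
  cases isEmpty_or_nonempty κ
  · exact ⟨0, fun ι _ _ c => isEmptyElim (c fun _ => none)⟩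
  obtain ⟨M, hM⟩ := exists_disjoint_color_eq κ d
  obtain ⟨N, hN⟩ := exists_subspace_color_eq X M κ
  refine ⟨N, fun ι _ hι c => ?_⟩
  obtain ⟨a₀⟩ : Nonempty X := inferInstance
  obtain ⟨U, hU⟩ := hN ι hι c
  obtain ⟨S, hS, hdisj, k, hk⟩ := hM fun T =>
    c (mapSub some U fun e => if e ∈ T then none else some a₀)
  let f : Fin M → X ⊕ Fin d := fun x =>
    if h : ∃ i, x ∈ S i then Sum.inr h.choose else Sum.inl a₀
  have hf : ∀ x i, x ∈ S i → f x = Sum.inr i := by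
    intro x i hx
    have h : ∃ i, x ∈ S i := ⟨i, hx⟩
    simp only [f, h, dif_pos]
    rw [hdisj _ _ x h.choose_spec hx]
  have hf' : ∀ x, (¬ ∃ i, x ∈ S i) → f x = Sum.inl a₀ := by
    intro x hx
    simp only [f, hx, dif_neg, not_false_eq_true]
  let W : Subspace (Fin d) X (Fin M) := ⟨f, fun e => (hS e).imp fun x hx => hf x e hx⟩
  refine ⟨comp U W, k, fun w hw => ?_⟩
  rw [← hk {e | w e = none} hw, mapSub_comp_apply]
  refine hU _ _ fun x => ?_
  by_cases hx : ∃ i, x ∈ S i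
  · obtain ⟨i, hi⟩ := hx
    have h1 : (∃ j, w j = none ∧ x ∈ S j) ↔ w i = none :=
      ⟨fun ⟨j, hj, hxj⟩ => hdisj _ _ _ hxj hi ▸ hj, fun h => ⟨i, h, hi⟩⟩
    simp [Subspace.coe_apply, mapSub, W, hf x i hi, h1]
  · have h1 : ¬ ∃ j, w j = none ∧ x ∈ S j := fun ⟨j, _, hxj⟩ => hx ⟨j, hxj⟩
    simp only [Subspace.coe_apply, mapSub, W, hf' x hx, Set.mem_ofPred_eq, h1]
    simp

theorem avg_prod_coord [Fintype ι] [Finite X] (g : X → ℝ) :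
    avg (fun w : ι → X => ∏ i, g (w i)) = avg g ^ Nat.card ι := by
  classical
  have := Fintype.ofFinite X
  rw [avg_eq, avg_eq, div_pow, Fintype.card_fun, Nat.card_eq_fintype_card]
  push_cast
  congr 1
  rw [← Finset.card_univ, ← Finset.prod_const, Finset.prod_univ_sum]
  simp

theorem avg_option_lt_one [Finite X] (t : ℝ) (ht : t < 1) [Nonempty X] :
    avg (fun o : Option X => o.elim 1 fun _ => t) < 1 := by
  have := Fintype.ofFinite X
  rw [avg_eq, div_lt_one (by positivity), Fintype.sum_option, Fintype.card_option]
  simp only [Option.elim, Finset.sum_const, Finset.card_univ, nsmul_eq_mul]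
  have : (0 : ℝ) < Fintype.card X := by positivity
  push_cast
  nlinarith

/-- Most words over an extended alphabet have many letters that are not blank. -/
theorem exists_dens_few_lt (X : Type) [Finite X] [Nonempty X] (N : ℕ) {ε : ℝ} (hε : 0 < ε) :
    ∃ M : ℕ, ∀ (ι : Type) [Finite ι], M ≤ Nat.card ι →
      dens {w : ι → Option X | Nat.card {i // w i ≠ none} < N} < ε := by
  classical
  set q : ℝ := avg (fun o : Option X => o.elim 1 fun _ => (1 / 2 : ℝ)) with hq
  have hq1 : q < 1 := avg_option_lt_one _ (by norm_num)
  have hq0 : 0 ≤ q := avg_nonneg fun o => by cases o <;> simp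
  obtain ⟨M, hM⟩ := exists_pow_lt_of_lt_one (show 0 < ε / 2 ^ N by positivity) hq1
  refine ⟨M, fun ι _ hι => ?_⟩
  have := Fintype.ofFinite ι
  have h : dens {w : ι → Option X | Nat.card {i // w i ≠ none} < N} ≤ avg fun w : ι → Option X =>
      2 ^ N * ∏ i, (w i).elim 1 fun _ => (1 / 2 : ℝ) := by
    refine avg_mono fun w => ?_
    have hprod : ∏ i, (w i).elim 1 (fun _ => (1 / 2 : ℝ)) =
        (1 / 2) ^ Nat.card {i // w i ≠ none} := by
      have : ∀ i, (w i).elim 1 (fun _ => (1 / 2 : ℝ)) = if w i ≠ none then 1 / 2 else 1 := by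
        intro i
        cases w i <;> simp
      simp only [this, Finset.prod_ite, Finset.prod_const, one_pow, mul_one]
      rw [Nat.card_eq_fintype_card, Fintype.card_subtype]
    rw [hprod]
    by_cases hw : Nat.card {i // w i ≠ none} < N
    · rw [Set.indicator_of_mem (by exact hw), one_div, inv_pow, ← div_eq_mul_inv, Pi.one_apply,
        one_le_div (by positivity)]
      exact pow_le_pow_right₀ (by norm_num) hw.le
    · rw [Set.indicator_of_notMem (by exact hw)]
      positivity
  rw [avg_mul_left, avg_prod_coord fun o : Option X => o.elim 1 fun _ => (1 / 2 : ℝ)] at h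
  have h2 : q ^ Nat.card ι ≤ q ^ M := pow_le_pow_of_le_one hq0 hq1.le hι
  rw [lt_div_iff₀ (by positivity)] at hM
  calc _ ≤ _ := h
    _ ≤ 2 ^ N * q ^ M := by gcongr
    _ < ε := by linarith

/-- Few words over an extended alphabet have no blank. -/
theorem exists_dens_no_blank_lt (X : Type) [Finite X] {ε : ℝ} (hε : 0 < ε) :
    ∃ M : ℕ, ∀ (ι : Type) [Finite ι], M ≤ Nat.card ι →
      dens {w : ι → Option X | ∀ i, w i ≠ none} < ε := by
  classical
  set q : ℝ := avg (fun o : Option X => o.elim 0 fun _ => (1 : ℝ)) with hq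
  have hq1 : q < 1 := by
    have := Fintype.ofFinite X
    rw [hq, avg_eq, div_lt_one (by positivity), Fintype.sum_option, Fintype.card_option]
    simp
  have hq0 : 0 ≤ q := avg_nonneg fun o => by cases o <;> simp
  obtain ⟨M, hM⟩ := exists_pow_lt_of_lt_one hε hq1
  refine ⟨M, fun ι _ hι => ?_⟩
  have := Fintype.ofFinite ι
  refine lt_of_le_of_lt ?_ ((pow_le_pow_of_le_one hq0 hq1.le hι).trans_lt hM)
  rw [hq, ← avg_prod_coord fun o : Option X => o.elim 0 fun _ => (1 : ℝ)]
  refine avg_mono fun w => ?_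
  by_cases hw : ∀ i, w i ≠ none
  · rw [Set.indicator_of_mem (by exact hw), Finset.prod_eq_one fun i _ => ?_]
    · rfl
    · obtain ⟨a, ha⟩ := Option.ne_none_iff_exists'.1 (hw i)
      simp [ha]
  · rw [Set.indicator_of_notMem (by exact hw)]
    exact Finset.prod_nonneg fun i _ => by cases w i <;> simp

/-- Averaging over all words is the same as averaging over all words and all ways to replace their
letters that are not blank. -/
theorem avg_merge [Finite X] [Nonempty X] [Finite ι] (f : (ι → Option X) → ℝ) :
    avg f = avg fun w : ι → Option X => avg fun y : ι → X => f fun i => (w i).map fun _ => y i := by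
  let Φ : (ι → Option X) × (ι → X) → (ι → Option X) × (ι → X) := fun q =>
    (fun i => (q.1 i).map fun _ => q.2 i, fun i => (q.1 i).getD (q.2 i))
  have hΦ : Function.Involutive Φ := by
    rintro ⟨w, y⟩
    refine Prod.ext (funext fun i => ?_) (funext fun i => ?_) <;> cases h : w i <;> simp [Φ, h]
  rw [← avg_prod fun q : (ι → Option X) × (ι → X) => f fun i => (q.1 i).map fun _ => q.2 i]
  have h1 : avg f = avg fun q : (ι → Option X) × (ι → X) => f q.1 := by
    rw [avg_prod]
    simp only [avg_const]
  rw [h1, ← avg_comp_equiv hΦ.toPerm]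
  rfl

/-- A set of words is insensitive with respect to `a` if membership does not change when blanks are
exchanged with `a`. -/
def Insensitive (a : X) (D : Set (ι → Option X)) : Prop :=
  ∀ w w' : ι → Option X, (∀ i, (w i).getD a = (w' i).getD a) → w ∈ D → w' ∈ D

theorem Insensitive.preimage {a : X} {D : Set (ι → Option X)} (hD : Insensitive a D)
    (V : Subspace η (Option X) ι) : Insensitive a {x | V x ∈ D} := by
  intro w w' h hw
  refine hD _ _ (fun i => ?_) hw
  cases h2 : V.idxFun i <;> simp [Subspace.coe_apply, h2, h]

theorem Insensitive.compl {a : X} {D : Set (ι → Option X)} (hD : Insensitive a D) :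
    Insensitive a Dᶜ :=
  fun w w' h hw hw' => hw (hD w' w (fun i => (h i).symm) hw')

/-- A dense insensitive set contains a subspace, provided that the density Hales–Jewett theorem
holds for the smaller alphabet. -/
theorem DHJ.exists_subspace_of_insensitive [Finite X] [Nonempty X] (hX : DHJ X) (m : ℕ) {ε : ℝ}
    (hε : 0 < ε) : ∃ M : ℕ, ∀ (ι : Type) [Finite ι], M ≤ Nat.card ι → ∀ (a : X)
      (D : Set (ι → Option X)), Insensitive a D → ε ≤ dens D →
        ∃ V : Subspace (Fin m) (Option X) ι, ∀ x, V x ∈ D := by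
  obtain ⟨N, hN⟩ := hX.multidim m (ε / 2) (by positivity)
  obtain ⟨M, hM⟩ := exists_dens_few_lt X N (half_pos hε)
  refine ⟨M, fun ι _ hι a D hD hdens => ?_⟩
  rw [dens, avg_merge] at hdens
  have h1 := le_dens_of_le_avg hε (fun w => avg_le_of_le zero_le_one fun y =>
    indicator_one_le D _) hdens
  obtain ⟨w, hw, hwN⟩ : ∃ w, w ∈ {w : ι → Option X | ε / 2 ≤ avg fun y : ι → X =>
      D.indicator (1 : (ι → Option X) → ℝ) fun i => (w i).map fun _ => y i} ∧
      N ≤ Nat.card {i // w i ≠ none} := by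
    by_contra! hcon
    exact absurd (h1.trans (dens_mono hcon)) (not_le.2 (hM ι hι))
  simp only [Set.mem_ofPred_eq] at hw
  let p : ι → Prop := fun i => w i ≠ none
  rw [avg_split p] at hw
  obtain ⟨z, hz⟩ := exists_le_of_le_avg hw
  obtain ⟨V, hV⟩ := hN {i // p i} hwN
    {x | (fun i => (w i).map fun _ => glue p x z i) ∈ D} hz
  refine ⟨extendLeft p (mapSub some V) (fun _ => none), fun x => ?_⟩
  refine hD _ _ (fun i => ?_) (hV fun e => (x e).getD a)
  rw [extendLeft_apply]
  by_cases h : w i = none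
  · rw [glue_neg (p := p) _ (fun _ => none) (not_not.2 h)]
    simp [h]
  · obtain ⟨b, hb⟩ := Option.ne_none_iff_exists'.1 h
    rw [glue_pos (p := p) _ _ h, glue_pos (p := p) _ _ h]
    cases h2 : V.idxFun ⟨i, h⟩ <;> simp [Subspace.coe_apply, mapSub, h2, hb]

theorem subspace_injective (V : Subspace η X ι) : Function.Injective V := by
  intro x y h
  funext e
  obtain ⟨i, hi⟩ := V.proper e
  have := congrFun h i
  rwa [Subspace.apply_inr hi, Subspace.apply_inr hi] at this

theorem avg_indicator_range_nonpos [Finite X] [Finite η] [Finite ι] (V : Subspace η X ι)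
    (f : (ι → X) → ℝ) (hf : avg (fun x => f (V x)) ≤ 0) :
    avg ((Set.range V).indicator f) ≤ 0 := by
  classical
  have := Fintype.ofFinite X
  have := Fintype.ofFinite η
  have := Fintype.ofFinite ι
  have hsum : ∑ w, (Set.range V).indicator f w = ∑ x, f (V x) := by
    rw [← Finset.sum_image (s := Finset.univ) (g := V) (f := f) (subspace_injective V).injOn]
    simp only [Set.indicator_apply]
    rw [← Finset.sum_filter]
    refine Finset.sum_congr ?_ fun _ _ => rfl
    ext w
    simp
  rw [avg_eq] at hf ⊢
  rw [hsum]
  cases isEmpty_or_nonempty (η → X)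
  · simp
  have hpos : (0 : ℝ) < Fintype.card (η → X) := by positivity
  have h0 : ∑ x, f (V x) ≤ 0 := by
    by_contra! h
    exact absurd hf (not_le.2 (div_pos h hpos))
  exact div_nonpos_of_nonpos_of_nonneg h0 (by positivity)

theorem avg_indicator_le_dens {Ω : Type} [Finite Ω] (D : Set Ω) {f : Ω → ℝ} (hf : ∀ x, f x ≤ 1) :
    avg (D.indicator f) ≤ dens D :=
  avg_mono fun _ => Set.indicator_le_indicator (hf _)

theorem Insensitive.fiber {a : X} {D : Set (ι → Option X)} (hD : Insensitive a D) (p : ι → Prop)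
    (z : {i // ¬ p i} → Option X) : Insensitive a {x | glue p x z ∈ D} := by
  intro x x' h hx
  refine hD _ _ (fun i => ?_) hx
  by_cases hi : p i <;> simp [glue, hi, h]

theorem Insensitive.fiber_eq {a : X} {D : Set (ι → Option X)} (hD : Insensitive a D) (p : ι → Prop)
    {z z' : {i // ¬ p i} → Option X} (h : ∀ i, (z i).getD a = (z' i).getD a) :
    {x | glue p x z ∈ D} = {x | glue p x z' ∈ D} := by
  ext x
  constructor <;> refine hD _ _ fun i => ?_ <;> by_cases hi : p i <;> simp [glue, hi, h]

open scoped Classical in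
/-- The point set of some `m`-dimensional subspace contained in `S`, if there is one. -/
noncomputable def someSubspace (m : ℕ) (S : Set (ι → X)) : Set (ι → X) :=
  if h : ∃ V : Subspace (Fin m) X ι, ∀ x, V x ∈ S then Set.range h.choose else ∅

theorem someSubspace_subset (m : ℕ) (S : Set (ι → X)) : someSubspace m S ⊆ S := by
  rw [someSubspace]
  split_ifs with h
  · rintro _ ⟨x, rfl⟩
    exact h.choose_spec x
  · exact Set.empty_subset _

theorem someSubspace_nonempty [Nonempty X] {m : ℕ} {S : Set (ι → X)}
    (h : ∃ V : Subspace (Fin m) X ι, ∀ x, V x ∈ S) : (someSubspace m S).Nonempty := by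
  rw [someSubspace, dif_pos h]
  exact Set.range_nonempty _

theorem avg_indicator_someSubspace [Finite X] [Finite ι] (m : ℕ) (S : Set (ι → X))
    (f : (ι → X) → ℝ) (hf : ∀ V : Subspace (Fin m) X ι, avg (fun x => f (V x)) ≤ 0) :
    avg ((someSubspace m S).indicator f) ≤ 0 := by
  rw [someSubspace]
  split_ifs with h
  · exact avg_indicator_range_nonpos _ f (hf _)
  · simp [avg]

theorem avg_avg_indicator_insensitive_le [Finite X] [Nonempty X] {m M : ℕ} {ε : ℝ} (hε : 0 < ε)
    (a : X) (hM : ∀ (ι : Type) [Finite ι], M ≤ Nat.card ι → ∀ D : Set (ι → Option X),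
      Insensitive a D → ε / 2 ≤ dens D →
        ∃ V : Subspace (Fin m) (Option X) ι, ∀ x, V x ∈ D) (j : ℕ) :
    ∀ (ι : Type) [Finite ι], j * M ≤ Nat.card ι → ∀ (Y : Type) [Finite Y]
      (D : Y → Set (ι → Option X)) (g : Y → (ι → Option X) → ℝ), (∀ y, Insensitive a (D y)) →
      (∀ y x, g y x ≤ 1) →
      (∀ y, ∀ V : Subspace (Fin m) (Option X) ι, avg (fun x => g y (V x)) ≤ 0) →
      avg (fun y => avg ((D y).indicator (g y))) ≤
        ε + max 0 (avg (fun y => dens (D y)) -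
          j * (ε / 2 * ((Nat.card (Option X) : ℝ) ^ M)⁻¹)) := by
  induction j with
  | zero =>
    intro ι _ hι Y _ D g hD hg hV
    have h : avg (fun y => avg ((D y).indicator (g y))) ≤ avg fun y => dens (D y) :=
      avg_mono fun y => avg_indicator_le_dens _ (hg y)
    have := le_max_right 0 (avg (fun y => dens (D y)) -
      (0 : ℕ) * (ε / 2 * ((Nat.card (Option X) : ℝ) ^ M)⁻¹))
    simp only [Nat.cast_zero, zero_mul, sub_zero] at this ⊢
    linarith
  | succ j ih =>
    intro ι _ hι Y _ D g hD hg hV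
    set c := ε / 2 * ((Nat.card (Option X) : ℝ) ^ M)⁻¹ with hc
    have hle : avg (fun y => avg ((D y).indicator (g y))) ≤ avg fun y => dens (D y) :=
      avg_mono fun y => avg_indicator_le_dens _ (hg y)
    rcases lt_or_ge (avg fun y => dens (D y)) ε with hlt | hge
    · have := le_max_left 0 (avg (fun y => dens (D y)) - (j + 1 : ℕ) * c)
      linarith
    rw [add_mul, one_mul] at hι
    obtain ⟨p, hp, hp'⟩ := exists_card_subtype (show M ≤ Nat.card ι by omega)
    let fib : Y → ({i // ¬ p i} → Option X) → Set ({i // p i} → Option X) :=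
      fun y z => {x | glue p x z ∈ D y}
    let D' : Y × ({i // p i} → Option X) → Set ({i // ¬ p i} → Option X) := fun q =>
      {z | q.2 ∈ fib q.1 z \ someSubspace m (fib q.1 z)}
    let g' : Y × ({i // p i} → Option X) → ({i // ¬ p i} → Option X) → ℝ := fun q z =>
      g q.1 (glue p q.2 z)
    have key := ih {i // ¬ p i} (by omega) (Y × ({i // p i} → Option X)) D' g' (by
        rintro ⟨y, x⟩ z z' h hz
        have : fib y z = fib y z' := (hD y).fiber_eq p h
        simp only [D', Set.mem_ofPred_eq, ← this] at hz ⊢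
        exact hz) (fun q z => hg _ _) (by
        rintro ⟨y, x⟩ V
        simpa [g'] using hV y (extendRight p x V))
    have h1 : avg (fun y => avg ((D y).indicator (g y))) ≤
        avg fun q => avg ((D' q).indicator (g' q)) := by
      rw [avg_prod]
      refine avg_mono fun y => ?_
      rw [avg_split p, avg_comm fun x => fun z => (D' (y, x)).indicator (g' (y, x)) z]
      refine avg_mono fun z => ?_
      have h2 := avg_indicator_someSubspace m (fib y z) (fun x => g y (glue p x z)) fun V => by
        simpa using hV y (extendLeft p V z)
      have h3 : (fun x => (D y).indicator (g y) (glue p x z)) = fun x =>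
          (someSubspace m (fib y z)).indicator (fun x => g y (glue p x z)) x +
            (D' (y, x)).indicator (g' (y, x)) z := by
        funext x
        by_cases hx : x ∈ someSubspace m (fib y z)
        · have hxD : glue p x z ∈ D y := someSubspace_subset m (fib y z) hx
          have hxD' : z ∉ D' (y, x) := fun h => h.2 hx
          simp [hx, hxD, hxD']
        · by_cases hxD : glue p x z ∈ D y
          · have hxD' : z ∈ D' (y, x) := ⟨hxD, hx⟩
            simp [hx, hxD, hxD', g']
          · have hxD' : z ∉ D' (y, x) := fun h => hxD h.1
            simp [hx, hxD, hxD']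
      rw [h3, avg_add]
      linarith
    have h4 : avg (fun q => dens (D' q)) = avg (fun y => dens (D y)) -
        avg fun q : Y × ({i // ¬ p i} → Option X) => dens (someSubspace m (fib q.1 q.2)) := by
      rw [avg_prod, avg_prod, ← avg_sub]
      congr 1
      funext y
      simp only [dens_split p (D y), ← avg_sub]
      simp only [dens]
      rw [avg_comm]
      congr 1
      funext z
      rw [← avg_sub]
      congr 1
      funext x
      by_cases hx : x ∈ someSubspace m (fib y z)
      · have hxD : x ∈ {x | glue p x z ∈ D y} := someSubspace_subset m _ hx
        have hxD' : z ∉ D' (y, x) := fun h => h.2 hx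
        simp [hx, hxD', Set.indicator_of_mem hxD]
      · by_cases hxD : x ∈ {x | glue p x z ∈ D y}
        · have hxD' : z ∈ D' (y, x) := ⟨hxD, hx⟩
          simp [hx, hxD', Set.indicator_of_mem hxD]
        · have hxD' : z ∉ D' (y, x) := fun h => hxD h.1
          simp [hx, hxD', Set.indicator_of_notMem hxD]
    have h5 : c ≤ avg fun q : Y × ({i // ¬ p i} → Option X) =>
        dens (someSubspace m (fib q.1 q.2)) := by
      have h6 : ε ≤ avg fun q : Y × ({i // ¬ p i} → Option X) => dens (fib q.1 q.2) := by
        rw [avg_prod]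
        refine hge.trans_eq ?_
        congr 1
        funext y
        exact dens_split p _
      have h7 := le_dens_of_le_avg hε (fun _ => dens_le_one _) h6
      calc c ≤ ((Nat.card (Option X) : ℝ) ^ M)⁻¹ *
            dens {q : Y × ({i // ¬ p i} → Option X) | ε / 2 ≤ dens (fib q.1 q.2)} := by
            rw [hc, mul_comm]
            gcongr
        _ = avg fun q => ((Nat.card (Option X) : ℝ) ^ M)⁻¹ *
            {q : Y × ({i // ¬ p i} → Option X) | ε / 2 ≤ dens (fib q.1 q.2)}.indicator 1 q := by
            rw [avg_mul_left]
            rfl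
        _ ≤ _ := by
            refine avg_mono fun q => ?_
            by_cases hq : ε / 2 ≤ dens (fib q.1 q.2)
            · rw [Set.indicator_of_mem (by exact hq), Pi.one_apply, mul_one]
              refine le_trans (le_of_eq ?_) (inv_card_le_dens
                (someSubspace_nonempty (hM _ hp.ge _ ((hD q.1).fiber p q.2) hq)))
              rw [Nat.card_fun, hp]
              push_cast
              rfl
            · rw [Set.indicator_of_notMem (by exact hq), mul_zero]
              exact dens_nonneg _
    refine h1.trans (key.trans ?_)
    gcongr 1
    refine max_le_max le_rfl ?_
    push_cast
    linarith

/-- A function whose averages over all subspaces of a given dimension are not positive has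
average almost nonpositive over an insensitive set. -/
theorem DHJ.avg_indicator_insensitive_le [Finite X] [Nonempty X] (hX : DHJ X) (m : ℕ) {ε : ℝ}
    (hε : 0 < ε) : ∃ N : ℕ, ∀ (ι : Type) [Finite ι], N ≤ Nat.card ι → ∀ (a : X)
      (D : Set (ι → Option X)) (g : (ι → Option X) → ℝ), Insensitive a D → (∀ x, g x ≤ 1) →
      (∀ V : Subspace (Fin m) (Option X) ι, avg (fun x => g (V x)) ≤ 0) →
      avg (D.indicator g) ≤ ε := by
  obtain ⟨M, hM⟩ := hX.exists_subspace_of_insensitive m (half_pos hε)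
  set c := ε / 2 * ((Nat.card (Option X) : ℝ) ^ M)⁻¹ with hc
  have hc0 : 0 < c := by
    have : 0 < Nat.card (Option X) := Nat.card_pos
    positivity
  obtain ⟨j, hj⟩ := exists_nat_gt (1 / c)
  refine ⟨j * M, fun ι _ hι a D g hD hg hV => ?_⟩
  have key := avg_avg_indicator_insensitive_le hε a (fun ι _ hι D => hM ι hι a D) j ι hι Unit
    (fun _ => D) (fun _ => g) (fun _ => hD) (fun _ => hg) (fun _ => hV)
  rw [avg_const, avg_const, ← hc, max_eq_left, add_zero] at key
  · exact key
  · rw [div_lt_iff₀ hc0] at hj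
    linarith [dens_le_one D]

/-- A function whose averages over all subspaces of a given dimension are not positive has
average almost nonpositive over a union of insensitive sets. -/
theorem DHJ.avg_indicator_union_le [Finite X] [Nonempty X] (hX : DHJ X) (s : Finset X) :
    ∀ (m : ℕ) (ε : ℝ), 0 < ε → ∃ N : ℕ, ∀ (ι : Type) [Finite ι], N ≤ Nat.card ι →
      ∀ (D : X → Set (ι → Option X)) (f : (ι → Option X) → ℝ), (∀ a ∈ s, Insensitive a (D a)) →
      (∀ x, f x ≤ 1) →
      (∀ V : Subspace (Fin m) (Option X) ι, avg (fun x => f (V x)) ≤ 0) →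
      avg ({w | ∃ a ∈ s, w ∉ D a}.indicator f) ≤ ε := by
  classical
  induction s using Finset.induction_on with
  | empty =>
    intro m ε hε
    refine ⟨0, fun ι _ _ D f _ _ _ => ?_⟩
    simpa [avg] using hε.le
  | insert b s hb ih =>
    intro m ε hε
    obtain ⟨N₀, hN₀⟩ := ih m (ε / 2) (by positivity)
    obtain ⟨N, hN⟩ := hX.avg_indicator_insensitive_le (max N₀ m) (show 0 < ε / 4 by positivity)
    refine ⟨N, fun ι _ hι D f hD hf hV => ?_⟩
    set E : Set (ι → Option X) := {w | ∃ a ∈ s, w ∉ D a} with hE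
    have hDb : Insensitive b (D b) := hD b (Finset.mem_insert_self b s)
    have h1 := hN ι hι b (D b)ᶜ f hDb.compl hf fun V =>
      avg_nonpos_of_subspace (m := m) (by simp) _ fun U => by simpa using hV (comp V U)
    have h2 := hN ι hι b (D b) (fun w => E.indicator f w - ε / 2) hDb (fun w => by
      have : E.indicator f w ≤ 1 := Set.indicator_apply_le' (fun _ => hf w) (fun _ => zero_le_one)
      linarith) fun V => by
        have h3 := hN₀ (Fin (max N₀ m)) (by simp) (fun a => {x | V x ∈ D a}) (fun x => f (V x))
          (fun a ha => (hD a (Finset.mem_insert_of_mem ha)).preimage V) (fun x => hf _)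
          fun U => by simpa using hV (comp V U)
        rw [avg_sub, avg_const]
        have h4 : (fun x => E.indicator f (V x)) =
            {x | ∃ a ∈ s, x ∉ (fun a => {x | V x ∈ D a}) a}.indicator fun x => f (V x) := rfl
        rw [h4]
        linarith
    have h5 : avg ({w | ∃ a ∈ insert b s, w ∉ D a}.indicator f) ≤
        avg fun w => (((D b)ᶜ).indicator f w +
          (D b).indicator (fun w => E.indicator f w - ε / 2) w) + ε / 2 := by
      refine avg_mono fun w => ?_
      by_cases hw : w ∈ D b
      · rw [Set.indicator_of_notMem (show w ∉ (D b)ᶜ from not_not.2 hw), Set.indicator_of_mem hw]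
        have : w ∈ {w | ∃ a ∈ insert b s, w ∉ D a} ↔ w ∈ E := by simp [hE, hw]
        by_cases hwE : w ∈ E
        · rw [Set.indicator_of_mem (this.2 hwE), Set.indicator_of_mem hwE]
          linarith
        · rw [Set.indicator_of_notMem (mt this.1 hwE), Set.indicator_of_notMem hwE]
          linarith
      · rw [Set.indicator_of_mem (show w ∈ (D b)ᶜ from hw), Set.indicator_of_notMem hw,
          Set.indicator_of_mem (show w ∈ {w | ∃ a ∈ insert b s, w ∉ D a} from
            ⟨b, Finset.mem_insert_self b s, hw⟩)]
        linarith
    rw [avg_add, avg_add, avg_const] at h5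
    linarith

/-- After passing to a subspace without losing density, all fibres over a given number of
coordinates have almost the full density. -/
theorem exists_subspace_fiber_dens (Z : Type) [Finite Z] [Nonempty Z] {ε : ℝ} (hε : 0 < ε)
    (m d : ℕ) : ∃ N : ℕ, ∀ (ι : Type) [Finite ι], N ≤ Nat.card ι → ∀ A : Set (ι → Z),
      ∃ (ι' : Type) (_ : Finite ι') (V : Subspace ι' Z ι) (p : ι' → Prop),
        dens A ≤ dens {x | V x ∈ A} ∧ Nat.card {i // p i} = m ∧ d ≤ Nat.card {i // ¬ p i} ∧
          ∀ y, dens {x | V x ∈ A} - ε ≤ dens {z | V (glue p y z) ∈ A} := by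
  set c : ℝ := ε / (Nat.card Z : ℝ) ^ m with hc
  have hZ : 0 < Nat.card Z := Nat.card_pos
  have hc0 : 0 < c := by positivity
  have key : ∀ j : ℕ, ∀ (ι : Type) [Finite ι], j * m + d ≤ Nat.card ι → ∀ A : Set (ι → Z),
      1 - dens A < j * c → ∃ (ι' : Type) (_ : Finite ι') (V : Subspace ι' Z ι) (p : ι' → Prop),
        dens A ≤ dens {x | V x ∈ A} ∧ Nat.card {i // p i} = m ∧ d ≤ Nat.card {i // ¬ p i} ∧
          ∀ y, dens {x | V x ∈ A} - ε ≤ dens {z | V (glue p y z) ∈ A} := by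
    intro j
    induction j with
    | zero =>
      intro ι _ _ A hA
      have := dens_le_one A
      simp only [Nat.cast_zero, zero_mul] at hA
      linarith
    | succ j ih =>
      intro ι _ hι A hA
      rw [add_mul, one_mul] at hι
      obtain ⟨p, hp, hp'⟩ := exists_card_subtype (show m ≤ Nat.card ι by omega)
      by_cases h : ∀ y, dens A - ε ≤ dens {z | glue p y z ∈ A}
      · exact ⟨ι, inferInstance, ofEquiv (Equiv.refl ι), p, le_rfl, hp, by omega, h⟩
      · push Not at h
        obtain ⟨y₀, hy₀⟩ := h
        have hd := dens_split' p A
        rw [hd] at hy₀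
        obtain ⟨y, hy⟩ := exists_avg_add_le_of_lt
          (f := fun y => dens {z | glue p y z ∈ A}) y₀ hy₀
        rw [← hd, Nat.card_fun, hp] at hy
        push_cast at hy
        rw [← hc] at hy
        obtain ⟨ι', hfin, V, q, h1, h2, h3, h4⟩ := ih {i // ¬ p i} (by omega)
          {z | glue p y z ∈ A} (by push_cast at hA; linarith)
        refine ⟨ι', hfin, comp (extendRight p y (ofEquiv (Equiv.refl _))) V, q, ?_, h2, h3, ?_⟩
        · simp only [comp_apply, extendRight_apply, ofEquiv_apply]
          exact le_trans (by linarith) h1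
        · simpa using h4
  obtain ⟨j, hj⟩ := exists_nat_gt (1 / c)
  refine ⟨j * m + d, fun ι _ hι A => key j ι hι A ?_⟩
  rw [div_lt_iff₀ hc0] at hj
  linarith [dens_nonneg A]

/-- Replace the blanks in a word by a given letter. -/
def fill (a : X) (w : ι → Option X) : ι → Option X := fun i => some ((w i).getD a)

theorem fill_mapSub (V : Subspace η X ι) (a : X) (w : η → Option X) :
    fill a (mapSub some V w) = mapSub some V (fill a w) := by
  funext i
  cases h : V.idxFun i <;> simp [Subspace.coe_apply, mapSub, fill, h]

/-- A word with a blank, as a line over the alphabet in which the blank is a letter. -/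
def blankLine (w : ι → Option X) (h : ∃ i, w i = none) : Line (Option X) ι where
  idxFun i := (w i).map some
  proper := by simpa using h

theorem blankLine_none (w : ι → Option X) (h : ∃ i, w i = none) : blankLine w h none = w := by
  funext i
  cases h2 : w i <;> simp [Line.coe_apply, blankLine, h2]

theorem blankLine_some (w : ι → Option X) (h : ∃ i, w i = none) (a : X) :
    blankLine w h (some a) = fill a w := by
  funext i
  cases h2 : w i <;> simp [Line.coe_apply, blankLine, h2, fill]

/-- A dense set without lines has larger density on some subspace. -/
theorem DHJ.exists_dens_increment [Finite X] [Nonempty X] (hX : DHJ X) {δ : ℝ} (hδ : 0 < δ) :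
    ∃ γ : ℝ, 0 < γ ∧ ∀ m : ℕ, ∃ N : ℕ, ∀ (ι : Type) [Finite ι], N ≤ Nat.card ι →
      ∀ A : Set (ι → Option X), δ ≤ dens A → (∀ L : Line (Option X) ι, ∃ a, L a ∉ A) →
        ∃ V : Subspace (Fin m) (Option X) ι, dens A + γ ≤ dens {x | V x ∈ A} := by
  classical
  have := Fintype.ofFinite X
  obtain ⟨N₀, θ, hθ, hinter⟩ := hX.exists_line_inter (half_pos hδ)
  obtain ⟨η, hη, hη1, hηθ⟩ : ∃ η : ℝ, 0 < η ∧ η ≤ 1 ∧ η ≤ θ :=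
    ⟨min 1 θ, by positivity, min_le_left _ _, min_le_right _ _⟩
  rcases lt_or_ge 1 δ with hδ1 | hδ1
  · exact ⟨1, one_pos, fun m => ⟨0, fun ι _ _ A hA => absurd hA (not_le.2
      ((dens_le_one A).trans_lt hδ1))⟩⟩
  set γ : ℝ := δ * η ^ 2 / 100 with hγ
  have hγ0 : 0 < γ := by positivity
  have hγδ : γ ≤ δ / 2 := by
    rw [hγ]
    nlinarith [pow_le_one₀ hη.le hη1 (n := 2)]
  refine ⟨γ, hγ0, fun m => ?_⟩
  obtain ⟨N₁, hblank⟩ := exists_dens_no_blank_lt X (show 0 < δ * η / 20 by positivity)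
  obtain ⟨N₂, hunion⟩ := hX.avg_indicator_union_le Finset.univ m (δ * η / 20) (by positivity)
  set d := max (max N₀ N₁) (max N₂ m) with hd
  obtain ⟨N₃, hcolor⟩ := exists_subspace_line_color_eq X Prop d
  obtain ⟨N₄, hreg⟩ := exists_subspace_fiber_dens (Option X) hγ0 N₃ m
  refine ⟨N₄, fun ι₀ _ hι₀ A₀ hA₀ hL₀ => ?_⟩
  obtain ⟨ι, _, V₀, p, hdens, hp, hp', hfib⟩ := hreg ι₀ hι₀ A₀
  set A : Set (ι → Option X) := {x | V₀ x ∈ A₀} with hA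
  set α : ℝ := dens A with hα
  have hδα : δ ≤ α := hA₀.trans hdens
  have hlf : ∀ L : Line (Option X) ι, ∃ a, L a ∉ A := fun L => by
    simpa [hA] using hL₀ (compLine V₀ L)
  by_contra! hcon
  have hsub : ∀ V : Subspace (Fin m) (Option X) ι, dens {x | V x ∈ A} ≤ α + γ := fun V => by
    have := hcon (comp V₀ V)
    simp only [comp_apply] at this
    exact this.le.trans (by linarith)
  -- all words with a blank in some subspace have a large intersection of fibres
  obtain ⟨U, k, hU⟩ := hcolor {i // p i} hp.ge fun w =>
    η ≤ dens {z | ∀ a : X, glue p (fill a w) z ∈ A}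
  have hQ : ∀ w : Fin d → Option X, (∃ e, w e = none) →
      η ≤ dens {z | ∀ a : X, glue p (mapSub some U (fill a w)) z ∈ A} := by
    obtain ⟨L, hL⟩ := hinter (Fin d) (by simp [hd]) ({i // ¬ p i} → Option X)
      (fun x => {z | glue p (mapSub some U (some ∘ x)) z ∈ A}) fun x =>
        le_trans (by linarith) (hfib _)
    intro w hw
    have h1 := hU w hw
    have h2 := hU L.idxFun L.proper
    rw [← h1] at h2
    simp only [fill_mapSub] at h2
    rw [← h2]
    exact hηθ.trans hL
  let W : ({i // ¬ p i} → Option X) → Subspace (Fin d) (Option X) ι :=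
    fun z => extendLeft p (mapSub some U) z
  have hW : ∀ z w, W z w = glue p (mapSub some U w) z := fun z w => extendLeft_apply _ _ _ _
  let D : X → ({i // ¬ p i} → Option X) → Set (Fin d → Option X) :=
    fun a z => {w | W z (fill a w) ∈ A}
  let B : ({i // ¬ p i} → Option X) → Set (Fin d → Option X) := fun z => {w | W z w ∈ A}
  have hD : ∀ a z, Insensitive a (D a z) := fun a z w w' h hw => by
    have : fill a w = fill a w' := funext fun i => congrArg some (h i)
    simpa only [D, Set.mem_ofPred_eq, this] using hw
  set t := dens {w : Fin d → Option X | ∀ i, w i ≠ none} with ht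
  have ht1 : t < δ * η / 20 := hblank (Fin d) (by simp [hd])
  have hδη : δ * η ≤ 1 := by nlinarith
  have hDB : ∀ z, {w | ∀ a, w ∈ D a z} ∩ B z ⊆ {w : Fin d → Option X | ∀ i, w i ≠ none} := by
    intro z w ⟨hwD, hwB⟩ i hi
    obtain ⟨o, ho⟩ := hlf (compLine (W z) (blankLine w ⟨i, hi⟩))
    refine ho ?_
    rw [compLine_apply]
    cases o with
    | none => rw [blankLine_none]; exact hwB
    | some a => rw [blankLine_some]; exact hwD a
  have hmeanD : η / 2 ≤ avg fun z => dens {w | ∀ a, w ∈ D a z} := by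
    have h1 : (avg fun z => dens {w | ∀ a, w ∈ D a z}) =
        avg fun w : Fin d → Option X =>
          dens {z | ∀ a : X, glue p (mapSub some U (fill a w)) z ∈ A} := by
      simp only [dens]
      rw [avg_comm]
      simp only [← hW]
      rfl
    have h2 : (avg fun w : Fin d → Option X => η -
        {w : Fin d → Option X | ∀ i, w i ≠ none}.indicator 1 w) ≤
        avg fun w : Fin d → Option X =>
          dens {z | ∀ a : X, glue p (mapSub some U (fill a w)) z ∈ A} := by
      refine avg_mono fun w => ?_
      by_cases hw : ∀ i, w i ≠ none
      · rw [Set.indicator_of_mem (show w ∈ {w : Fin d → Option X | ∀ i, w i ≠ none} from hw),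
          Pi.one_apply]
        linarith [dens_nonneg {z | ∀ a : X, glue p (mapSub some U (fill a w)) z ∈ A}]
      · rw [Set.indicator_of_notMem (show w ∉ {w : Fin d → Option X | ∀ i, w i ≠ none} from hw),
          sub_zero]
        exact hQ w (by simpa using hw)
    rw [avg_sub, avg_const] at h2
    change η - t ≤ _ at h2
    rw [h1]
    nlinarith
  have hmeanB : α - γ ≤ avg fun z => dens (B z) := by
    have h1 : (avg fun z => dens (B z)) = avg fun w : Fin d → Option X =>
        dens {z | glue p (mapSub some U w) z ∈ A} := by
      simp only [dens]
      rw [avg_comm]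
      congr 1
      funext w
      congr 1
      funext z
      simp [Set.indicator_apply, B, hW]
    rw [h1, ← avg_const (Ω := Fin d → Option X) (α - γ)]
    exact avg_mono fun w => hfib _
  have hsubB : ∀ z, ∀ V : Subspace (Fin m) (Option X) (Fin d),
      avg (fun x => (B z).indicator 1 (V x) - (α + γ)) ≤ 0 := fun z V => by
    rw [avg_sub, avg_const]
    have h1 := hsub (comp (W z) V)
    simp only [comp_apply] at h1
    exact sub_nonpos.2 h1
  have hB : ∀ z, 0 ≤ α + γ - dens (B z) := fun z => by
    have := avg_nonpos_of_subspace (ι := Fin d) (m := m) (by simp [hd])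
      (fun w => (B z).indicator 1 w - (α + γ)) (hsubB z)
    rw [avg_sub, avg_const] at this
    linarith [show avg (fun x => (B z).indicator (1 : (Fin d → Option X) → ℝ) x) = dens (B z)
      from rfl]
  obtain ⟨z, hzD, hzB⟩ : ∃ z, η / 4 ≤ dens {w | ∀ a, w ∈ D a z} ∧
      α + γ - dens (B z) ≤ 10 * γ / η := by
    by_contra! hz
    have h1 := le_dens_of_le_avg (half_pos hη) (fun _ => dens_le_one _) hmeanD
    have h2 : (avg fun z => 10 * γ / η * {z | η / 2 / 2 ≤ dens {w | ∀ a, w ∈ D a z}}.indicator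
        1 z) ≤ avg fun z => (α + γ - dens (B z)) := by
      refine avg_mono fun z => ?_
      by_cases h : η / 2 / 2 ≤ dens {w | ∀ a, w ∈ D a z}
      · rw [Set.indicator_of_mem (by exact h), Pi.one_apply, mul_one]
        exact (hz z (by linarith)).le
      · rw [Set.indicator_of_notMem (by exact h), mul_zero]
        exact hB z
    rw [avg_mul_left, avg_sub, avg_const] at h2
    change 10 * γ / η * dens _ ≤ _ at h2
    have h3 : 10 * γ / η * (η / 2 / 2) ≤ 10 * γ / η *
        dens {z | η / 2 / 2 ≤ dens {w | ∀ a, w ∈ D a z}} := by gcongr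
    have h4 : 10 * γ / η * (η / 2 / 2) = 10 / 4 * γ := by
      field_simp
      norm_num
    linarith
  have hfin := hunion (Fin d) (by simp [hd]) (fun a => D a z)
    (fun w => (B z).indicator 1 w - (α + γ)) (fun a _ => hD a z) (fun w => by
      linarith [indicator_one_le (B z) w]) (hsubB z)
  have hsplit : avg (fun w => (B z).indicator 1 w - (α + γ)) ≤
      avg fun w => {w | ∃ a ∈ Finset.univ, w ∉ D a z}.indicator
        (fun w => (B z).indicator 1 w - (α + γ)) w +
        ({w : Fin d → Option X | ∀ i, w i ≠ none}.indicator 1 w -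
          δ * {w | ∀ a, w ∈ D a z}.indicator 1 w) := by
    refine avg_mono fun w => ?_
    have h0 : 0 ≤ {w : Fin d → Option X | ∀ i, w i ≠ none}.indicator (1 : (Fin d → Option X) → ℝ) w :=
      Set.indicator_nonneg (by simp) _
    by_cases hw : ∀ a, w ∈ D a z
    · rw [Set.indicator_of_notMem (show w ∉ {w | ∃ a ∈ Finset.univ, w ∉ D a z} by simpa using hw),
        Set.indicator_of_mem (show w ∈ {w | ∀ a, w ∈ D a z} from hw), Pi.one_apply]
      by_cases hwB : w ∈ B z
      · rw [Set.indicator_of_mem hwB, Set.indicator_of_mem (hDB z ⟨hw, hwB⟩)]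
        simp only [Pi.one_apply]
        linarith
      · rw [Set.indicator_of_notMem hwB]
        linarith
    · rw [Set.indicator_of_mem (show w ∈ {w | ∃ a ∈ Finset.univ, w ∉ D a z} by simpa using hw),
        Set.indicator_of_notMem (show w ∉ {w | ∀ a, w ∈ D a z} from hw)]
      linarith
  simp only [avg_add, avg_sub, avg_mul_left, avg_const] at hsplit
  change dens (B z) - (α + γ) ≤ _ + (t - δ * dens {w | ∀ a, w ∈ D a z}) at hsplit
  have h1 : 10 * γ / η = δ * η / 10 := by
    rw [hγ]
    field_simp
    norm_num
  have h2 : δ * (η / 4) ≤ δ * dens {w | ∀ a, w ∈ D a z} := by gcongr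
  nlinarith

/-- The inductive step of the density Hales–Jewett theorem. -/
theorem DHJ.option [Finite X] [Nonempty X] (hX : DHJ X) : DHJ (Option X) := by
  intro δ hδ
  obtain ⟨γ, hγ, hinc⟩ := hX.exists_dens_increment hδ
  have key : ∀ j : ℕ, ∃ N : ℕ, ∀ (ι : Type) [Finite ι], N ≤ Nat.card ι →
      ∀ A : Set (ι → Option X), δ ≤ dens A → 1 - dens A < j * γ →
        ∃ L : Line (Option X) ι, ∀ a, L a ∈ A := by
    intro j
    induction j with
    | zero =>
      refine ⟨0, fun ι _ _ A _ hA => ?_⟩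
      have := dens_le_one A
      simp only [Nat.cast_zero, zero_mul] at hA
      linarith
    | succ j ih =>
      obtain ⟨m, hm⟩ := ih
      obtain ⟨N, hN⟩ := hinc m
      refine ⟨N, fun ι _ hι A hA hj => ?_⟩
      by_contra! hcon
      obtain ⟨V, hV⟩ := hN ι hι A hA hcon
      push_cast at hj
      obtain ⟨L, hL⟩ := hm (Fin m) (by simp) {x | V x ∈ A} (by linarith) (by linarith)
      obtain ⟨a, ha⟩ := hcon (compLine V L)
      rw [compLine_apply] at ha
      exact ha (hL a)
  obtain ⟨j, hj⟩ := exists_nat_gt (1 / γ)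
  obtain ⟨N, hN⟩ := key j
  refine ⟨N, fun ι _ hι A hA => hN ι hι A hA ?_⟩
  rw [div_lt_iff₀ hγ] at hj
  linarith [dens_nonneg A]

theorem DHJ.of_equiv (e : X ≃ Y) (hX : DHJ X) : DHJ Y := by
  intro δ hδ
  obtain ⟨N, hN⟩ := hX δ hδ
  refine ⟨N, fun ι _ hι A hA => ?_⟩
  rw [dens, ← avg_comp_equiv ((Equiv.refl ι).arrowCongr e)] at hA
  obtain ⟨L, hL⟩ := hN ι hι {x | e ∘ x ∈ A} hA
  refine ⟨L.map e, fun b => ?_⟩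
  obtain ⟨a, rfl⟩ := e.surjective b
  rw [Line.map_apply]
  exact hL a

theorem DHJ.of_subsingleton [Subsingleton X] : DHJ X := by
  intro δ hδ
  refine ⟨1, fun ι _ hι A hA => ?_⟩
  obtain ⟨x, hx⟩ := nonempty_of_dens_pos (hδ.trans_le hA)
  obtain ⟨i⟩ : Nonempty ι := (Nat.card_pos_iff.1 (by omega)).1
  exact ⟨⟨fun _ => none, i, rfl⟩, fun a => by rwa [Subsingleton.elim (Line.toFun _ _) x]⟩

/-- The density Hales–Jewett theorem. -/
theorem dhj (X : Type) [Finite X] : DHJ X := by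
  refine Finite.induction_empty_option (P := DHJ) (fun e h => h.of_equiv e) DHJ.of_subsingleton
    (fun {X} _ h => ?_) X
  cases isEmpty_or_nonempty X
  · exact DHJ.of_subsingleton
  · exact h.option

theorem dens_eq_card_filter {Ω : Type*} [Fintype Ω] (P : Ω → Prop) [DecidablePred P] :
    dens {x | P x} = (Finset.univ.filter P).card / Fintype.card Ω := by
  rw [dens, avg_eq]
  congr 1
  rw [Finset.card_filter]
  push_cast
  exact Finset.sum_congr rfl fun x _ => by simp [Set.indicator_apply]

/-- The sum of the letters of the points on a line is an arithmetic progression. -/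
theorem line_sum_eq {k n : ℕ} (L : Line (Fin k) (Fin n)) : ∃ s j : ℕ, s ≤ n * k ∧ 1 ≤ j ∧ j ≤ n ∧
    ∀ a, ∑ i, (L a i : ℕ) = s + a * j := by
  classical
  refine ⟨∑ i, (L.idxFun i).elim 0 fun b : Fin k => (b : ℕ),
    (Finset.univ.filter fun i => L.idxFun i = none).card, ?_, ?_, ?_, fun a => ?_⟩
  · calc _ ≤ ∑ _i : Fin n, k := Finset.sum_le_sum fun i _ => by
          cases L.idxFun i <;> simp
      _ = n * k := by simp
  · obtain ⟨i, hi⟩ := L.proper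
    exact Finset.card_pos.2 ⟨i, by simpa using hi⟩
  · exact (Finset.card_le_univ _).trans (by simp)
  · rw [Finset.card_filter, Finset.mul_sum, ← Finset.sum_add_distrib]
    refine Finset.sum_congr rfl fun i _ => ?_
    cases h : L.idxFun i <;> simp [Line.coe_apply, h]

open scoped Classical in
/-- Varnavides' theorem: dense sets of integers contain many arithmetic progressions. -/
theorem exists_card_ap_ge (k : ℕ) (hk : 2 ≤ k) {δ : ℝ} (hδ : 0 < δ) :
    ∃ c : ℝ, 0 < c ∧ ∃ N₀ : ℕ, ∀ N, N₀ ≤ N → ∀ C ⊆ Finset.Icc 1 N, δ * N ≤ C.card →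
      c * (N : ℝ) ^ 2 ≤
        ((Finset.range (N + 1) ×ˢ Finset.range (N + 1)).filter fun q => APIn k C q.1 q.2).card := by
  obtain ⟨n₀, hn₀⟩ := dhj (Fin k) (δ / 8) (by positivity)
  set n := n₀ + 1 with hn
  set E₀ : ℝ := δ / (2 * (n * k)) with hE₀
  have hE0 : 0 < E₀ := by positivity
  obtain ⟨N₀, hN₀⟩ := exists_nat_gt (2 / E₀)
  refine ⟨E₀ / 2 * (δ / 8) / ((n + 1) * (n * k + 1)), by positivity, N₀ + 1,
    fun N hN C hC hCN => ?_⟩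
  have hN1 : (1 : ℝ) ≤ N := by exact_mod_cast (by omega : 1 ≤ N)
  set E := ⌊E₀ * N⌋₊ with hE
  have hEN : E₀ / 2 * N ≤ E := by
    have h1 := Nat.lt_floor_add_one (E₀ * N)
    have h2 : 2 < E₀ * N := by
      rw [div_lt_iff₀ hE0] at hN₀
      have : (N₀ : ℝ) ≤ N := by exact_mod_cast (by omega : N₀ ≤ N)
      nlinarith
    linarith
  let σ : (Fin n → Fin k) → ℕ := fun x => ∑ i, (x i : ℕ)
  have hσ : ∀ x, σ x ≤ n * k := fun x => by
    calc σ x ≤ ∑ _i : Fin n, k := Finset.sum_le_sum fun i _ => by omega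
      _ = n * k := by simp
  let T : ℕ → Finset (Fin (N + 1)) := fun e =>
    Finset.univ.filter fun t => ∃ L : Line (Fin k) (Fin n), ∀ a, t + e * σ (L a) ∈ C
  have hT : ∀ e ∈ Finset.Icc 1 E, δ / 8 * (N + 1) ≤ (T e).card := by
    intro e he
    have hk0 : Nonempty (Fin k) := ⟨⟨0, by omega⟩⟩
    have he2 : (e : ℝ) * (n * k) ≤ δ / 2 * N := by
      have h1 : (e : ℝ) ≤ E₀ * N := by
        have h2 : (E : ℝ) ≤ E₀ * N := Nat.floor_le (by positivity)
        have h3 : (e : ℝ) ≤ E := by exact_mod_cast (Finset.mem_Icc.1 he).2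
        linarith
      calc (e : ℝ) * (n * k) ≤ E₀ * N * (n * k) := by gcongr
        _ = δ / 2 * N := by
          have : (n : ℝ) ≠ 0 := by rw [hn]; positivity
          rw [hE₀]
          field_simp
    have h1 : δ / 4 ≤ avg fun t : Fin (N + 1) => dens {x | (t : ℕ) + e * σ x ∈ C} := by
      have h2 : (avg fun t : Fin (N + 1) => dens {x | (t : ℕ) + e * σ x ∈ C}) =
          avg fun x => dens {t : Fin (N + 1) | (t : ℕ) + e * σ x ∈ C} := by
        simp only [dens]
        rw [avg_comm]
        rfl
      rw [h2, ← avg_const (Ω := Fin n → Fin k) (δ / 4)]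
      refine avg_mono fun x => ?_
      rw [dens_eq_card_filter]
      set Tx := Finset.univ.filter fun t : Fin (N + 1) => (t : ℕ) + e * σ x ∈ C
      have h3 : C ⊆ Finset.range (e * σ x) ∪ Tx.image fun t : Fin (N + 1) => (t : ℕ) + e * σ x := by
        intro y hy
        rw [Finset.mem_union, Finset.mem_range, Finset.mem_image]
        rcases lt_or_ge y (e * σ x) with h | h
        · exact Or.inl h
        · have := (Finset.mem_Icc.1 (hC hy)).2
          refine Or.inr ⟨⟨y - e * σ x, by omega⟩, ?_, by simp only; omega⟩
          simp only [Tx, Finset.mem_filter, Finset.mem_univ, true_and]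
          rwa [Nat.sub_add_cancel h]
      have h4 := (Finset.card_le_card h3).trans (Finset.card_union_le _ _)
      rw [Finset.card_range] at h4
      have h5 : (C.card : ℝ) ≤ e * σ x + Tx.card := by
        exact_mod_cast h4.trans (Nat.add_le_add_left Finset.card_image_le _)
      have h6 : (e : ℝ) * σ x ≤ e * (n * k) := by
        gcongr
        exact_mod_cast hσ x
      rw [Fintype.card_fin, le_div_iff₀ (by positivity)]
      push_cast
      nlinarith
    have h2 := le_dens_of_le_avg (by positivity) (fun _ => dens_le_one _) h1
    have h3 := h2.trans (dens_mono (B := {t : Fin (N + 1) |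
      ∃ L : Line (Fin k) (Fin n), ∀ a, t + e * σ (L a) ∈ C}) fun t ht =>
        hn₀ (Fin n) (by simp [hn]) {x | (t : ℕ) + e * σ x ∈ C} (by
          simp only [Set.mem_ofPred_eq] at ht
          linarith))
    rw [dens_eq_card_filter, Fintype.card_fin, le_div_iff₀ (by positivity)] at h3
    push_cast at h3
    linarith
  set R := (Finset.range (N + 1) ×ˢ Finset.range (N + 1)).filter fun q => APIn k C q.1 q.2
    with hR
  have hcard : ((Finset.Icc 1 E).sigma T).card ≤
      (R ×ˢ (Finset.range (n + 1) ×ˢ Finset.range (n * k + 1))).card := by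
    have hex : ∀ q ∈ (Finset.Icc 1 E).sigma T, ∃ s j : ℕ, s ≤ n * k ∧ 1 ≤ j ∧ j ≤ n ∧
        APIn k C (q.2 + q.1 * s) (q.1 * j) := by
      rintro ⟨e, t⟩ hq
      simp only [Finset.mem_sigma, T, Finset.mem_filter, Finset.mem_univ, true_and,
        Finset.mem_Icc] at hq
      obtain ⟨⟨he, -⟩, L, hL⟩ := hq
      obtain ⟨s, j, hs, hj, hjn, hsum⟩ := line_sum_eq L
      refine ⟨s, j, hs, hj, hjn, Nat.mul_pos he hj, fun i hi => ?_⟩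
      have := hL ⟨i, hi⟩
      simp only [σ, hsum] at this
      convert this using 1
      ring
    choose! s j hs hj hjn hap using hex
    refine Finset.card_le_card_of_injOn
      (fun q => ((q.2 + q.1 * s q, q.1 * j q), (j q, s q))) (fun q hq => ?_) ?_
    · have h1 := hap q hq
      have h2 := Finset.mem_Icc.1 (hC (h1.2 0 (by omega)))
      have h3 := Finset.mem_Icc.1 (hC (h1.2 1 (by omega)))
      have h4 := hs q hq
      have h5 := hjn q hq
      simp only [Finset.coe_product, Set.mem_prod, Finset.mem_coe, hR, Finset.mem_filter,
        Finset.mem_product, Finset.mem_range]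
      refine ⟨⟨⟨?_, ?_⟩, h1⟩, ?_, ?_⟩ <;> omega
    · rintro ⟨e, t⟩ hq ⟨e', t'⟩ hq' h
      simp only [Prod.mk.injEq] at h
      obtain ⟨⟨h1, h2⟩, h3, h4⟩ := h
      rw [h3] at h2
      have : e = e' := Nat.eq_of_mul_eq_mul_right (hj _ hq') h2
      subst this
      rw [h4] at h1
      have : t = t' := Fin.ext (by omega)
      rw [this]
  rw [Finset.card_sigma, Finset.card_product, Finset.card_product, Finset.card_range,
    Finset.card_range] at hcard
  have hsum : (E : ℝ) * (δ / 8 * (N + 1)) ≤ ∑ e ∈ Finset.Icc 1 E, ((T e).card : ℝ) := by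
    refine le_trans (le_of_eq ?_) (Finset.sum_le_sum hT)
    simp
  have hcard' : ∑ e ∈ Finset.Icc 1 E, ((T e).card : ℝ) ≤ R.card * ((n + 1) * (n * k + 1)) := by
    exact_mod_cast hcard
  rw [div_mul_eq_mul_div, div_le_iff₀ (by positivity)]
  calc E₀ / 2 * (δ / 8) * (N : ℝ) ^ 2 = E₀ / 2 * N * (δ / 8 * N) := by ring
    _ ≤ E * (δ / 8 * (N + 1)) := by gcongr; linarith
    _ ≤ _ := hsum.trans hcard'

end Cube

/-! ### Containers for weighted hypergraphs -/

namespace Container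

open Finset

/-- The degree of a set of vertices in a weighted hypergraph with vertex set `U`. -/
def deg (U : Finset ℕ) (w : Finset ℕ → ℝ) (T : Finset ℕ) : ℝ :=
  ∑ E ∈ U.powerset with T ⊆ E, w E

/-- The link of a vertex in a weighted hypergraph. -/
def link (v : ℕ) (w : Finset ℕ → ℝ) (E : Finset ℕ) : ℝ :=
  if v ∈ E then 0 else w (insert v E)

open scoped Classical in
/-- Remove from the weighted hypergraph `w` all edges that contain a set of large degree in `G`. -/
noncomputable def del (U : Finset ℕ) (τ : ℝ) (w G : Finset ℕ → ℝ) (E : Finset ℕ) : ℝ :=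
  if ∃ T ⊆ E, T.Nonempty ∧ τ ^ #T ≤ deg U G T then 0 else w E

theorem exists_lex_max (φ : ℕ → ℝ) {I : Finset ℕ} (hI : I.Nonempty) :
    ∃ v ∈ I, ∀ x ∈ I, toLex (φ x, x) ≤ toLex (φ v, v) :=
  I.exists_max_image (fun x => toLex (φ x, x)) hI

open scoped Classical in
/-- The largest point of `I` at which `φ` attains its maximum on `I`. -/
noncomputable def argmax (φ : ℕ → ℝ) (I : Finset ℕ) : ℕ :=
  if hI : I.Nonempty then (exists_lex_max φ hI).choose else 0

theorem argmax_spec (φ : ℕ → ℝ) {I : Finset ℕ} (hI : I.Nonempty) :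
    argmax φ I ∈ I ∧ ∀ x ∈ I, toLex (φ x, x) ≤ toLex (φ (argmax φ I), argmax φ I) := by
  rw [argmax, dif_pos hI]
  exact (exists_lex_max φ hI).choose_spec

theorem le_argmax (φ : ℕ → ℝ) {I : Finset ℕ} {x : ℕ} (hx : x ∈ I) : φ x ≤ φ (argmax φ I) := by
  rcases Prod.Lex.le_iff.1 ((argmax_spec φ ⟨x, hx⟩).2 x hx) with h | h
  · exact h.le
  · exact h.1.le

theorem argmax_eq_of_subset (φ : ℕ → ℝ) {I S : Finset ℕ} (hS : S ⊆ I) (h : argmax φ I ∈ S) :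
    argmax φ S = argmax φ I := by
  have h1 := (argmax_spec φ ⟨_, h⟩).2 _ h
  have h2 := (argmax_spec φ ⟨_, hS h⟩).2 _ (hS (argmax_spec φ ⟨_, h⟩).1)
  have := le_antisymm h2 h1
  simpa using congrArg (fun q => (ofLex q).2) this

open scoped Classical in
/-- The container algorithm: repeatedly select the vertex of `I` of largest degree and add its link
to the hypergraph that is being built. -/
noncomputable def run (U : Finset ℕ) (τ : ℝ) (w : Finset ℕ → ℝ) (I : Finset ℕ) :
    ℕ → (Finset ℕ → ℝ) × Finset ℕ
  | 0 => (0, ∅)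
  | i + 1 =>
    if I.Nonempty then
      ((run U τ w I i).1 + link (argmax (fun v => deg U (del U τ w (run U τ w I i).1) {v}) I)
        (del U τ w (run U τ w I i).1),
        insert (argmax (fun v => deg U (del U τ w (run U τ w I i).1) {v}) I) (run U τ w I i).2)
    else run U τ w I i

variable {U I S T : Finset ℕ} {τ : ℝ} {w G u : Finset ℕ → ℝ} {v : ℕ}

/-- The vertex selected in a step of the container algorithm. -/
noncomputable def sel (U : Finset ℕ) (τ : ℝ) (w : Finset ℕ → ℝ) (I : Finset ℕ) (i : ℕ) : ℕ :=
  argmax (fun v => deg U (del U τ w (run U τ w I i).1) {v}) I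

theorem run_succ (hI : I.Nonempty) (i : ℕ) : run U τ w I (i + 1) =
    ((run U τ w I i).1 + link (sel U τ w I i) (del U τ w (run U τ w I i).1),
      insert (sel U τ w I i) (run U τ w I i).2) := by
  rw [run, if_pos hI]
  rfl

theorem sel_mem (hI : I.Nonempty) (i : ℕ) : sel U τ w I i ∈ I := (argmax_spec _ hI).1

theorem run_empty (i : ℕ) : run U τ w ∅ i = (0, ∅) := by
  induction i with
  | zero => rfl
  | succ i ih => rw [run, if_neg (by simp), ih]

theorem run_subset (i : ℕ) : (run U τ w I i).2 ⊆ I := by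
  rcases I.eq_empty_or_nonempty with rfl | hI
  · simp [run_empty]
  · induction i with
    | zero => simp [run]
    | succ i ih =>
      rw [run_succ hI]
      exact insert_subset (sel_mem hI i) ih

theorem card_run_le (i : ℕ) : #(run U τ w I i).2 ≤ i := by
  rcases I.eq_empty_or_nonempty with rfl | hI
  · simp [run_empty]
  · induction i with
    | zero => simp [run]
    | succ i ih =>
      rw [run_succ hI]
      exact (card_insert_le _ _).trans (by simpa using ih)

/-- The outcome of the container algorithm is determined by the selected vertices. -/
theorem run_eq_of_subset (hSI : S ⊆ I) (i : ℕ) (hS : (run U τ w I i).2 ⊆ S) :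
    run U τ w S i = run U τ w I i := by
  rcases I.eq_empty_or_nonempty with rfl | hI
  · rw [subset_empty.1 hSI]
  · induction i with
    | zero => rfl
    | succ i ih =>
      rw [run_succ hI] at hS ⊢
      have hv : sel U τ w I i ∈ S := hS (mem_insert_self _ _)
      have h := ih ((subset_insert _ _).trans hS)
      have hsel : sel U τ w S i = sel U τ w I i := by
        rw [sel, h]
        exact argmax_eq_of_subset _ hSI hv
      rw [run_succ ⟨_, hv⟩, hsel, h]

theorem deg_nonneg (hw : ∀ E, 0 ≤ w E) (T : Finset ℕ) : 0 ≤ deg U w T :=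
  sum_nonneg fun E _ => hw E

theorem deg_add (w u : Finset ℕ → ℝ) (T : Finset ℕ) :
    deg U (w + u) T = deg U w T + deg U u T := sum_add_distrib

theorem deg_mono (h : ∀ E, w E ≤ u E) (T : Finset ℕ) : deg U w T ≤ deg U u T :=
  sum_le_sum fun E _ => h E

theorem deg_empty : deg U w ∅ = ∑ E ∈ U.powerset, w E := by simp [deg]

theorem deg_link_of_mem (hv : v ∈ T) : deg U (link v w) T = 0 :=
  sum_eq_zero fun _ hE => if_pos ((mem_filter.1 hE).2 hv)

theorem deg_link_of_notMem (hU : v ∈ U) (hv : v ∉ T) :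
    deg U (link v w) T = deg U w (insert v T) := by
  have h1 : deg U (link v w) T = ∑ E ∈ U.powerset with T ⊆ E ∧ v ∉ E, w (insert v E) := by
    rw [deg, ← filter_filter, sum_filter (fun E => v ∉ E)]
    exact sum_congr rfl fun E _ => by simp [link, ite_not]
  rw [h1]
  refine sum_nbij' (insert v) (fun E => E.erase v) ?_ ?_ ?_ ?_ fun _ _ => rfl
  · intro E hE
    simp only [mem_filter, mem_powerset] at hE ⊢
    exact ⟨insert_subset hU hE.1, insert_subset_insert v hE.2.1⟩
  · intro E hE
    simp only [mem_filter, mem_powerset] at hE ⊢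
    exact ⟨(erase_subset v E).trans hE.1,
      (subset_erase.2 ⟨(subset_insert v T).trans hE.2, hv⟩), notMem_erase v E⟩
  · intro E hE
    exact erase_insert (mem_filter.1 hE).2.2
  · intro E hE
    exact insert_erase ((mem_filter.1 hE).2 (mem_insert_self v T))

theorem del_le (hw : ∀ E, 0 ≤ w E) (E : Finset ℕ) : del U τ w G E ≤ w E := by
  rw [del]
  split_ifs
  · exact hw E
  · exact le_rfl

theorem del_nonneg (hw : ∀ E, 0 ≤ w E) (E : Finset ℕ) : 0 ≤ del U τ w G E := by
  rw [del]
  split_ifs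
  · exact le_rfl
  · exact hw E

theorem ne_zero_of_del_ne_zero {E : Finset ℕ} (h : del U τ w G E ≠ 0) : w E ≠ 0 := by
  rw [del] at h
  split_ifs at h
  · exact absurd rfl h
  · exact h

theorem del_anti (hw : ∀ E, 0 ≤ w E) (h : ∀ E, G E ≤ u E) (E : Finset ℕ) :
    del U τ w u E ≤ del U τ w G E := by
  by_cases hG : ∃ T ⊆ E, T.Nonempty ∧ τ ^ #T ≤ deg U G T
  · obtain ⟨T, hT, hT', hle⟩ := hG
    rw [del, if_pos ⟨T, hT, hT', hle.trans (deg_mono h T)⟩]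
    exact del_nonneg hw E
  · conv_rhs => rw [del, if_neg hG]
    exact del_le hw E

theorem deg_del_of_le (hT : T.Nonempty) (h : τ ^ #T ≤ deg U G T) {R : Finset ℕ} (hR : T ⊆ R) :
    deg U (del U τ w G) R = 0 :=
  sum_eq_zero fun E hE => by
    rw [del, if_pos ⟨T, hR.trans (mem_filter.1 hE).2, hT, h⟩]

theorem link_nonneg (hw : ∀ E, 0 ≤ w E) (E : Finset ℕ) : 0 ≤ link v w E := by
  rw [link]
  split_ifs
  · exact le_rfl
  · exact hw _

theorem run_nonneg (hw : ∀ E, 0 ≤ w E) (i : ℕ) (E : Finset ℕ) : 0 ≤ (run U τ w I i).1 E := by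
  rcases I.eq_empty_or_nonempty with rfl | hI
  · simp [run_empty]
  · induction i with
    | zero => simp [run]
    | succ i ih =>
      rw [run_succ hI]
      exact add_nonneg ih (link_nonneg (del_nonneg hw) E)

theorem run_ne_zero {s : ℕ} (hw : ∀ E, w E ≠ 0 → E ⊆ U ∧ #E = s + 1) (i : ℕ) (E : Finset ℕ)
    (hE : (run U τ w I i).1 E ≠ 0) : E ⊆ U ∧ #E = s := by
  rcases I.eq_empty_or_nonempty with rfl | hI
  · simp [run_empty] at hE
  · induction i with
    | zero => simp [run] at hE
    | succ i ih =>
      by_cases h : (run U τ w I i).1 E = 0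
      · rw [run_succ hI] at hE
        simp only [Pi.add_apply, h, zero_add, link] at hE
        split_ifs at hE with hv
        · exact absurd rfl hE
        · obtain ⟨h1, h2⟩ := hw _ (ne_zero_of_del_ne_zero hE)
          rw [card_insert_of_notMem hv] at h2
          exact ⟨(subset_insert _ _).trans h1, by omega⟩
      · exact ih h

theorem run_eq_zero_of_subset (hind : ∀ E ⊆ I, w E = 0) (i : ℕ) (E : Finset ℕ) (hE : E ⊆ I) :
    (run U τ w I i).1 E = 0 := by
  rcases I.eq_empty_or_nonempty with rfl | hI
  · simp [run_empty]
  · induction i with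
    | zero => simp [run]
    | succ i ih =>
      rw [run_succ hI]
      simp only [Pi.add_apply, ih, zero_add, link]
      split_ifs
      · rfl
      · by_contra h
        exact ne_zero_of_del_ne_zero h (hind _ (insert_subset (sel_mem hI i) hE))

theorem deg_run_le {K : ℝ} (hK : 0 ≤ K) (hτ : 0 < τ) (hIU : I ⊆ U) (hw : ∀ E, 0 ≤ w E)
    (hdeg : ∀ T : Finset ℕ, T.Nonempty → deg U w T ≤ K * τ ^ (#T - 1)) (i : ℕ)
    (hT : T.Nonempty) : deg U (run U τ w I i).1 T ≤ (1 + K) * τ ^ #T := by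
  rcases I.eq_empty_or_nonempty with rfl | hI
  · simp only [run_empty, deg, Pi.zero_apply, sum_const_zero]
    positivity
  · induction i with
    | zero =>
      simp only [run, deg, Pi.zero_apply, sum_const_zero]
      positivity
    | succ i ih =>
      rw [run_succ hI, deg_add]
      by_cases hv : sel U τ w I i ∈ T
      · rw [deg_link_of_mem hv, add_zero]
        exact ih
      · rw [deg_link_of_notMem (hIU (sel_mem hI i)) hv]
        rcases le_or_gt (τ ^ #T) (deg U (run U τ w I i).1 T) with h | h
        · rw [deg_del_of_le hT h (subset_insert _ _), add_zero]
          exact ih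
        · have h1 := (deg_mono (U := U) (del_le (U := U) (τ := τ) (G := (run U τ w I i).1) hw)
            (insert (sel U τ w I i) T)).trans (hdeg _ (insert_nonempty _ _))
          rw [card_insert_of_notMem hv, Nat.add_sub_cancel] at h1
          linarith

theorem mul_deg_del_le (hIU : I ⊆ U) (hw : ∀ E, 0 ≤ w E) (i : ℕ) (hv : v ∈ I) :
    i * deg U (del U τ w (run U τ w I i).1) {v} ≤ deg U (run U τ w I i).1 ∅ := by
  have hI : I.Nonempty := ⟨v, hv⟩
  induction i with
  | zero => simp [run, deg]
  | succ i ih =>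
    have h1 : deg U (del U τ w (run U τ w I (i + 1)).1) {v} ≤
        deg U (del U τ w (run U τ w I i).1) {v} := by
      refine deg_mono (del_anti hw fun E => ?_) _
      rw [run_succ hI]
      exact le_add_of_nonneg_right (link_nonneg (del_nonneg hw) E)
    have h2 : deg U (del U τ w (run U τ w I i).1) {v} ≤
        deg U (del U τ w (run U τ w I i).1) {sel U τ w I i} :=
      le_argmax (fun v => deg U (del U τ w (run U τ w I i).1) {v}) hv
    have h3 : deg U (run U τ w I (i + 1)).1 ∅ = deg U (run U τ w I i).1 ∅ +
        deg U (del U τ w (run U τ w I i).1) {sel U τ w I i} := by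
      rw [run_succ hI, deg_add, deg_link_of_notMem (hIU (sel_mem hI i)) (notMem_empty _)]
      rfl
    have h4 : (i : ℝ) * deg U (del U τ w (run U τ w I (i + 1)).1) {v} ≤
        i * deg U (del U τ w (run U τ w I i).1) {v} := by gcongr
    rw [h3]
    push_cast
    linarith

theorem sum_deg_eq (s : ℕ) (hG : ∀ E, G E ≠ 0 → E ⊆ U ∧ #E = s) :
    ∑ T ∈ U.powerset, deg U G T = 2 ^ s * deg U G ∅ := by
  simp only [deg, sum_filter, empty_subset, if_true]
  rw [sum_comm, mul_sum]
  refine sum_congr rfl fun E hE => ?_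
  by_cases h : G E = 0
  · simp [h]
  rw [← sum_filter, sum_const, nsmul_eq_mul]
  congr 1
  have : (U.powerset.filter fun T => T ⊆ E) = E.powerset := by
    ext T
    simp only [mem_filter, mem_powerset, and_iff_right_iff_imp]
    exact fun hT => hT.trans (mem_powerset.1 hE)
  rw [this, card_powerset, (hG E h).2]
  norm_num

/-- The weight of the deleted edges is bounded in terms of the weight of `G`. -/
theorem deg_sub_deg_del_le {K : ℝ} (hK : 0 ≤ K) (hτ : 0 < τ) (hw : ∀ E, 0 ≤ w E)
    (hG : ∀ E, 0 ≤ G E)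
    (hdeg : ∀ T : Finset ℕ, T.Nonempty → deg U w T ≤ K * τ ^ (#T - 1)) :
    deg U w ∅ - deg U (del U τ w G) ∅ ≤ K / τ * ∑ T ∈ U.powerset, deg U G T := by
  classical
  have h1 : deg U w ∅ - deg U (del U τ w G) ∅ ≤
      ∑ T ∈ U.powerset with T.Nonempty ∧ τ ^ #T ≤ deg U G T, deg U w T := by
    have : ∀ T, (if T.Nonempty ∧ τ ^ #T ≤ deg U G T then deg U w T else 0) =
        ∑ E ∈ U.powerset, if T ⊆ E ∧ T.Nonempty ∧ τ ^ #T ≤ deg U G T then w E else 0 := by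
      intro T
      rw [show deg U w T = ∑ E ∈ U.powerset, if T ⊆ E then w E else 0 from sum_filter _ _]
      split_ifs with h
      · exact sum_congr rfl fun E _ => by simp [h]
      · exact (sum_eq_zero fun E _ => by rw [if_neg fun h' => h h'.2]).symm
    rw [deg_empty, deg_empty, ← sum_sub_distrib, sum_filter, sum_congr rfl fun T _ => this T,
      sum_comm]
    refine sum_le_sum fun E hE => ?_
    rw [del]
    split_ifs with h
    · obtain ⟨T, hT, hT'⟩ := h
      rw [sub_zero]
      refine le_trans ?_ (single_le_sum (fun T _ => ?_)
        (mem_powerset.2 (hT.trans (mem_powerset.1 hE))))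
      · rw [if_pos ⟨hT, hT'⟩]
      · split_ifs
        · exact hw E
        · exact le_rfl
    · rw [sub_self]
      refine sum_nonneg fun T _ => ?_
      split_ifs
      · exact hw E
      · exact le_rfl
  refine h1.trans ?_
  rw [mul_sum]
  refine (sum_le_sum fun T hT => ?_).trans
    (sum_le_sum_of_subset_of_nonneg (filter_subset _ _) fun T _ _ =>
      mul_nonneg (by positivity) (deg_nonneg hG T))
  obtain ⟨-, hT1, hT2⟩ := mem_filter.1 hT
  obtain ⟨m, hm⟩ : ∃ m, #T = m + 1 := ⟨#T - 1, by have := hT1.card_pos; omega⟩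
  calc deg U w T ≤ K * τ ^ (#T - 1) := hdeg T hT1
    _ = K / τ * τ ^ #T := by
      rw [hm, Nat.add_sub_cancel, pow_succ]
      field_simp
    _ ≤ _ := by gcongr

theorem deg_empty_le_sum {s : ℕ} (hu : ∀ E, 0 ≤ u E) (hs : ∀ E, u E ≠ 0 → #E = s + 1) :
    deg U u ∅ ≤ ∑ v ∈ U, deg U u {v} := by
  simp only [deg, sum_filter, empty_subset, if_true]
  rw [sum_comm]
  refine sum_le_sum fun E hE => ?_
  by_cases h : u E = 0
  · simp [h]
  obtain ⟨v, hv⟩ : E.Nonempty := card_pos.1 (by rw [hs E h]; omega)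
  refine le_trans ?_ (single_le_sum (fun v _ => ?_) (mem_powerset.1 hE hv))
  · simp [hv]
  · split_ifs
    · exact hu E
    · exact le_rfl

theorem deg_div (w : Finset ℕ → ℝ) (a : ℝ) (T : Finset ℕ) :
    deg U (fun E => w E / a) T = deg U w T / a :=
  (sum_div _ _ _).symm

/-- If the hypergraph that is built stays small, then many vertices have large degree. -/
theorem card_filter_deg_lt {K c n : ℝ} {s : ℕ} (hK : 0 < K) (hτ : 0 < τ) (hn : 0 < n) (hc : 0 < c)
    (hc1 : c ≤ 1 / 4) (hc2 : K * 2 ^ s * c ≤ 1 / 4) (hU : (#U : ℝ) ≤ n) (hw : ∀ E, 0 ≤ w E)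
    (hwU : ∀ E, w E ≠ 0 → E ⊆ U ∧ #E = s + 1) (htot : n ≤ deg U w ∅)
    (hdeg : ∀ T : Finset ℕ, T.Nonempty → deg U w T ≤ K * τ ^ (#T - 1))
    (hG : ∀ E, 0 ≤ G E) (hGU : ∀ E, G E ≠ 0 → E ⊆ U ∧ #E = s) (hGtot : deg U G ∅ ≤ c * τ * n) :
    (#(U.filter fun v => deg U (del U τ w G) {v} < c) : ℝ) + 1 / (2 * K) * n ≤ #U := by
  have h1 := deg_sub_deg_del_le hK.le hτ hw hG hdeg
  rw [sum_deg_eq s hGU] at h1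
  have h2 : K / τ * (2 ^ s * deg U G ∅) ≤ n / 4 := by
    calc K / τ * (2 ^ s * deg U G ∅) ≤ K / τ * (2 ^ s * (c * τ * n)) := by gcongr
      _ = K * 2 ^ s * c * n := by field_simp
      _ ≤ 1 / 4 * n := by gcongr
      _ = n / 4 := by ring
  have h3 := deg_empty_le_sum (U := U) (u := del U τ w G) (s := s) (del_nonneg hw)
    fun E hE => (hwU E (ne_zero_of_del_ne_zero hE)).2
  rw [← sum_filter_add_sum_filter_not U fun v => deg U (del U τ w G) {v} < c] at h3
  have h4 : ∑ v ∈ U with deg U (del U τ w G) {v} < c, deg U (del U τ w G) {v} ≤ c * n := by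
    calc _ ≤ ∑ v ∈ U with deg U (del U τ w G) {v} < c, c :=
          sum_le_sum fun v hv => (mem_filter.1 hv).2.le
      _ = #(U.filter fun v => deg U (del U τ w G) {v} < c) * c := by simp
      _ ≤ #U * c := by gcongr; exact filter_subset _ _
      _ ≤ n * c := by gcongr
      _ = c * n := mul_comm _ _
  have h5 : ∑ v ∈ U with ¬ deg U (del U τ w G) {v} < c, deg U (del U τ w G) {v} ≤
      #(U.filter fun v => ¬ deg U (del U τ w G) {v} < c) * K := by
    calc _ ≤ ∑ v ∈ U with ¬ deg U (del U τ w G) {v} < c, K :=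
          sum_le_sum fun v _ => (deg_mono (del_le hw) _).trans
            ((hdeg {v} (singleton_nonempty v)).trans (by simp))
      _ = _ := by simp
  have h6 : (#(U.filter fun v => deg U (del U τ w G) {v} < c) : ℝ) +
      #(U.filter fun v => ¬ deg U (del U τ w G) {v} < c) = #U := by
    exact_mod_cast card_filter_add_card_filter_not _
  have h7 : c * n ≤ 1 / 4 * n := by gcongr
  have h8 : 1 / (2 * K) * n ≤ #(U.filter fun v => ¬ deg U (del U τ w G) {v} < c) := by
    rw [one_div_mul_eq_div, div_le_iff₀ (by positivity)]
    linarith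
  linarith

/-- The container theorem for weighted uniform hypergraphs with well distributed degrees. -/
theorem exists_container (s : ℕ) : ∀ K : ℝ, 0 < K → ∃ δ : ℝ, 0 < δ ∧
    ∀ (U : Finset ℕ) (w : Finset ℕ → ℝ) (τ n : ℝ) (q : ℕ), 0 < τ → 0 < n → τ * n ≤ q →
      (#U : ℝ) ≤ n → (∀ E, 0 ≤ w E) → (∀ E, w E ≠ 0 → E ⊆ U ∧ #E = s) → n ≤ deg U w ∅ →
      (∀ T : Finset ℕ, T.Nonempty → deg U w T ≤ K * τ ^ (#T - 1)) →
      ∃ f : Finset ℕ → Finset ℕ, ∀ I ⊆ U, (∀ E ⊆ I, w E = 0) → ∃ S ⊆ I, #S ≤ s * q ∧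
        (∀ S', S ⊆ S' → S' ⊆ I → f S' = f I) ∧ I ⊆ f I ∧ f I ⊆ U ∧ (#(f I) : ℝ) + δ * n ≤ #U := by
  classical
  induction s with
  | zero =>
    refine fun K _ => ⟨1, one_pos, fun U w τ n q _ hn _ _ _ hwU htot _ => ⟨id, fun I _ hI => ?_⟩⟩
    rw [deg_empty, sum_eq_zero fun E _ => ?_] at htot
    · exact absurd htot hn.not_ge
    · by_contra h
      rw [card_eq_zero.1 (hwU E h).2, hI ∅ (empty_subset _)] at h
      exact h rfl
  | succ s ih =>
    intro K hK
    set c : ℝ := 1 / (4 * (K + 1) * 2 ^ s) with hc_def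
    have hc : 0 < c := by positivity
    have hc' : c * (4 * (K + 1) * 2 ^ s) = 1 := by rw [hc_def]; field_simp
    have hc1 : c ≤ 1 / 4 := by
      have : (1 : ℝ) ≤ (K + 1) * 2 ^ s :=
        one_le_mul_of_one_le_of_one_le (by linarith) (one_le_pow₀ one_le_two)
      nlinarith
    have hc2 : K * 2 ^ s * c ≤ 1 / 4 := by
      have : 0 < 2 ^ s * c := by positivity
      nlinarith
    obtain ⟨δ, hδ, H⟩ := ih ((1 + K) / c) (by positivity)
    refine ⟨min δ (1 / (2 * K)), by positivity,
      fun U w τ n q hτ hn hq hU hw hwU htot hdeg => ?_⟩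
    have hq0 : (0 : ℝ) < q := (mul_pos hτ hn).trans_le hq
    have H' : ∀ u : Finset ℕ → ℝ, ∃ g : Finset ℕ → Finset ℕ,
        (∀ E, 0 ≤ u E) → (∀ E, u E ≠ 0 → E ⊆ U ∧ #E = s) → n ≤ deg U u ∅ →
        (∀ T : Finset ℕ, T.Nonempty → deg U u T ≤ (1 + K) / c * τ ^ (#T - 1)) →
        ∀ I ⊆ U, (∀ E ⊆ I, u E = 0) → ∃ S ⊆ I, #S ≤ s * q ∧
        (∀ S', S ⊆ S' → S' ⊆ I → g S' = g I) ∧ I ⊆ g I ∧ g I ⊆ U ∧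
          (#(g I) : ℝ) + δ * n ≤ #U := by
      intro u
      by_cases h : (∀ E, 0 ≤ u E) ∧ (∀ E, u E ≠ 0 → E ⊆ U ∧ #E = s) ∧ n ≤ deg U u ∅ ∧
        (∀ T : Finset ℕ, T.Nonempty → deg U u T ≤ (1 + K) / c * τ ^ (#T - 1))
      · obtain ⟨g, hg⟩ := H U u τ n q hτ hn hq hU h.1 h.2.1 h.2.2.1 h.2.2.2
        exact ⟨g, fun _ _ _ _ => hg⟩
      · exact ⟨id, fun h1 h2 h3 h4 => absurd ⟨h1, h2, h3, h4⟩ h⟩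
    choose F hF using H'
    refine ⟨fun S' => if c * τ * n ≤ deg U (run U τ w S' q).1 ∅
      then F (fun E => (run U τ w S' q).1 E / (c * τ)) S'
      else U.filter fun v => deg U (del U τ w (run U τ w S' q).1) {v} < c, fun I hI hind => ?_⟩
    set G := (run U τ w I q).1 with hG_def
    have hG0 : ∀ E, 0 ≤ G E := run_nonneg hw q
    have hGU : ∀ E, G E ≠ 0 → E ⊆ U ∧ #E = s := run_ne_zero hwU q
    by_cases hbig : c * τ * n ≤ deg U G ∅
    · obtain ⟨S, hSI, hS, hS', h3, h4, h5⟩ := hF (fun E => G E / (c * τ))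
        (fun E => div_nonneg (hG0 E) (by positivity))
        (fun E hE => hGU E fun h => hE (by simp [h]))
        (by rw [deg_div, le_div_iff₀ (by positivity)]; linarith)
        (fun T hT => by
          obtain ⟨m, hm⟩ : ∃ m, #T = m + 1 := ⟨#T - 1, by have := hT.card_pos; omega⟩
          have := deg_run_le hK.le hτ hI hw hdeg q hT
          rw [deg_div, div_le_iff₀ (by positivity)]
          refine this.trans_eq ?_
          rw [hm, Nat.add_sub_cancel, pow_succ]
          field_simp)
        I hI fun E hE => by simp [hG_def, run_eq_zero_of_subset hind q E hE]
      refine ⟨(run U τ w I q).2 ∪ S, union_subset (run_subset q) hSI, ?_, fun S' h1 h2 => ?_, ?_⟩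
      · calc _ ≤ #(run U τ w I q).2 + #S := card_union_le _ _
          _ ≤ q + s * q := add_le_add (card_run_le q) hS
          _ = _ := by ring
      · simp only [run_eq_of_subset h2 q (subset_union_left.trans h1)]
        rw [← hG_def, if_pos hbig, if_pos hbig, hS' S' (subset_union_right.trans h1) h2]
      · simp only [← hG_def]
        rw [if_pos hbig]
        refine ⟨h3, h4, h5.trans' ?_⟩
        gcongr
        exact min_le_left _ _
    · refine ⟨(run U τ w I q).2, run_subset q, (card_run_le q).trans ?_, fun S' h1 h2 => ?_, ?_⟩
      · exact Nat.le_mul_of_pos_left q s.succ_pos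
      · simp only [run_eq_of_subset h2 q h1]
        rw [← hG_def, if_neg hbig, if_neg hbig]
      · simp only [← hG_def]
        rw [if_neg hbig]
        refine ⟨fun v hv => mem_filter.2 ⟨hI hv, ?_⟩, filter_subset _ _, ?_⟩
        · have h3 := mul_deg_del_le (τ := τ) hI hw q hv
          have h4 : c * (τ * n) ≤ c * q := by gcongr
          rw [← mul_lt_mul_iff_right₀ hq0]
          linarith
        · refine (card_filter_deg_lt hK hτ hn hc hc1 hc2 hU hw hwU htot hdeg hG0 hGU
            (not_le.1 hbig).le).trans' ?_
          gcongr
          exact min_le_right _ _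

/-- The arithmetic progression of length `k` with first term `q.1` and common difference `q.2`. -/
def ap (k : ℕ) (q : ℕ × ℕ) : Finset ℕ := (range k).image fun i => q.1 + i * q.2

theorem mem_ap {k v : ℕ} {q : ℕ × ℕ} : v ∈ ap k q ↔ ∃ i < k, q.1 + i * q.2 = v := by simp [ap]

theorem apIn_iff {k : ℕ} {C : Finset ℕ} {a d : ℕ} : APIn k C a d ↔ 1 ≤ d ∧ ap k (a, d) ⊆ C := by
  simp [APIn, ap, image_subset_iff]

theorem card_ap {k : ℕ} {q : ℕ × ℕ} (hq : 1 ≤ q.2) : #(ap k q) = k := by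
  rw [ap, card_image_of_injective, card_range]
  intro i j h
  exact Nat.eq_of_mul_eq_mul_right hq (Nat.add_left_cancel h)

theorem card_filter_mem_ap_le (k n v : ℕ) :
    #((range (n + 1) ×ˢ range (n + 1)).filter fun q => v ∈ ap k q) ≤ k * (n + 1) := by
  have : ((range (n + 1) ×ˢ range (n + 1)).filter fun q => v ∈ ap k q) ⊆
      (range k ×ˢ range (n + 1)).image fun p => (v - p.1 * p.2, p.2) := by
    intro q hq
    simp only [mem_filter, mem_product, mem_range, mem_ap] at hq
    obtain ⟨⟨-, h2⟩, i, hi, h⟩ := hq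
    refine mem_image.2 ⟨(i, q.2), by simp [hi, h2], Prod.ext ?_ rfl⟩
    simp [← h]
  refine (card_le_card this).trans (card_image_le.trans ?_)
  simp

theorem card_filter_pair_subset_ap_le (k : ℕ) (Q : Finset (ℕ × ℕ)) {u v : ℕ} (huv : u ≠ v) :
    #(Q.filter fun q => u ∈ ap k q ∧ v ∈ ap k q) ≤ k ^ 2 := by
  classical
  have : ∀ q : ℕ × ℕ, u ∈ ap k q ∧ v ∈ ap k q → ∃ p : ℕ × ℕ, p.1 < k ∧ p.2 < k ∧
      q.1 + p.1 * q.2 = u ∧ q.1 + p.2 * q.2 = v := by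
    rintro q ⟨h1, h2⟩
    obtain ⟨i, hi, hi'⟩ := mem_ap.1 h1
    obtain ⟨j, hj, hj'⟩ := mem_ap.1 h2
    exact ⟨(i, j), hi, hj, hi', hj'⟩
  choose! F hF using this
  have hinj : Set.InjOn F (Q.filter fun q => u ∈ ap k q ∧ v ∈ ap k q) := by
    intro q hq q' hq' h
    obtain ⟨-, -, h1, h2⟩ := hF q (mem_filter.1 hq).2
    obtain ⟨-, -, h3, h4⟩ := hF q' (mem_filter.1 hq').2
    rw [← h] at h3 h4
    zify at h1 h2 h3 h4 huv
    have hd : ((F q).1 - (F q).2 : ℤ) * (q.2 - q'.2) = 0 := by linarith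
    have hne : ((F q).1 - (F q).2 : ℤ) ≠ 0 := by
      intro h0
      rw [sub_eq_zero.1 h0] at h1
      exact huv (h1.symm.trans h2)
    have h5 : (q.2 : ℤ) = q'.2 := sub_eq_zero.1 ((mul_eq_zero.1 hd).resolve_left hne)
    rw [h5] at h1
    have h6 : (q.1 : ℤ) = q'.1 := by linarith
    exact Prod.ext (by exact_mod_cast h6) (by exact_mod_cast h5)
  calc _ ≤ #(range k ×ˢ range k) := card_le_card_of_injOn F (fun q hq => by
        obtain ⟨h1, h2, -⟩ := hF q (mem_filter.1 hq).2
        simp [h1, h2]) hinj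
    _ = k ^ 2 := by simp [sq]

open scoped Classical in
/-- The weighted hypergraph of arithmetic progressions in `C ⊆ [n]`. -/
noncomputable def apWeight (k n : ℕ) (ε : ℝ) (C E : Finset ℕ) : ℝ :=
  #(((range (n + 1) ×ˢ range (n + 1)).filter fun q => APIn k C q.1 q.2).filter
    fun q => ap k q = E) / (ε * n)

open scoped Classical in
theorem deg_apWeight (k n : ℕ) (ε : ℝ) (C T : Finset ℕ) : deg C (apWeight k n ε C) T =
    #(((range (n + 1) ×ˢ range (n + 1)).filter fun q => APIn k C q.1 q.2).filter
      fun q => T ⊆ ap k q) / (ε * n) := by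
  rw [deg]
  simp only [apWeight]
  rw [← sum_div]
  congr 1
  rw [card_eq_sum_card_fiberwise (f := ap k) (t := C.powerset.filter fun E => T ⊆ E)]
  · push_cast
    refine sum_congr rfl fun E hE => ?_
    congr 2
    ext q
    simp only [mem_filter]
    refine ⟨fun h => ⟨⟨h.1, h.2 ▸ (mem_filter.1 hE).2⟩, h.2⟩, fun h => ⟨h.1.1, h.2⟩⟩
  · intro q hq
    rw [mem_coe, mem_filter, mem_filter] at hq
    exact mem_filter.2 ⟨mem_powerset.2 (apIn_iff.1 hq.1.2).2, hq.2⟩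

/-- The container theorem for the subsets without progressions of a dense set of integers. -/
theorem exists_container_ap (k : ℕ) (hk : 2 ≤ k) {β : ℝ} (hβ : 0 < β) : ∃ δ : ℝ, 0 < δ ∧ ∃ N₀ : ℕ,
    ∀ n, N₀ ≤ n → ∀ (τ : ℝ) (q : ℕ), 0 < τ → τ ≤ 1 → 1 ≤ τ ^ (k - 1) * n → τ * n ≤ q →
      ∀ C ⊆ Icc 1 n, β * n ≤ #C → ∃ f : Finset ℕ → Finset ℕ, ∀ I ⊆ C, (∀ a d, ¬ APIn k I a d) →
        ∃ S ⊆ I, #S ≤ k * q ∧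
          (∀ S', S ⊆ S' → S' ⊆ I → f S' = f I) ∧ I ⊆ f I ∧ f I ⊆ C ∧ (#(f I) : ℝ) + δ * n ≤ #C := by
  classical
  obtain ⟨ε, hε, N₀, hN₀⟩ := Cube.exists_card_ap_ge k hk hβ
  obtain ⟨δ, hδ, H⟩ := exists_container k (2 * k ^ 2 / ε) (by positivity)
  refine ⟨δ, hδ, N₀, fun n hn τ q hτ hτ1 hτn hq C hC hCn => ?_⟩
  have hn0 : (0 : ℝ) < n := by
    by_contra h
    have : (0 : ℝ) < τ ^ (k - 1) := by positivity
    nlinarith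
  have hn1 : (1 : ℝ) ≤ n := by exact_mod_cast Nat.cast_pos.1 hn0
  have hk1 : (1 : ℝ) ≤ k := by exact_mod_cast (by omega : 1 ≤ k)
  have key : ∀ E, apWeight k n ε C E ≠ 0 → ∃ q : ℕ × ℕ, APIn k C q.1 q.2 ∧ ap k q = E := by
    intro E hE
    by_contra! h
    refine hE ?_
    rw [apWeight, filter_eq_empty_iff.2 fun q hq => h q (mem_filter.1 hq).2]
    simp
  obtain ⟨f, hf⟩ := H C (apWeight k n ε C) τ n q hτ hn0 hq
    (by simpa using (Nat.cast_le (α := ℝ)).2 (card_le_card hC))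
    (fun E => by rw [apWeight]; positivity)
    (fun E hE => by
      obtain ⟨q, hq, rfl⟩ := key E hE
      exact ⟨(apIn_iff.1 hq).2, card_ap hq.1⟩)
    (by
      rw [deg_apWeight, le_div_iff₀ (by positivity), filter_true_of_mem (by simp)]
      refine (hN₀ n hn C hC hCn).trans' (by linarith [sq (n : ℝ)]))
    (fun T hT => by
      rw [deg_apWeight, div_le_iff₀ (by positivity)]
      have e : 2 * (k : ℝ) ^ 2 / ε * τ ^ (#T - 1) * (ε * n) = 2 * k ^ 2 * (τ ^ (#T - 1) * n) := by
        field_simp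
      rw [e]
      rcases (Nat.succ_le_of_lt hT.card_pos).eq_or_lt with h1 | h1
      · obtain ⟨v, rfl⟩ := card_eq_one.1 h1.symm
        simp only [card_singleton, Nat.sub_self, pow_zero, one_mul, singleton_subset_iff]
        have := (card_le_card (filter_subset_filter (fun q => v ∈ ap k q) (filter_subset
          (fun q => APIn k C q.1 q.2) (range (n + 1) ×ˢ range (n + 1))))).trans
          (card_filter_mem_ap_le k n v)
        calc _ ≤ ((k * (n + 1) : ℕ) : ℝ) := by exact_mod_cast this
          _ = k * (n + 1) := by push_cast; ring
          _ ≤ k * (2 * n) := by gcongr; linarith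
          _ ≤ k * (2 * n) * k := le_mul_of_one_le_right (by positivity) hk1
          _ = _ := by ring
      · obtain ⟨u, hu, v, hv, huv⟩ := one_lt_card.1 h1
        rcases le_or_gt #T k with h2 | h2
        · have h3 := (card_le_card (monotone_filter_right
            ((range (n + 1) ×ˢ range (n + 1)).filter fun q => APIn k C q.1 q.2)
            fun (q : ℕ × ℕ) _ (h : T ⊆ ap k q) => (⟨h hu, h hv⟩ : u ∈ ap k q ∧ v ∈ ap k q))).trans
            (card_filter_pair_subset_ap_le k _ huv)
          have h4 : 1 ≤ τ ^ (#T - 1) * n := hτn.trans (by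
            gcongr ?_ * _
            exact pow_le_pow_of_le_one hτ.le hτ1 (by omega))
          calc _ ≤ ((k ^ 2 : ℕ) : ℝ) := by exact_mod_cast h3
            _ ≤ 2 * k ^ 2 * 1 := by push_cast; nlinarith
            _ ≤ _ := by gcongr
        · rw [filter_eq_empty_iff.2 fun q hq h => ?_]
          · simp only [card_empty, Nat.cast_zero]
            positivity
          · have := card_le_card h
            rw [card_ap (mem_filter.1 hq).2.1] at this
            omega)
  refine ⟨f, fun I hI hfree => hf I hI fun E hE => ?_⟩
  by_contra h
  obtain ⟨q, hq, rfl⟩ := key E h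
  exact hfree q.1 q.2 (apIn_iff.2 ⟨hq.1, hE⟩)

/-- Subsets of `[n]` without progressions have few containers that are sparse. -/
theorem exists_containers (k : ℕ) (hk : 2 ≤ k) {β : ℝ} (hβ : 0 < β) : ∃ M N₀ : ℕ,
    ∀ n, N₀ ≤ n → ∀ (τ : ℝ) (q : ℕ), 0 < τ → τ ≤ 1 → 1 ≤ τ ^ (k - 1) * n → τ * n ≤ q →
      ∃ f : Finset ℕ → Finset ℕ, ∀ I ⊆ Icc 1 n, (∀ a d, ¬ APIn k I a d) →
        ∃ S ⊆ I, #S ≤ M * q ∧ I ⊆ f S ∧ (#(f S) : ℝ) ≤ β * n := by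
  classical
  obtain ⟨δ, hδ, N₀, H⟩ := exists_container_ap k hk hβ
  obtain ⟨r, hr⟩ := exists_nat_gt (1 / δ)
  refine ⟨r * k, N₀ + 1, fun n hn τ q hτ hτ1 hτn hq => ?_⟩
  have hn0 : (0 : ℝ) < n := by exact_mod_cast (by omega : 0 < n)
  have H' : ∀ C : Finset ℕ, ∃ g : Finset ℕ → Finset ℕ, C ⊆ Icc 1 n → β * n ≤ #C →
      ∀ I ⊆ C, (∀ a d, ¬ APIn k I a d) → ∃ S ⊆ I, #S ≤ k * q ∧
        (∀ S', S ⊆ S' → S' ⊆ I → g S' = g I) ∧ I ⊆ g I ∧ g I ⊆ C ∧ (#(g I) : ℝ) + δ * n ≤ #C := by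
    intro C
    by_cases h : C ⊆ Icc 1 n ∧ β * n ≤ #C
    · obtain ⟨g, hg⟩ := H n (by omega) τ q hτ hτ1 hτn hq C h.1 h.2
      exact ⟨g, fun _ _ => hg⟩
    · exact ⟨id, fun h1 h2 => absurd ⟨h1, h2⟩ h⟩
  choose F hF using H'
  have main : ∀ r : ℕ, ∃ f : Finset ℕ → Finset ℕ, ∀ I ⊆ Icc 1 n, (∀ a d, ¬ APIn k I a d) →
      ∃ S ⊆ I, #S ≤ r * k * q ∧ (∀ S', S ⊆ S' → S' ⊆ I → f S' = f I) ∧ I ⊆ f I ∧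
        f I ⊆ Icc 1 n ∧ ((#(f I) : ℝ) ≤ β * n ∨ (#(f I) : ℝ) + r * δ * n ≤ n) := by
    intro r
    induction r with
    | zero =>
      exact ⟨fun _ => Icc 1 n, fun I hI _ => ⟨∅, empty_subset _, by simp, fun _ _ _ => rfl,
        hI, Subset.rfl, Or.inr (by simp)⟩⟩
    | succ r ih =>
      obtain ⟨f, hf⟩ := ih
      refine ⟨fun S' => if β * n ≤ #(f S') then F (f S') S' else f S', fun I hI hfree => ?_⟩
      obtain ⟨S, hSI, hS, h, h1, h2, h3⟩ := hf I hI hfree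
      by_cases hbig : β * n ≤ #(f I)
      · obtain ⟨R, hRI, hR, h4, h5, h6, h7⟩ := hF (f I) h2 hbig I h1 hfree
        refine ⟨S ∪ R, union_subset hSI hRI, ?_, fun S' hS' hS'I => ?_, ?_⟩
        · calc _ ≤ #S + #R := card_union_le _ _
            _ ≤ r * k * q + k * q := add_le_add hS hR
            _ = _ := by ring
        · simp only [h S' (subset_union_left.trans hS') hS'I]
          rw [if_pos hbig, if_pos hbig,
            h4 S' (subset_union_right.trans hS') hS'I]
        · simp only [if_pos hbig]
          refine ⟨h5, h6.trans h2, ?_⟩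
          rcases h3 with h3 | h3
          · exact Or.inl (h3.trans' (by exact_mod_cast card_le_card h6))
          · refine Or.inr ?_
            push_cast
            linarith
      · refine ⟨S, hSI, hS.trans (by gcongr; omega), fun S' hS' hS'I => ?_, ?_⟩
        · simp only [h S' hS' hS'I, if_neg hbig]
        · simp only [if_neg hbig]
          exact ⟨h1, h2, Or.inl (not_le.1 hbig).le⟩
  obtain ⟨f, hf⟩ := main r
  refine ⟨f, fun I hI hfree => ?_⟩
  obtain ⟨S, hSI, hS, h, h1, -, h2⟩ := hf I hI hfree
  rw [← h S Subset.rfl hSI] at h1 h2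
  refine ⟨S, hSI, hS, h1, h2.resolve_right fun h3 => ?_⟩
  rw [div_lt_iff₀ hδ] at hr
  have : (0 : ℝ) ≤ #(f S) := by positivity
  nlinarith

end Container

/-! ### The random set -/

namespace RandomSet

open Finset

variable {n : ℕ} {p : ℝ}

theorem sum_prod_mul_prod (n : ℕ) (p : ℝ) (f g : ℕ → ℝ) :
    ∑ A ∈ (Icc 1 n).powerset, p ^ #A * (1 - p) ^ (n - #A) *
      ((∏ v ∈ A, f v) * ∏ v ∈ Icc 1 n \ A, g v) = ∏ v ∈ Icc 1 n, (p * f v + (1 - p) * g v) := by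
  rw [prod_add]
  refine sum_congr rfl fun A hA => ?_
  rw [prod_mul_distrib, prod_mul_distrib, prod_const, prod_const,
    card_sdiff_of_subset (mem_powerset.1 hA), Nat.card_Icc, Nat.add_sub_cancel]
  ring

theorem sum_weight (n : ℕ) (p : ℝ) :
    ∑ A ∈ (Icc 1 n).powerset, p ^ #A * (1 - p) ^ (n - #A) = 1 := by
  simpa using sum_prod_mul_prod n p (fun _ => 1) fun _ => 1

theorem weight_nonneg (hp : 0 ≤ p) (hp1 : p ≤ 1) (n : ℕ) (A : Finset ℕ) :
    0 ≤ p ^ #A * (1 - p) ^ (n - #A) :=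
  mul_nonneg (pow_nonneg hp _) (pow_nonneg (sub_nonneg.2 hp1) _)

theorem sum_weight_mul_half_pow_le (hp1 : p ≤ 1) (n : ℕ) :
    ∑ A ∈ (Icc 1 n).powerset, p ^ #A * (1 - p) ^ (n - #A) * (1 / 2) ^ #A ≤
      Real.exp (-(n * p / 2)) := by
  have := sum_prod_mul_prod n p (fun _ => 1 / 2) fun _ => 1
  simp only [prod_const, one_pow, mul_one, Nat.card_Icc, Nat.add_sub_cancel] at this
  rw [this]
  calc (p * (1 / 2) + (1 - p)) ^ n ≤ Real.exp (-(p / 2)) ^ n := by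
        refine pow_le_pow_left₀ (by linarith) ?_ n
        linarith [Real.add_one_le_exp (-(p / 2))]
    _ = _ := by rw [← Real.exp_nat_mul]; ring_nf

theorem sum_weight_mul_two_pow_le (hp : 0 ≤ p) (hp1 : p ≤ 1) {S : Finset ℕ} (hS : S ⊆ Icc 1 n)
    (F : Finset ℕ) :
    ∑ A ∈ (Icc 1 n).powerset, p ^ #A * (1 - p) ^ (n - #A) *
      (if S ⊆ A then 2 ^ #(A ∩ F) else 0) ≤ (2 * p) ^ #S * Real.exp (p * #F) := by
  have h := sum_prod_mul_prod n p (fun v => if v ∈ F then 2 else 1) fun v => if v ∈ S then 0 else 1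
  have h1 : ∀ A ∈ (Icc 1 n).powerset, p ^ #A * (1 - p) ^ (n - #A) *
      (if S ⊆ A then 2 ^ #(A ∩ F) else 0) = p ^ #A * (1 - p) ^ (n - #A) *
      ((∏ v ∈ A, if v ∈ F then 2 else 1) * ∏ v ∈ Icc 1 n \ A, if v ∈ S then 0 else 1) := by
    intro A _
    congr 1
    rw [prod_ite_mem, prod_const]
    split_ifs with hSA
    · rw [show (∏ v ∈ Icc 1 n \ A, if v ∈ S then (0 : ℝ) else 1) = 1 from
        prod_eq_one fun v hv => if_neg fun h => (mem_sdiff.1 hv).2 (hSA h), mul_one]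
    · obtain ⟨v, hv, hvA⟩ := not_subset.1 hSA
      rw [show (∏ v ∈ Icc 1 n \ A, if v ∈ S then (0 : ℝ) else 1) = 0 from
        prod_eq_zero (mem_sdiff.2 ⟨hS hv, hvA⟩) (if_pos hv), mul_zero]
  rw [sum_congr rfl h1, h]
  calc _ ≤ ∏ v ∈ Icc 1 n, ((if v ∈ S then 2 * p else 1) * if v ∈ F then Real.exp p else 1) := by
        refine prod_le_prod (fun v _ => ?_) fun v _ => ?_
        · have := sub_nonneg.2 hp1
          positivity
        · have h1 := Real.add_one_le_exp p
          split_ifs <;> nlinarith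
    _ = (2 * p) ^ #S * Real.exp p ^ #(Icc 1 n ∩ F) := by
        rw [prod_mul_distrib, prod_ite_mem, prod_ite_mem, prod_const, prod_const,
          inter_eq_right.2 hS]
    _ ≤ (2 * p) ^ #S * Real.exp p ^ #F := by
        gcongr
        · exact Real.one_le_exp hp
        · exact inter_subset_right
    _ = _ := by rw [← Real.exp_nat_mul, mul_comm p]

theorem sum_two_mul_pow_le (hp : 0 ≤ p) (n t : ℕ) {l : ℝ} (hl : 1 ≤ l) :
    ∑ S ∈ (Icc 1 n).powerset with #S ≤ t, (2 * p) ^ #S ≤ l ^ t * Real.exp (2 * p / l * n) := by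
  have hl0 : 0 < l := by linarith
  calc _ ≤ ∑ S ∈ (Icc 1 n).powerset with #S ≤ t, l ^ t * (2 * p / l) ^ #S := by
        refine sum_le_sum fun S hS => ?_
        calc (2 * p) ^ #S = l ^ #S * (2 * p / l) ^ #S := by
              rw [← mul_pow, mul_div_cancel₀ _ hl0.ne']
          _ ≤ _ := by
              gcongr ?_ * _
              exact pow_le_pow_right₀ hl (mem_filter.1 hS).2
    _ ≤ ∑ S ∈ (Icc 1 n).powerset, l ^ t * (2 * p / l) ^ #S :=
        sum_le_sum_of_subset_of_nonneg (filter_subset _ _) fun _ _ _ => by positivity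
    _ = l ^ t * (2 * p / l + 1) ^ n := by
        rw [← mul_sum]
        have := (prod_add (fun _ => 2 * p / l) (fun _ => (1 : ℝ)) (Icc 1 n)).symm
        simp only [prod_const, one_pow, mul_one, Nat.card_Icc, Nat.add_sub_cancel] at this
        rw [this]
    _ ≤ l ^ t * Real.exp (2 * p / l) ^ n := by
        gcongr
        exact Real.add_one_le_exp _
    _ = _ := by rw [← Real.exp_nat_mul, mul_comm (n : ℝ)]

theorem exp_half_le_two_pow {x : ℝ} {m : ℕ} (h : x ≤ m) : Real.exp (x / 2) ≤ 2 ^ m := by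
  have h1 := Real.log_two_gt_d9
  have h2 : (0 : ℝ) ≤ m := m.cast_nonneg
  calc Real.exp (x / 2) ≤ Real.exp (m * Real.log 2) := Real.exp_le_exp.2 (by nlinarith)
    _ = 2 ^ m := by rw [Real.exp_nat_mul, Real.exp_log two_pos]

open scoped Classical in
/-- The random set fails to be `(α,k)`-Sz with small probability as soon as there are few
containers. -/
theorem sum_weight_not_isSz_le {k t : ℕ} {α l : ℝ} (hα : 0 < α) (hl : 1 ≤ l)
    (hp : 0 ≤ p) (hp1 : p ≤ 1) {f : Finset ℕ → Finset ℕ}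
    (hf : ∀ I ⊆ Icc 1 n, (∀ a d, ¬ APIn k I a d) →
      ∃ S ⊆ I, #S ≤ t ∧ I ⊆ f S ∧ (#(f S) : ℝ) ≤ α / 32 * n) :
    ∑ A ∈ (Icc 1 n).powerset, (if IsSz α k A then 0 else p ^ #A * (1 - p) ^ (n - #A)) ≤
      Real.exp (-(n * p / 4)) +
        l ^ t * Real.exp (2 * p / l * n) * Real.exp (-(3 * α / 32 * (n * p))) := by
  set W : Finset ℕ → ℝ := fun A => p ^ #A * (1 - p) ^ (n - #A) with hW
  have hW0 : ∀ A, 0 ≤ W A := weight_nonneg hp hp1 n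
  set 𝒮 := ((Icc 1 n).powerset.filter fun S => #S ≤ t).filter
    fun S => (#(f S) : ℝ) ≤ α / 32 * n with h𝒮
  have hnp : 0 ≤ n * p := by positivity
  have key : ∀ A ∈ (Icc 1 n).powerset, (if IsSz α k A then 0 else W A) ≤
      W A * (1 / 2) ^ #A * Real.exp (n * p / 4) +
      ∑ S ∈ 𝒮, W A * (if S ⊆ A then 2 ^ #(A ∩ f S) else 0) * Real.exp (-(α * (n * p) / 8)) := by
    intro A hA
    have h1 : 0 ≤ W A * (1 / 2) ^ #A * Real.exp (n * p / 4) := by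
      have := hW0 A
      positivity
    have h2 : ∀ S ∈ 𝒮, 0 ≤ W A * (if S ⊆ A then 2 ^ #(A ∩ f S) else 0) *
        Real.exp (-(α * (n * p) / 8)) := fun S _ => by
      have := hW0 A
      positivity
    split_ifs with h
    · exact add_nonneg h1 (sum_nonneg h2)
    rcases le_or_gt (n * p / 4) #A with hA1 | hA1
    · simp only [IsSz, not_forall, not_exists] at h
      obtain ⟨B, hBA, hB, hfree⟩ := h
      obtain ⟨S, hSB, hS, hBf, hfS⟩ := hf B (hBA.trans (mem_powerset.1 hA)) hfree
      have hS𝒮 : S ∈ 𝒮 := by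
        simp only [h𝒮, mem_filter, mem_powerset]
        exact ⟨⟨(hSB.trans hBA).trans (mem_powerset.1 hA), hS⟩, hfS⟩
      refine (le_add_of_nonneg_of_le h1 ((single_le_sum h2 hS𝒮).trans' ?_))
      rw [if_pos (hSB.trans hBA), mul_assoc]
      refine le_mul_of_one_le_right (hW0 A) ?_
      have h3 : α * (n * p) / 4 ≤ #(A ∩ f S) := by
        have : #B ≤ #(A ∩ f S) := card_le_card (subset_inter hBA hBf)
        have : (#B : ℝ) ≤ #(A ∩ f S) := by exact_mod_cast this
        have : α * (n * p / 4) ≤ α * #A := by gcongr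
        linarith
      rw [Real.exp_neg, ← div_eq_mul_inv, one_le_div (Real.exp_pos _)]
      refine (exp_half_le_two_pow h3).trans' (le_of_eq ?_)
      congr 1
      ring
    · refine le_add_of_le_of_nonneg ?_ (sum_nonneg h2)
      rw [mul_assoc]
      refine le_mul_of_one_le_right (hW0 A) ?_
      rw [one_div, inv_pow, inv_mul_eq_div, one_le_div (by positivity)]
      calc (2 : ℝ) ^ #A ≤ Real.exp 1 ^ #A := by
            gcongr
            linarith [Real.add_one_le_exp 1]
        _ = Real.exp #A := by rw [← Real.exp_nat_mul, mul_one]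
        _ ≤ _ := Real.exp_le_exp.2 hA1.le
  refine (sum_le_sum key).trans ?_
  rw [sum_add_distrib, ← sum_mul, sum_comm]
  refine add_le_add ?_ ?_
  · calc _ ≤ Real.exp (-(n * p / 2)) * Real.exp (n * p / 4) := by
          gcongr
          exact sum_weight_mul_half_pow_le hp1 n
      _ = _ := by rw [← Real.exp_add]; ring_nf
  · calc _ ≤ ∑ S ∈ 𝒮, (2 * p) ^ #S * Real.exp (p * (α / 32 * n)) *
            Real.exp (-(α * (n * p) / 8)) := by
          refine sum_le_sum fun S hS => ?_
          rw [← sum_mul]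
          simp only [h𝒮, mem_filter, mem_powerset] at hS
          gcongr
          refine (sum_weight_mul_two_pow_le hp hp1 hS.1.1 (f S)).trans ?_
          gcongr
          exact hS.2
      _ = (∑ S ∈ 𝒮, (2 * p) ^ #S) * Real.exp (-(3 * α / 32 * (n * p))) := by
          rw [sum_mul]
          refine sum_congr rfl fun S _ => ?_
          rw [mul_assoc, ← Real.exp_add]
          ring_nf
      _ ≤ _ := by
          gcongr
          refine (sum_two_mul_pow_le hp n t hl).trans' ?_
          exact sum_le_sum_of_subset_of_nonneg (filter_subset _ _) fun _ _ _ => by positivity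

theorem isSz_mono {α β : ℝ} {k : ℕ} {A : Finset ℕ} (h : IsSz α k A) (hαβ : α ≤ β) : IsSz β k A :=
  fun B hB hAB => h B hB (hAB.trans' (by gcongr))

end RandomSet

theorem random_szemeredi :
    ∀ k : ℕ, 3 ≤ k → ∀ α : ℝ, 0 < α → ∃ C c : ℝ, 0 < C ∧ 0 < c ∧
      ∀ n : ℕ, ∀ p : ℝ, 0 ≤ p → p ≤ 1 →
        C * (n : ℝ) ^ (-(1 : ℝ) / ((k : ℝ) - 1)) < p →
        1 - Real.exp (-(c * n * p)) ≤ binomProb n p (IsSz α k) := by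
  classical
  intro k hk α₀ hα₀
  set α := min α₀ 1 with hα_def
  have hα : 0 < α := lt_min hα₀ one_pos
  have hα1 : α ≤ 1 := min_le_right _ _
  obtain ⟨M, N₀, H⟩ := Container.exists_containers k (by omega) (β := α / 32) (by positivity)
  set l : ℝ := 64 / α with hl
  have hl1 : 1 ≤ l := by rw [hl, le_div_iff₀ hα]; linarith
  have hlog : 0 ≤ Real.log l := Real.log_nonneg hl1
  have hC0 : 0 < 64 * (M + 1) * (Real.log l + 1) / α + N₀ := by positivity
  set C : ℝ := 64 * (M + 1) * (Real.log l + 1) / α + N₀ with hC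
  have hC1 : 64 * M * Real.log l ≤ α * C := by
    have : α * C = 64 * (M + 1) * (Real.log l + 1) + α * N₀ := by rw [hC]; field_simp
    have : 0 ≤ α * N₀ := by positivity
    have : (0 : ℝ) ≤ M := by positivity
    nlinarith
  have hC2 : 64 ≤ α * C := by
    have : α * C = 64 * (M + 1) * (Real.log l + 1) + α * N₀ := by rw [hC]; field_simp
    have : 0 ≤ α * N₀ := by positivity
    have : (0 : ℝ) ≤ M * Real.log l := by positivity
    have : (0 : ℝ) ≤ M := by positivity
    nlinarith
  have hC3 : N₀ ≤ C := le_add_of_nonneg_left (by positivity)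
  refine ⟨C, α / 64, hC0, by positivity, fun n p hp hp1 hCp => ?_⟩
  have hsum : binomProb n p (IsSz α₀ k) + ∑ A ∈ (Finset.Icc 1 n).powerset,
      (if IsSz α₀ k A then 0 else p ^ A.card * (1 - p) ^ (n - A.card)) = 1 := by
    rw [binomProb, ← Finset.sum_add_distrib]
    refine Eq.trans ?_ (RandomSet.sum_weight n p)
    refine Finset.sum_congr rfl fun A _ => ?_
    split_ifs <;> simp
  have hle : ∑ A ∈ (Finset.Icc 1 n).powerset,
      (if IsSz α₀ k A then 0 else p ^ A.card * (1 - p) ^ (n - A.card)) ≤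
      ∑ A ∈ (Finset.Icc 1 n).powerset,
      (if IsSz α k A then 0 else p ^ A.card * (1 - p) ^ (n - A.card)) := by
    refine Finset.sum_le_sum fun A _ => ?_
    have := RandomSet.weight_nonneg hp hp1 n A
    by_cases h : IsSz α k A
    · rw [if_pos h, if_pos (RandomSet.isSz_mono h (min_le_left _ _))]
    · rw [if_neg h]
      split_ifs <;> linarith
  rcases Nat.eq_zero_or_pos n with rfl | hn
  · have : 0 ≤ binomProb 0 p (IsSz α₀ k) := Finset.sum_nonneg fun A _ => by
      have := RandomSet.weight_nonneg hp hp1 0 A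
      split_ifs <;> simp_all
    simpa using this
  have hn1 : (1 : ℝ) ≤ n := by exact_mod_cast hn
  have hn0 : (0 : ℝ) < n := by linarith
  set τ : ℝ := (n : ℝ) ^ (-(1 : ℝ) / ((k : ℝ) - 1)) with hτ
  have hk1 : ((k - 1 : ℕ) : ℝ) = k - 1 := by rw [Nat.cast_sub (by omega), Nat.cast_one]
  have hk2 : (2 : ℝ) ≤ k - 1 := by
    have : (3 : ℝ) ≤ k := by exact_mod_cast hk
    linarith
  have hτ0 : 0 < τ := by positivity
  have hτ1 : τ ≤ 1 := Real.rpow_le_one_of_one_le_of_nonpos hn1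
    (div_nonpos_of_nonpos_of_nonneg (by norm_num) (by linarith))
  have hτk : τ ^ (k - 1) * n = 1 := by
    rw [hτ, ← Real.rpow_natCast, ← Real.rpow_mul hn0.le, hk1, div_mul_cancel₀ _ (by linarith),
      Real.rpow_neg_one, inv_mul_cancel₀ hn0.ne']
  have hτn : 1 ≤ τ * n := by
    rw [← hτk]
    gcongr
    exact pow_le_of_le_one hτ0.le hτ1 (by omega)
  have hnN : N₀ ≤ n := by
    have : (N₀ : ℝ) ≤ n := by
      have : C * (τ * n) ≤ 1 * n := by
        rw [← mul_assoc]
        gcongr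
        linarith
      nlinarith
    exact_mod_cast this
  have hnp : C * (τ * n) ≤ n * p := by
    rw [← mul_assoc, mul_comm (n : ℝ)]
    gcongr
  obtain ⟨f, hf⟩ := H n hnN τ ⌈τ * n⌉₊ hτ0 hτ1 hτk.ge (Nat.le_ceil _)
  have hq : (⌈τ * n⌉₊ : ℝ) ≤ 2 * (τ * n) := by
    linarith [Nat.ceil_lt_add_one (by positivity : 0 ≤ τ * n)]
  have hbad := RandomSet.sum_weight_not_isSz_le hα hl1 hp hp1 hf
  have h1 : l ^ (M * ⌈τ * n⌉₊) ≤ Real.exp (α / 32 * (n * p)) := by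
    rw [← Real.exp_log (by linarith : 0 < l), ← Real.exp_nat_mul]
    refine Real.exp_le_exp.2 ?_
    push_cast
    calc M * ⌈τ * n⌉₊ * Real.log l ≤ M * (2 * (τ * n)) * Real.log l := by gcongr
      _ = 64 * M * Real.log l * (τ * n) / 32 := by ring
      _ ≤ α * C * (τ * n) / 32 := by gcongr
      _ = α / 32 * (C * (τ * n)) := by ring
      _ ≤ _ := by gcongr
  have h2 : 2 * p / l * n = α / 32 * (n * p) := by rw [hl]; field_simp; ring
  have h3 : l ^ (M * ⌈τ * n⌉₊) * Real.exp (2 * p / l * n) *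
      Real.exp (-(3 * α / 32 * (n * p))) ≤ Real.exp (-(α / 32 * (n * p))) := by
    calc _ ≤ Real.exp (α / 32 * (n * p)) * Real.exp (2 * p / l * n) *
          Real.exp (-(3 * α / 32 * (n * p))) := by gcongr
      _ = _ := by
        rw [h2, ← Real.exp_add, ← Real.exp_add]
        ring_nf
  have hnp0 : 0 ≤ n * p := by positivity
  have h4 : Real.exp (-(n * p / 4)) ≤ Real.exp (-(α / 32 * (n * p))) :=
    Real.exp_le_exp.2 (by nlinarith)
  have h5 : 2 ≤ Real.exp (α / 64 * n * p) := by
    have : C ≤ n * p := hnp.trans' (le_mul_of_one_le_right hC0.le hτn)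
    have : 64 ≤ α * (n * p) := hC2.trans (by gcongr)
    linarith [Real.add_one_le_exp (α / 64 * n * p)]
  have h6 : 2 * Real.exp (-(α / 32 * (n * p))) ≤ Real.exp (-(α / 64 * n * p)) := by
    calc _ ≤ Real.exp (α / 64 * n * p) * Real.exp (-(α / 32 * (n * p))) := by gcongr
      _ = _ := by
        rw [← Real.exp_add]
        ring_nf
  linarith
end

section
/- For every integer k ≥ 3 and every δ > 0, there exists ε > 0 such that for all sufficiently large n, every A ⊆ {1,...,n} with |A| ≥ δn contains at least ε n² k-APs; that is, the number of pairs (a,d) with d ≥ 1 and {a, a+d, ..., a+(k-1)d} ⊆ A is at least ε n². -/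
namespace DensityHalesJewett

open Finset BigOperators Combinatorics

section Average

variable {X Y Z : Type*} [Finite X] [Finite Y] [Finite Z]

/-- The average of a real function over a finite type. -/
noncomputable def avg (f : X → ℝ) : ℝ :=
  letI := Fintype.ofFinite X
  𝔼 x, f x

lemma avg_eq_expect {X : Type*} [Fintype X] (f : X → ℝ) : avg f = 𝔼 x, f x := by
  unfold avg
  congr 1
  exact congrArg (fun i : Fintype X => @Finset.univ X i) (Subsingleton.elim _ _)

lemma avg_add (f g : X → ℝ) : avg (fun x => f x + g x) = avg f + avg g :=
  expect_add_distrib _ _ _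

lemma avg_sub (f g : X → ℝ) : avg (fun x => f x - g x) = avg f - avg g :=
  expect_sub_distrib _ _ _

lemma avg_const_mul (c : ℝ) (f : X → ℝ) : avg (fun x => c * f x) = c * avg f :=
  (mul_expect _ _ _).symm

lemma avg_sum {κ : Type*} (s : Finset κ) (f : κ → X → ℝ) :
    avg (fun x => ∑ i ∈ s, f i x) = ∑ i ∈ s, avg (f i) :=
  expect_sum_comm _ _ _

lemma avg_const [Nonempty X] (c : ℝ) : avg (fun _ : X => c) = c := by
  have := Fintype.ofFinite X
  rw [avg_eq_expect, Fintype.expect_const]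

lemma avg_mono {f g : X → ℝ} (h : ∀ x, f x ≤ g x) : avg f ≤ avg g :=
  expect_le_expect fun x _ => h x

lemma avg_nonneg {f : X → ℝ} (h : ∀ x, 0 ≤ f x) : 0 ≤ avg f :=
  expect_nonneg fun x _ => h x

lemma avg_le [Nonempty X] {f : X → ℝ} {c : ℝ} (h : ∀ x, f x ≤ c) : avg f ≤ c :=
  (avg_mono h).trans_eq (avg_const c)

lemma exists_le_of_le_avg [Nonempty X] {f : X → ℝ} {c : ℝ} (h : c ≤ avg f) : ∃ x, c ≤ f x := by
  by_contra! hf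
  have := Fintype.ofFinite X
  rw [avg_eq_expect] at h
  obtain ⟨x, -, hx⟩ := Finset.exists_le_of_le_expect univ_nonempty h
  exact absurd hx (hf x).not_ge

lemma avg_equiv (e : X ≃ Y) (f : Y → ℝ) : avg (fun x => f (e x)) = avg f := by
  have := Fintype.ofFinite X
  have := Fintype.ofFinite Y
  simp only [avg_eq_expect]
  exact Fintype.expect_equiv e _ _ fun _ => rfl

lemma avg_prod (f : X × Y → ℝ) : avg f = avg fun x => avg fun y => f (x, y) := by
  have := Fintype.ofFinite X
  have := Fintype.ofFinite Y
  simp only [avg_eq_expect]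
  exact expect_product _ _ _

lemma avg_comm (f : X → Y → ℝ) :
    (avg fun x => avg fun y => f x y) = avg fun y => avg fun x => f x y :=
  expect_comm _ _ _

/-- If no value exceeds the average by more than `ε`, then no value is far below the average. -/
lemma le_of_avg_of_forall_le {f : X → ℝ} {a ε : ℝ} (hε : 0 ≤ ε) (ha : a ≤ avg f)
    (h : ∀ x, f x ≤ a + ε) (x : X) : a - Nat.card X * ε ≤ f x := by
  classical
  have := Fintype.ofFinite X
  have : Nonempty X := ⟨x⟩
  have hc : (0 : ℝ) < Fintype.card X := by exact_mod_cast Fintype.card_pos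
  rw [avg_eq_expect, Fintype.expect_eq_sum_div_card, le_div_iff₀ hc,
    ← Finset.add_sum_erase _ _ (mem_univ x)] at ha
  have h1 : ∑ y ∈ univ.erase x, f y ≤ ∑ _y ∈ univ.erase x, (a + ε) := sum_le_sum fun y _ => h y
  rw [sum_const, card_erase_of_mem (mem_univ x), nsmul_eq_mul, card_univ,
    Nat.cast_sub Fintype.card_pos] at h1
  rw [Nat.card_eq_fintype_card]
  push_cast at h1
  nlinarith

/-- The uniform density of a subset of a finite type. -/
noncomputable def dens (A : Set X) : ℝ := avg (A.indicator 1)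

lemma indicator_one_nonneg {X : Type*} (A : Set X) (x : X) : (0 : ℝ) ≤ A.indicator 1 x :=
  Set.indicator_nonneg (fun _ _ => zero_le_one) x

lemma indicator_one_le {X : Type*} (A : Set X) (x : X) : A.indicator 1 x ≤ (1 : ℝ) :=
  Set.indicator_le_self' (fun _ _ => zero_le_one) x

lemma dens_nonneg (A : Set X) : 0 ≤ dens A := avg_nonneg (indicator_one_nonneg A)

lemma dens_le_one [Nonempty X] (A : Set X) : dens A ≤ 1 := avg_le (indicator_one_le A)

lemma nonempty_of_dens_pos {A : Set X} (h : 0 < dens A) : A.Nonempty := by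
  rw [Set.nonempty_iff_ne_empty]
  rintro rfl
  simp [dens, avg] at h

lemma inv_card_le_dens {A : Set X} (hA : A.Nonempty) : (Nat.card X : ℝ)⁻¹ ≤ dens A := by
  classical
  obtain ⟨x, hx⟩ := hA
  have := Fintype.ofFinite X
  rw [dens, avg_eq_expect, Fintype.expect_eq_sum_div_card, Nat.card_eq_fintype_card, ← one_div]
  gcongr
  calc (1 : ℝ) = A.indicator 1 x := by simp [hx]
    _ ≤ _ := single_le_sum (fun y _ => indicator_one_nonneg A y) (mem_univ x)

end Average

section Functions

variable {ι κ α : Type*} [Finite ι] [Finite κ] [Finite α]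

lemma avg_sum_elim (f : (ι ⊕ κ → α) → ℝ) :
    avg f = avg fun y : κ → α => avg fun z : ι → α => f (Sum.elim z y) := by
  rw [avg_comm, ← avg_prod (fun p : (ι → α) × (κ → α) => f (Sum.elim p.1 p.2)),
    ← avg_equiv (Equiv.sumArrowEquivProdArrow ι κ α).symm]
  rfl

lemma avg_update [DecidableEq ι] (j : ι) (f : (ι → α) → ℝ) :
    avg f = avg fun t : ι → α => avg fun u : α => f (Function.update t j u) := by
  have key (g : (ι → α) → ℝ) :
      avg g = avg fun v : α => avg fun w : {i // i ≠ j} → α =>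
        g ((Equiv.funSplitAt j α).symm (v, w)) := by
    rw [← avg_prod (fun p => g ((Equiv.funSplitAt j α).symm p)), avg_equiv]
  rcases isEmpty_or_nonempty α with hα | hα
  · have : IsEmpty (ι → α) := ⟨fun t => hα.elim (t j)⟩
    have := Fintype.ofFinite (ι → α)
    simp only [avg_eq_expect, univ_eq_empty, expect_empty]
  · rw [key, key (fun t => avg fun u : α => f (Function.update t j u))]
    have h (v : α) (w : {i // i ≠ j} → α) (u : α) :
        Function.update ((Equiv.funSplitAt j α).symm (v, w)) j u
          = (Equiv.funSplitAt j α).symm (u, w) := by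
      ext i
      by_cases hi : i = j
      · subst hi; simp
      · simp [hi]
    simp only [h]
    rw [avg_const, avg_comm]

end Functions

section Subspaces

variable {ι κ η ζ α : Type*}

/-- The composition of two combinatorial subspaces. -/
def subspaceComp (V : Subspace η α ι) (U : Subspace ζ α η) : Subspace ζ α ι where
  idxFun i := (V.idxFun i).elim Sum.inl U.idxFun
  proper e := by
    obtain ⟨j, hj⟩ := U.proper e
    obtain ⟨i, hi⟩ := V.proper j
    exact ⟨i, by simp [hi, hj]⟩

lemma subspaceComp_apply (V : Subspace η α ι) (U : Subspace ζ α η) (x : ζ → α) :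
    subspaceComp V U x = V (U x) := by
  ext i
  cases h : V.idxFun i <;> simp [subspaceComp, Subspace.coe_apply, h]

/-- The image of a combinatorial line in a combinatorial subspace. -/
def subspaceLine (V : Subspace η α ι) (l : Line α η) : Line α ι where
  idxFun i := (V.idxFun i).elim some l.idxFun
  proper := by
    obtain ⟨j, hj⟩ := l.proper
    obtain ⟨i, hi⟩ := V.proper j
    exact ⟨i, by simp [hi, hj]⟩

lemma subspaceLine_apply (V : Subspace η α ι) (l : Line α η) (a : α) :
    subspaceLine V l a = V (l a) := by
  ext i
  cases h : V.idxFun i <;> simp [subspaceLine, Subspace.coe_apply, h]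

/-- A subspace of a cube, extended by fixed coordinates on the left. -/
def subspaceVertical (z : ι → α) (V : Subspace η α κ) : Subspace η α (ι ⊕ κ) where
  idxFun := Sum.elim (fun i => Sum.inl (z i)) V.idxFun
  proper e := by
    obtain ⟨i, hi⟩ := V.proper e
    exact ⟨Sum.inr i, hi⟩

lemma subspaceVertical_apply (z : ι → α) (V : Subspace η α κ) (x : η → α) :
    subspaceVertical z V x = Sum.elim z (V x) := by
  ext (i | i) <;> simp [subspaceVertical, Subspace.coe_apply]

/-- A subspace of a cube, extended by fixed coordinates on the right. -/
def subspaceHorizontal (V : Subspace η α ι) (y : κ → α) : Subspace η α (ι ⊕ κ) where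
  idxFun := Sum.elim V.idxFun (fun i => Sum.inl (y i))
  proper e := by
    obtain ⟨i, hi⟩ := V.proper e
    exact ⟨Sum.inl i, hi⟩

lemma subspaceHorizontal_apply (V : Subspace η α ι) (y : κ → α) (x : η → α) :
    subspaceHorizontal V y x = Sum.elim (V x) y := by
  ext (i | i) <;> simp [subspaceHorizontal, Subspace.coe_apply]

/-- The product of a line and a subspace. -/
def lineProdSubspace (l : Line α ι) (V : Subspace η α κ) : Subspace (Option η) α (ι ⊕ κ) where
  idxFun := Sum.elim (fun i => (l.idxFun i).elim (Sum.inr none) Sum.inl)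
    (fun k => (V.idxFun k).map id some)
  proper
    | none => by
      obtain ⟨i, hi⟩ := l.proper
      exact ⟨Sum.inl i, by simp [hi]⟩
    | some e => by
      obtain ⟨i, hi⟩ := V.proper e
      exact ⟨Sum.inr i, by simp [hi]⟩

lemma lineProdSubspace_apply (l : Line α ι) (V : Subspace η α κ) (x : Option η → α) :
    lineProdSubspace l V x = Sum.elim (l (x none)) (V (x ∘ some)) := by
  ext (i | i)
  · cases h : l.idxFun i <;> simp [lineProdSubspace, Subspace.coe_apply, h]
  · cases h : V.idxFun i <;> simp [lineProdSubspace, Subspace.coe_apply, h]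

/-- A subspace over the alphabet `α`, as a subspace over the alphabet `Option α`. -/
def subspaceOption (V : Subspace η α ι) : Subspace η (Option α) ι where
  idxFun i := (V.idxFun i).map some id
  proper e := by
    obtain ⟨i, hi⟩ := V.proper e
    exact ⟨i, by simp [hi]⟩

lemma subspaceOption_apply (V : Subspace η α ι) (x : η → Option α) (i : ι) :
    subspaceOption V x i = (V.idxFun i).elim some x := by
  cases h : V.idxFun i <;> simp [subspaceOption, Subspace.coe_apply, h]

instance [Finite α] [Finite ι] : Finite (Line α ι) :=
  Finite.of_injective Line.idxFun fun _ _ h => Line.ext h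

end Subspaces

section Fibers

variable {ι κ α X Y : Type*} [Finite ι] [Finite κ] [Finite α] [Finite X] [Finite Y]

lemma avg_dens_comm (P : X → Y → Prop) :
    (avg fun x => dens {y | P x y}) = avg fun y => dens {x | P x y} :=
  avg_comm _

lemma dens_eq_avg_right (A : Set (ι ⊕ κ → α)) :
    dens A = avg fun y : κ → α => dens {z : ι → α | Sum.elim z y ∈ A} :=
  avg_sum_elim _

lemma dens_eq_avg_left (A : Set (ι ⊕ κ → α)) :
    dens A = avg fun z : ι → α => dens {y : κ → α | Sum.elim z y ∈ A} := by
  rw [avg_dens_comm, dens_eq_avg_right]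

end Fibers

/-- The density Hales-Jewett property of an alphabet `α`. -/
def DHJ (α : Type) [Finite α] : Prop :=
  ∀ δ : ℝ, 0 < δ → ∃ ι : Type, ∃ _ : Finite ι, ∀ A : Set (ι → α), δ ≤ dens A →
    ∃ l : Line α ι, ∀ a, l a ∈ A

section Insensitivity

variable {α : Type}

/-- A set of words is insensitive with respect to `a` if membership does not change when letters
`none` and `some a` are exchanged. -/
def Insensitive {ι : Type} (a : α) (D : Set (ι → Option α)) : Prop :=
  ∀ z z' : ι → Option α, (∀ i, (z i).getD a = (z' i).getD a) → (z ∈ D ↔ z' ∈ D)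

lemma Insensitive.comp_subspace {ι η : Type} {a : α} {D : Set (ι → Option α)}
    (hD : Insensitive a D) (V : Subspace η (Option α) ι) : Insensitive a {x | V x ∈ D} := by
  intro z z' h
  refine hD _ _ fun i => ?_
  cases hi : V.idxFun i with
  | inl b => simp [Subspace.coe_apply, hi]
  | inr e => simpa [Subspace.coe_apply, hi] using h e

end Insensitivity

section Multidimensional

variable {α : Type} [Finite α]

lemma avg_dens_le_sum_lines {ι : Type} [Finite ι] [Fintype (Line α ι)] {Y : Type*} [Finite Y]
    [Nonempty Y] {δ : ℝ} (hδ : 0 ≤ δ) [Nonempty α]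
    (h : ∀ A : Set (ι → α), δ ≤ dens A → ∃ l : Line α ι, ∀ a, l a ∈ A) (S : Y → Set (ι → α)) :
    (avg fun y => dens (S y)) ≤ δ + ∑ l : Line α ι, dens {y | ∀ a, l a ∈ S y} := by
  simp only [dens]
  rw [← avg_sum, ← avg_const (X := Y) δ, ← avg_add]
  refine avg_mono fun y => ?_
  have h0 (l : Line α ι) : (0 : ℝ) ≤ {y | ∀ a, l a ∈ S y}.indicator 1 y := indicator_one_nonneg _ _
  rcases lt_or_ge (dens (S y)) δ with hy | hy
  · exact hy.le.trans (le_add_of_nonneg_right (sum_nonneg fun l _ => h0 l))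
  · obtain ⟨l, hl⟩ := h _ hy
    have h1 : (1 : ℝ) ≤ ∑ l : Line α ι, {y | ∀ a, l a ∈ S y}.indicator 1 y := by
      refine le_trans ?_ (single_le_sum (fun l _ => h0 l) (mem_univ l))
      rw [Set.indicator_of_mem (show y ∈ {y | ∀ a, l a ∈ S y} from hl)]
      rfl
    exact (dens_le_one _).trans (h1.trans (le_add_of_nonneg_left hδ))

/-- If dense sets contain lines, then in a family of sets that are dense on average
some line is contained in a positive proportion of the sets. -/
lemma exists_popular_line [Nonempty α] {ι : Type} [Finite ι] {Y : Type*} [Finite Y]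
    [Nonempty Y] {δ : ℝ} (hδ : 0 < δ)
    (h : ∀ A : Set (ι → α), δ ≤ dens A → ∃ l : Line α ι, ∀ a, l a ∈ A) (S : Y → Set (ι → α))
    (hS : 2 * δ ≤ avg fun y => dens (S y)) :
    ∃ l : Line α ι, δ / (Nat.card (Line α ι) + 1) ≤ dens {y | ∀ a, l a ∈ S y} := by
  have := Fintype.ofFinite (Line α ι)
  by_contra! hl
  have h1 := avg_dens_le_sum_lines hδ.le h S
  have h2 := sum_le_sum fun (l : Line α ι) (_ : l ∈ univ) => (hl l).le
  rw [sum_const, nsmul_eq_mul, card_univ, Nat.card_eq_fintype_card] at h2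
  have h3 : (Fintype.card (Line α ι) : ℝ) * (δ / (Fintype.card (Line α ι) + 1)) < δ := by
    rw [mul_div_assoc', div_lt_iff₀ (by positivity)]
    nlinarith
  linarith

/-- The multidimensional density Hales-Jewett theorem, from the one-dimensional one. -/
lemma DHJ.exists_subspace [Nonempty α] (h : DHJ α) (η : Type) [Finite η] :
    ∀ δ : ℝ, 0 < δ → ∃ ι : Type, ∃ _ : Finite ι, ∀ A : Set (ι → α), δ ≤ dens A →
      ∃ V : Subspace η α ι, ∀ x, V x ∈ A := by
  induction η using Finite.induction_empty_option with
  | of_equiv e ih =>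
    intro δ hδ
    obtain ⟨ι, hι, hA⟩ := ih δ hδ
    refine ⟨ι, hι, fun A hδA => ?_⟩
    obtain ⟨V, hV⟩ := hA A hδA
    refine ⟨V.reindex e (Equiv.refl _) (Equiv.refl _), fun x => ?_⟩
    convert hV (x ∘ e) using 1
    ext i
    simp
  | h_empty =>
    intro δ hδ
    refine ⟨Empty, inferInstance, fun A hδA => ?_⟩
    obtain ⟨y, hy⟩ := nonempty_of_dens_pos (hδ.trans_le hδA)
    refine ⟨⟨fun i => Sum.inl (y i), fun e => e.elim⟩, fun x => ?_⟩
    convert hy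
  | h_option ih =>
    intro δ hδ
    obtain ⟨M, hM, hl⟩ := h (δ / 2) (half_pos hδ)
    obtain ⟨κ, hκ, hV⟩ := ih (δ / 2 / (Nat.card (Line α M) + 1)) (by positivity)
    refine ⟨M ⊕ κ, inferInstance, fun A hδA => ?_⟩
    rw [dens_eq_avg_right] at hδA
    obtain ⟨l, hlA⟩ := exists_popular_line (half_pos hδ) hl
      (fun y : κ → α => {z : M → α | Sum.elim z y ∈ A}) (by linarith)
    obtain ⟨V, hVA⟩ := hV _ hlA
    refine ⟨lineProdSubspace l V, fun x => ?_⟩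
    rw [lineProdSubspace_apply]
    exact hVA (x ∘ some) (x none)

/-- A dense set over the alphabet `Option α` is dense in a copy of a cube over `α`. -/
lemma exists_subspace_dens_restrict [Nonempty α] {δ : ℝ} (hδ : 0 < δ) (K : Type) [Finite K] :
    ∃ ι : Type, ∃ _ : Finite ι, ∀ A : Set (ι → Option α), δ ≤ dens A →
      ∃ V : Subspace K (Option α) ι, δ / 2 ≤ dens {x : K → α | V (some ∘ x) ∈ A} := by
  have hc : (0 : ℝ) < Nat.card (K → Option α) := by exact_mod_cast Nat.card_pos
  set ε : ℝ := δ / (2 * Nat.card (K → Option α)) with hε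
  have hε0 : 0 < ε := by positivity
  have hεc : Nat.card (K → Option α) * ε = δ / 2 := by rw [hε]; field_simp
  have claim : ∀ r : ℕ, ∃ ι : Type, ∃ _ : Finite ι, ∀ A : Set (ι → Option α), δ ≤ dens A →
      1 - r * ε < dens A →
      ∃ V : Subspace K (Option α) ι, δ / 2 ≤ dens {x : K → α | V (some ∘ x) ∈ A} := by
    intro r
    induction r with
    | zero =>
      refine ⟨Empty, inferInstance, fun A _ hA => ?_⟩
      have := dens_le_one A
      norm_num at hA
      linarith
    | succ r ih =>
      obtain ⟨κ, hκ, hV⟩ := ih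
      refine ⟨K ⊕ κ, inferInstance, fun A hδA hA => ?_⟩
      push_cast at hA
      by_cases hz : ∀ z : K → Option α, dens {y | Sum.elim z y ∈ A} ≤ dens A + ε
      · have hlow := le_of_avg_of_forall_le hε0.le (dens_eq_avg_left A).le hz
        rw [hεc] at hlow
        have havg : δ / 2 ≤ avg fun y : κ → Option α =>
            dens {x : K → α | Sum.elim (some ∘ x) y ∈ A} := by
          rw [← avg_dens_comm, ← avg_const (X := K → α) (δ / 2)]
          exact avg_mono fun x => by linarith [hlow (some ∘ x)]
        obtain ⟨y, hy⟩ := exists_le_of_le_avg havg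
        refine ⟨subspaceHorizontal default y, ?_⟩
        simp only [subspaceHorizontal_apply]
        exact hy
      · push Not at hz
        obtain ⟨z, hz⟩ := hz
        obtain ⟨V, hVA⟩ := hV _ (by linarith) (by linarith)
        refine ⟨subspaceVertical z V, ?_⟩
        simp only [subspaceVertical_apply]
        exact hVA
  obtain ⟨r, hr⟩ := exists_nat_gt (1 / ε)
  rw [div_lt_iff₀ hε0] at hr
  obtain ⟨ι, hι, hA⟩ := claim r
  exact ⟨ι, hι, fun A hδA => hA A hδA (by linarith)⟩

lemma DHJ.exists_subspace_of_insensitive [Nonempty α] (h : DHJ α) {β : ℝ} (hβ : 0 < β) (η : Type)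
    [Finite η] :
    ∃ ι : Type, ∃ _ : Finite ι, ∀ (a : α) (D : Set (ι → Option α)), Insensitive a D →
      β ≤ dens D → ∃ V : Subspace η (Option α) ι, ∀ x, V x ∈ D := by
  obtain ⟨K, hK, hU⟩ := h.exists_subspace η (β / 2) (half_pos hβ)
  obtain ⟨ι, hι, hV⟩ := exists_subspace_dens_restrict (α := α) hβ K
  refine ⟨ι, hι, fun a D hD hβD => ?_⟩
  obtain ⟨V, hVD⟩ := hV D hβD
  obtain ⟨U, hUD⟩ := hU _ hVD
  refine ⟨subspaceComp V (subspaceOption U), fun x => ?_⟩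
  rw [subspaceComp_apply]
  refine (hD.comp_subspace V _ (some ∘ U fun e => (x e).getD a) fun i => ?_).2 (hUD _)
  cases hi : U.idxFun i <;> simp [subspaceOption_apply, Subspace.apply_def U, hi]

end Multidimensional

section Tiling

lemma avg_indicator_range {X Y : Type*} [Finite X] [Finite Y] {g : X → Y}
    (hg : Function.Injective g) (f : Y → ℝ) :
    Nat.card Y * avg ((Set.range g).indicator f) = Nat.card X * avg fun x => f (g x) := by
  classical
  have := Fintype.ofFinite X
  have := Fintype.ofFinite Y
  simp only [avg_eq_expect, Nat.card_eq_fintype_card, Fintype.card_mul_expect]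
  have h := Finset.sum_indicator_subset f (subset_univ (univ.map ⟨g, hg⟩))
  rw [sum_map] at h
  simpa using h

lemma subspace_injective {η α ι : Type*} (V : Subspace η α ι) : Function.Injective V := by
  intro x x' h
  ext e
  obtain ⟨i, hi⟩ := V.proper e
  simpa [Subspace.coe_apply, hi] using congrFun h i

variable {α : Type} [Finite α] [Nonempty α]

/-- From every dense insensitive set one can remove a subspace in a canonical way. -/
lemma DHJ.exists_selection (h : DHJ α) {β : ℝ} (hβ : 0 < β) (η : Type) [Finite η] :
    ∃ ι : Type, ∃ _ : Finite ι, ∃ c : ℝ, 0 < c ∧ c ≤ 1 ∧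
      ∃ R : Set (ι → Option α) → Set (ι → Option α), (∀ E, R E ⊆ E) ∧
        (∀ a E, Insensitive a E → c * (dens E - β) ≤ dens (R E)) ∧
        ∀ E (f : (ι → Option α) → ℝ),
          (∀ V : Subspace η (Option α) ι, (avg fun x => f (V x)) ≤ 0) →
            avg ((R E).indicator f) ≤ 0 := by
  classical
  obtain ⟨ι, hι, hV⟩ := h.exists_subspace_of_insensitive hβ η
  have hcard : (1 : ℝ) ≤ Nat.card (ι → Option α) := by exact_mod_cast Nat.card_pos
  refine ⟨ι, hι, (Nat.card (ι → Option α) : ℝ)⁻¹, by positivity, inv_le_one_of_one_le₀ hcard,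
    fun E => if hE : ∃ V : Subspace η (Option α) ι, ∀ x, V x ∈ E then Set.range hE.choose else ∅,
    fun E => ?_, fun a E ha => ?_, fun E f hf => ?_⟩
  · dsimp only
    split_ifs with hE
    · rintro _ ⟨x, rfl⟩
      exact hE.choose_spec x
    · exact Set.empty_subset E
  · dsimp only
    split_ifs with hE
    · refine le_trans ?_ (inv_card_le_dens (Set.range_nonempty _))
      refine mul_le_of_le_one_right (by positivity) ?_
      linarith [dens_le_one E]
    · have hd : dens E < β := by
        by_contra! hd
        exact hE (hV a E ha hd)
      refine le_trans ?_ (dens_nonneg _)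
      exact mul_nonpos_of_nonneg_of_nonpos (by positivity) (by linarith)
  · dsimp only
    split_ifs with hE
    · have h1 := avg_indicator_range (subspace_injective hE.choose) f
      have h2 : (0 : ℝ) ≤ Nat.card (η → Option α) := by positivity
      have h3 := mul_nonpos_of_nonneg_of_nonpos h2 (hf hE.choose)
      rw [← h1] at h3
      by_contra! hlt
      have := mul_pos (zero_lt_one.trans_le hcard) hlt
      linarith
    · simp [avg]

/-- A bounded function with positive average on an insensitive set has positive average on a
subspace: an insensitive set can almost be partitioned into subspaces. -/
lemma DHJ.exists_subspace_avg_pos (h : DHJ α) {β : ℝ} (hβ : 0 < β) (η : Type) [Finite η] :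
    ∃ ι : Type, ∃ _ : Finite ι, ∀ (a : α) (D : Set (ι → Option α)) (f : (ι → Option α) → ℝ),
      Insensitive a D → (∀ x, f x ≤ 1) → β ≤ avg (D.indicator f) →
        ∃ V : Subspace η (Option α) ι, 0 < avg fun x => f (V x) := by
  obtain ⟨L, hL, c, hc0, hc1, R, hRsub, hRdens, hRavg⟩ := h.exists_selection (half_pos hβ) η
  have claim : ∀ r : ℕ, ∃ ι : Type, ∃ _ : Finite ι, ∀ (a : α) (D : Set (ι → Option α))
      (f : (ι → Option α) → ℝ), Insensitive a D → (∀ x, f x ≤ 1) →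
        (∀ V : Subspace η (Option α) ι, (avg fun x => f (V x)) ≤ 0) →
          avg (D.indicator f) ≤ β / 2 + (1 - c) ^ r * (dens D - β / 2) := by
    intro r
    induction r with
    | zero =>
      refine ⟨Empty, inferInstance, fun a D f _ hf _ => ?_⟩
      have : avg (D.indicator f) ≤ dens D :=
        avg_mono fun x => Set.indicator_le_indicator (hf x)
      simpa using this
    | succ r ih =>
      obtain ⟨κ, hκ, hD⟩ := ih
      refine ⟨L ⊕ κ, inferInstance, fun a D f ha hf hV => ?_⟩
      set E : (κ → Option α) → Set (L → Option α) := fun y => {z | Sum.elim z y ∈ D} with hE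
      have hEins (y) : Insensitive a (E y) := by
        intro z z' hz
        refine ha _ _ ?_
        rintro (i | i)
        · exact hz i
        · rfl
      have hEeq (y y' : κ → Option α) (hy : ∀ i, (y i).getD a = (y' i).getD a) : E y = E y' := by
        ext z
        refine ha _ _ ?_
        rintro (i | i)
        · rfl
        · exact hy i
      set D' : (L → Option α) → Set (κ → Option α) := fun z => {y | z ∈ E y \ R (E y)} with hD'
      have hD'ins (z) : Insensitive a (D' z) := by
        intro y y' hy
        simp only [hD', Set.mem_ofPred_eq, hEeq y y' hy]
      have hsplit (y z) : D.indicator f (Sum.elim z y)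
          = (D' z).indicator (fun y => f (Sum.elim z y)) y
            + (R (E y)).indicator (fun z => f (Sum.elim z y)) z := by
        by_cases h1 : z ∈ R (E y)
        · have h2 : Sum.elim z y ∈ D := hRsub _ h1
          have h3 : y ∉ D' z := fun h => h.2 h1
          simp [h1, h2, h3]
        · by_cases h2 : Sum.elim z y ∈ D
          · have h3 : y ∈ D' z := ⟨h2, h1⟩
            simp [h1, h2, h3]
          · have h3 : y ∉ D' z := fun h => h2 h.1
            simp [h1, h2, h3]
      have hdiff (y) : dens (E y \ R (E y)) ≤ dens (E y) - c * (dens (E y) - β / 2) := by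
        have h1 : dens (E y \ R (E y)) = dens (E y) - dens (R (E y)) := by
          rw [dens, dens, dens, ← avg_sub]
          congr 1
          rw [Set.indicator_sdiff (hRsub _)]
          rfl
        linarith [hRdens a (E y) (hEins y)]
      have hD'dens : (avg fun z => dens (D' z)) ≤ dens D - c * (dens D - β / 2) := by
        rw [show (avg fun z => dens (D' z)) = avg fun y => dens (E y \ R (E y)) from
          avg_dens_comm fun z y => z ∈ E y \ R (E y)]
        refine (avg_mono hdiff).trans_eq ?_
        rw [avg_sub, avg_const_mul, avg_sub, avg_const, dens_eq_avg_right D]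
      have hfirst : (avg fun z => avg ((D' z).indicator fun y => f (Sum.elim z y)))
          ≤ β / 2 + (1 - c) ^ r * ((avg fun z => dens (D' z)) - β / 2) := by
        refine (avg_mono fun z => hD a (D' z) (fun y => f (Sum.elim z y)) (hD'ins z)
          (fun y => hf _) fun V => ?_).trans_eq ?_
        · have := hV (subspaceVertical z V)
          simpa only [subspaceVertical_apply] using this
        · rw [avg_add, avg_const_mul, avg_sub, avg_const]
      have hsecond : (avg fun y => avg ((R (E y)).indicator fun z => f (Sum.elim z y))) ≤ 0 := by
        refine avg_le fun y => hRavg _ _ fun V => ?_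
        have := hV (subspaceHorizontal V y)
        simpa only [subspaceHorizontal_apply] using this
      have hpow : (0 : ℝ) ≤ (1 - c) ^ r := pow_nonneg (by linarith) r
      have hmul := mul_le_mul_of_nonneg_left hD'dens hpow
      rw [avg_sum_elim]
      simp only [hsplit]
      simp only [avg_add]
      rw [avg_comm (fun y z => (D' z).indicator (fun y => f (Sum.elim z y)) y)]
      have hpows : (1 - c) ^ (r + 1) * (dens D - β / 2)
          = (1 - c) ^ r * (dens D - c * (dens D - β / 2)) - (1 - c) ^ r * (β / 2) := by ring
      linarith
  obtain ⟨r, hr⟩ := exists_pow_lt_of_lt_one (half_pos hβ) (show 1 - c < 1 by linarith)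
  obtain ⟨ι, hι, hD⟩ := claim r
  refine ⟨ι, hι, fun a D f ha hf hβD => ?_⟩
  by_contra! hV
  have h1 := hD a D f ha hf hV
  have h2 : (1 - c) ^ r * (dens D - β / 2) ≤ (1 - c) ^ r :=
    mul_le_of_le_one_right (pow_nonneg (by linarith) r) (by linarith [dens_le_one D])
  linarith

lemma DHJ.exists_subspace_avg_pos_inter (h : DHJ α) (s : Finset α) :
    ∀ β : ℝ, 0 < β → ∀ (η : Type) [Finite η], ∃ ι : Type, ∃ _ : Finite ι,
      ∀ D : α → Set (ι → Option α), (∀ a ∈ s, Insensitive a (D a)) →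
        ∀ f : (ι → Option α) → ℝ, (∀ x, f x ≤ 1) → β ≤ avg ((⋂ a ∈ s, D a).indicator f) →
          ∃ V : Subspace η (Option α) ι, 0 < avg fun x => f (V x) := by
  classical
  induction s using Finset.induction_on with
  | empty =>
    intro β hβ η hη
    refine ⟨η, hη, fun D _ f _ hfD => ⟨default, ?_⟩⟩
    simp only [notMem_empty, Set.iInter_of_empty, Set.iInter_univ, Set.indicator_univ] at hfD
    exact hβ.trans_le hfD
  | insert a s has ih =>
    intro β hβ η hη
    obtain ⟨κ, hκ, hs⟩ := ih (β / 2) (half_pos hβ) η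
    obtain ⟨ι, hι, ha⟩ := h.exists_subspace_avg_pos (half_pos hβ) κ
    refine ⟨ι, hι, fun D hD f hf hfD => ?_⟩
    set S : Set (ι → Option α) := ⋂ b ∈ s, D b with hS
    have hSf (x) : S.indicator f x ≤ 1 := Set.indicator_le' (fun x _ => hf x) (by simp) x
    obtain ⟨V, hV⟩ := ha a (D a) (fun x => S.indicator f x - β / 2) (hD a (mem_insert_self a s))
      (fun x => by linarith [hSf x]) (by
        rw [set_biInter_insert, ← hS] at hfD
        have : avg ((D a ∩ S).indicator f) - β / 2
            ≤ avg ((D a).indicator fun x => S.indicator f x - β / 2) := by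
          rw [← avg_const (X := ι → Option α) (β / 2), ← avg_sub]
          refine avg_mono fun x => ?_
          by_cases hx : x ∈ D a
          · by_cases hxS : x ∈ S <;> simp [hx, hxS, avg_const]
          · simpa [hx, avg_const] using (half_pos hβ).le
        linarith)
    rw [avg_sub, avg_const] at hV
    obtain ⟨U, hU⟩ := hs (fun b => {x | V x ∈ D b})
      (fun b hb => (hD b (mem_insert_of_mem hb)).comp_subspace V) (fun x => f (V x))
      (fun x => hf _) (by
        have : (⋂ b ∈ s, {x | V x ∈ D b}) = {x | V x ∈ S} := by
          ext x; simp [hS]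
        rw [this]
        have h2 : β / 2 ≤ avg fun x => S.indicator f (V x) := by linarith
        exact h2)
    exact ⟨subspaceComp V U, by simpa only [subspaceComp_apply] using hU⟩

end Tiling

section Increment

variable {α : Type}

/-- Fill the unspecified letters of each block of `t` with the letter of `x` for that block; the
letters of `x` themselves are kept in front. -/
def fillBlocks {M Q : Type} (x : M → Option α) (t : M → Q → Option α) : M ⊕ M × Q → Option α :=
  Sum.elim x fun p => (t p.1 p.2).elim (x p.1) some

/-- The line over `Option α` obtained from a line over `α` by filling blocks. -/
def fillLine {M Q κ : Type} (l : Line α M) (t : M → Q → Option α) (y : κ → Option α) :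
    Line (Option α) ((M ⊕ M × Q) ⊕ κ) where
  idxFun := Sum.elim
    (Sum.elim (fun j => (l.idxFun j).map some)
      fun p => (t p.1 p.2).elim ((l.idxFun p.1).map some) fun a => some (some a))
    fun k => some (y k)
  proper := by
    obtain ⟨j, hj⟩ := l.proper
    exact ⟨Sum.inl (Sum.inl j), by simp [hj]⟩

lemma fillLine_none {M Q κ : Type} (l : Line α M) (t : M → Q → Option α) (y : κ → Option α) :
    fillLine l t y none = Sum.elim (fillBlocks l.idxFun t) y := by
  ext1 i
  rcases i with (j | ⟨j, q⟩) | k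
  · cases h : l.idxFun j <;> simp [fillLine, fillBlocks, h]
  · cases h : l.idxFun j <;> cases h' : t j q <;> simp [fillLine, fillBlocks, h, h']
  · simp [fillLine]

lemma fillLine_some {M Q κ : Type} (l : Line α M) (t : M → Q → Option α) (y : κ → Option α)
    (a : α) : fillLine l t y (some a) = Sum.elim (fillBlocks (some ∘ l a) t) y := by
  ext1 i
  rcases i with (j | ⟨j, q⟩) | k
  · cases h : l.idxFun j <;> simp [fillLine, fillBlocks, h]
  · cases h : l.idxFun j <;> cases h' : t j q <;> simp [fillLine, fillBlocks, h, h']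
  · simp [fillLine]

/-- The subspace in which only one block varies. -/
def blockSubspace {M Q κ : Type} [DecidableEq M] (x : M → Option α) (t : M → Q → Option α)
    (y : κ → Option α) (j₀ : M) : Subspace Q (Option α) ((M ⊕ M × Q) ⊕ κ) where
  idxFun := Sum.elim
    (Sum.elim (fun j => Sum.inl (x j))
      fun p => if p.1 = j₀ then Sum.inr p.2 else Sum.inl ((t p.1 p.2).elim (x p.1) some))
    fun k => Sum.inl (y k)
  proper q := ⟨Sum.inl (Sum.inr (j₀, q)), by simp⟩

lemma blockSubspace_apply {M Q κ : Type} [DecidableEq M] {x : M → Option α}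
    (t : M → Q → Option α) (y : κ → Option α) {j₀ : M} (hj₀ : x j₀ = none) (u : Q → Option α) :
    blockSubspace x t y j₀ u = Sum.elim (fillBlocks x (Function.update t j₀ u)) y := by
  ext1 i
  rcases i with (j | ⟨j, q⟩) | k
  · simp [blockSubspace, fillBlocks, Subspace.coe_apply]
  · by_cases h : j = j₀
    · subst h
      cases h' : u q <;> simp [blockSubspace, fillBlocks, Subspace.coe_apply, hj₀, h']
    · simp [blockSubspace, fillBlocks, Subspace.coe_apply, h]
  · simp [blockSubspace, Subspace.coe_apply]

lemma insensitive_fillBlocks {M Q κ : Type} [DecidableEq M] (A : Set ((M ⊕ M × Q) ⊕ κ → Option α))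
    {l : Line α M} (t : M → Q → Option α) (y : κ → Option α) {j₀ : M} (hj₀ : l.idxFun j₀ = none)
    (a : α) :
    Insensitive a {u : Q → Option α |
      Sum.elim (fillBlocks (some ∘ l a) (Function.update t j₀ u)) y ∈ A} := by
  intro u u' h
  suffices fillBlocks (some ∘ l a) (Function.update t j₀ u)
      = fillBlocks (some ∘ l a) (Function.update t j₀ u') by
    simp only [Set.mem_ofPred_eq, this]
  ext1 i
  rcases i with j | ⟨j, q⟩
  · rfl
  · by_cases hj : j = j₀
    · subst hj
      have := h q
      cases h1 : u q <;> cases h2 : u' q <;> simp_all [fillBlocks]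
    · simp [fillBlocks, hj]

lemma Insensitive.compl {ι : Type} {a : α} {D : Set (ι → Option α)} (hD : Insensitive a D) :
    Insensitive a Dᶜ :=
  fun z z' h => not_congr (hD z z' h)

variable [Finite α] [Nonempty α]

lemma DHJ.density_increment (h : DHJ α) {δ₀ : ℝ} (hδ₀ : 0 < δ₀) :
    ∃ γ : ℝ, 0 < γ ∧ ∀ (m : Type) [Finite m], ∃ γ' : ℝ, 0 < γ' ∧ ∀ (κ : Type) [Finite κ],
      ∃ ι : Type, ∃ _ : Finite ι, ∀ A : Set (ι → Option α), δ₀ ≤ dens A →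
        (∃ l : Line (Option α) ι, ∀ b, l b ∈ A) ∨
        (∃ V : Subspace m (Option α) ι, dens A + γ ≤ dens {v | V v ∈ A}) ∨
        ∃ V : Subspace κ (Option α) ι, dens A + γ' ≤ dens {v | V v ∈ A} := by
  classical
  obtain ⟨M, hM, hline⟩ := h (δ₀ / 4) (by positivity)
  set θ : ℝ := δ₀ / 4 / (Nat.card (Line α M) + 1) with hθ
  have hθ0 : 0 < θ := by positivity
  have := Fintype.ofFinite (Set α)
  have hP : (1 : ℝ) ≤ Fintype.card (Set α) := by exact_mod_cast Fintype.card_pos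
  set P : ℝ := ((Fintype.card (Set α) : ℕ) : ℝ) with hPdef
  set γ : ℝ := δ₀ * θ / (4 * P) with hγ
  have hγ0 : 0 < γ := by positivity
  have hPγ : P * γ = δ₀ * θ / 4 := by rw [hγ]; field_simp
  set η : ℝ := min (δ₀ / 2) (δ₀ * θ / 4) with hη
  have hη0 : 0 < η := by positivity
  refine ⟨γ, hγ0, fun m hm => ?_⟩
  have := Fintype.ofFinite α
  obtain ⟨Q, hQ, htile⟩ := h.exists_subspace_avg_pos_inter univ γ hγ0 m
  have hZ : (0 : ℝ) < Nat.card (M ⊕ M × Q → Option α) := by exact_mod_cast Nat.card_pos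
  refine ⟨η / Nat.card (M ⊕ M × Q → Option α), by positivity, fun κ hκ =>
    ⟨(M ⊕ M × Q) ⊕ κ, inferInstance, fun A hA => ?_⟩⟩
  rw [or_iff_not_imp_left, or_iff_not_imp_right]
  intro hnoline hnoinc
  set δ : ℝ := dens A with hδ
  have hfiber (z : M ⊕ M × Q → Option α) : δ - η ≤ dens {y : κ → Option α | Sum.elim z y ∈ A} := by
    have := le_of_avg_of_forall_le (by positivity) (dens_eq_avg_left A).le
      (ε := η / Nat.card (M ⊕ M × Q → Option α)) (fun z => by
        by_contra! hz
        refine hnoinc ⟨subspaceVertical z default, ?_⟩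
        simp only [subspaceVertical_apply]
        exact hz.le) z
    rwa [mul_div_cancel₀ _ hZ.ne'] at this
  have hfill (x : M → Option α) : δ - η ≤
      dens {p : (M → Q → Option α) × (κ → Option α) | Sum.elim (fillBlocks x p.1) p.2 ∈ A} := by
    rw [dens, avg_prod, ← avg_const (X := M → Q → Option α) (δ - η)]
    exact avg_mono fun t => hfiber (fillBlocks x t)
  obtain ⟨l, hl⟩ := exists_popular_line (by positivity) hline
    (fun p : (M → Q → Option α) × (κ → Option α) =>
      {x : M → α | Sum.elim (fillBlocks (some ∘ x) p.1) p.2 ∈ A}) (by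
      rw [avg_dens_comm fun (p : (M → Q → Option α) × (κ → Option α)) (x : M → α) =>
        Sum.elim (fillBlocks (some ∘ x) p.1) p.2 ∈ A, ← avg_const (X := M → α) (2 * (δ₀ / 4))]
      refine avg_mono fun x => ?_
      have := hfill (some ∘ x)
      have := min_le_left (δ₀ / 2) (δ₀ * θ / 4)
      linarith)
  rw [← hθ] at hl
  obtain ⟨j₀, hj₀⟩ := l.proper
  set c : ℝ := δ + γ with hc
  have hc0 : 0 < c := by linarith
  set 𝒜 : Set ((M → Q → Option α) × (κ → Option α)) :=
    {p | Sum.elim (fillBlocks l.idxFun p.1) p.2 ∈ A} with h𝒜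
  set pat : (M → Q → Option α) × (κ → Option α) → Set α :=
    fun p => {a | Sum.elim (fillBlocks (some ∘ l a) p.1) p.2 ∈ A} with hpat
  set ℬ : Set ((M → Q → Option α) × (κ → Option α)) := {p | pat p = Set.univ} with hℬ
  have hdisj (p) (hp : p ∈ 𝒜) : p ∉ ℬ := by
    intro hpB
    refine hnoline ⟨fillLine l p.1 p.2, fun b => ?_⟩
    cases b with
    | none => rw [fillLine_none]; exact hp
    | some a => rw [fillLine_some]; exact Set.eq_univ_iff_forall.1 hpB a
  have hℬdens : θ ≤ dens ℬ := by
    convert hl using 2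
    ext p
    exact Set.eq_univ_iff_forall
  set F : Set α → (M → Q → Option α) × (κ → Option α) → ℝ :=
    fun S p => if pat p = S then 𝒜.indicator 1 p - c else 0 with hF
  have hFsum (p) : (𝒜.indicator 1 p - c) + c * ℬ.indicator 1 p
      ≤ ∑ S ∈ univ.erase Set.univ, F S p := by
    simp only [hF]
    rw [sum_ite_eq]
    by_cases hp : pat p = Set.univ
    · have h1 : p ∈ ℬ := hp
      have h2 : p ∉ 𝒜 := fun h => hdisj p h h1
      simp [hp, h1, h2]
    · have h1 : p ∉ ℬ := hp
      simp [hp, h1]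
  have hFavg : δ - η - c + c * θ ≤ ∑ S ∈ univ.erase Set.univ, avg (F S) := by
    rw [← avg_sum]
    refine le_trans ?_ (avg_mono hFsum)
    rw [avg_add, avg_sub, avg_const_mul, avg_const]
    have := hfill l.idxFun
    have := mul_le_mul_of_nonneg_left hℬdens hc0.le
    simp only [dens] at *
    linarith
  obtain ⟨S, -, hS⟩ : ∃ S ∈ univ.erase Set.univ, γ ≤ avg (F S) := by
    by_contra! hlt
    have h1 := sum_le_sum fun S hS => (hlt S hS).le
    have h2 : ((univ.erase (Set.univ : Set α)).card : ℝ) ≤ P := by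
      rw [hPdef]; exact_mod_cast card_le_univ _
    rw [sum_const, nsmul_eq_mul] at h1
    have h3 := mul_le_mul_of_nonneg_right h2 hγ0.le
    have h4 : η ≤ δ₀ * θ / 4 := min_le_right _ _
    have h5 : γ ≤ P * γ := le_mul_of_one_le_left hγ0.le hP
    have h6 : δ₀ * θ ≤ δ * θ := mul_le_mul_of_nonneg_right hA hθ0.le
    have h7 : 0 < γ * θ := by positivity
    have h8 : 0 < δ₀ * θ := by positivity
    rw [hc] at hFavg
    nlinarith
  rw [avg_prod, avg_comm] at hS
  obtain ⟨y, hy⟩ := exists_le_of_le_avg hS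
  rw [avg_update j₀] at hy
  obtain ⟨t, ht⟩ := exists_le_of_le_avg hy
  set D : α → Set (Q → Option α) := fun a =>
    if a ∈ S then {u | Sum.elim (fillBlocks (some ∘ l a) (Function.update t j₀ u)) y ∈ A}
    else {u | Sum.elim (fillBlocks (some ∘ l a) (Function.update t j₀ u)) y ∈ A}ᶜ with hD
  obtain ⟨V, hV⟩ := htile D (fun a _ => by
      simp only [hD]
      split_ifs
      · exact insensitive_fillBlocks A t y hj₀ a
      · exact (insensitive_fillBlocks A t y hj₀ a).compl)
    (fun u => A.indicator 1 (blockSubspace l.idxFun t y j₀ u) - c)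
    (fun u => by linarith [indicator_one_le A (blockSubspace l.idxFun t y j₀ u)]) (by
      refine ht.trans (avg_mono fun u => le_of_eq ?_)
      have h1 : u ∈ ⋂ a ∈ univ, D a ↔ pat (Function.update t j₀ u, y) = S := by
        simp only [mem_univ, Set.iInter_true, Set.mem_iInter, Set.ext_iff]
        refine forall_congr' fun a => ?_
        simp only [hD, hpat]
        split_ifs with ha <;> simp [ha]
      by_cases h2 : pat (Function.update t j₀ u, y) = S
      · rw [Set.indicator_of_mem (h1.2 h2)]
        simp only [hF, if_pos h2, blockSubspace_apply t y hj₀]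
        rfl
      · rw [Set.indicator_of_notMem (fun h => h2 (h1.1 h))]
        simp only [hF, if_neg h2])
  refine ⟨subspaceComp (blockSubspace l.idxFun t y j₀) V, ?_⟩
  rw [avg_sub, avg_const] at hV
  simp only [subspaceComp_apply]
  have h2 : dens {v | blockSubspace l.idxFun t y j₀ (V v) ∈ A}
    = avg fun v => A.indicator 1 (blockSubspace l.idxFun t y j₀ (V v)) := rfl
  rw [h2]
  linarith

/-- The density Hales-Jewett property passes to an alphabet with one more letter. -/
lemma DHJ.option (h : DHJ α) : DHJ (Option α) := by
  intro δ hδ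
  obtain ⟨γ, hγ0, hinc⟩ := h.density_increment hδ
  have claim : ∀ r : ℕ, ∃ ι : Type, ∃ _ : Finite ι, ∀ A : Set (ι → Option α), δ ≤ dens A →
      1 - r * γ < dens A → ∃ l : Line (Option α) ι, ∀ b, l b ∈ A := by
    intro r
    induction r with
    | zero =>
      refine ⟨Empty, inferInstance, fun A _ hA => ?_⟩
      have := dens_le_one A
      norm_num at hA
      linarith
    | succ r ih =>
      obtain ⟨m, hm, hmline⟩ := ih
      obtain ⟨γ', hγ'0, hκ⟩ := hinc m
      have claim' : ∀ s : ℕ, ∃ ι : Type, ∃ _ : Finite ι, ∀ A : Set (ι → Option α), δ ≤ dens A →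
          1 - (r + 1 : ℕ) * γ < dens A → 1 - s * γ' < dens A →
            ∃ l : Line (Option α) ι, ∀ b, l b ∈ A := by
        intro s
        induction s with
        | zero =>
          refine ⟨Empty, inferInstance, fun A _ _ hA => ?_⟩
          have := dens_le_one A
          norm_num at hA
          linarith
        | succ s ih =>
          obtain ⟨κ, hκf, hκline⟩ := ih
          obtain ⟨ι, hι, hA⟩ := hκ κ
          refine ⟨ι, hι, fun A h1 h2 h3 => ?_⟩
          push_cast at h2 h3
          rcases hA A h1 with hl | ⟨V, hV⟩ | ⟨V, hV⟩
          · exact hl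
          · obtain ⟨l, hl⟩ := hmline _ (by linarith) (by linarith)
            exact ⟨subspaceLine V l, fun b => by rw [subspaceLine_apply]; exact hl b⟩
          · obtain ⟨l, hl⟩ := hκline {v | V v ∈ A} (by linarith) (by push_cast; linarith)
              (by linarith)
            exact ⟨subspaceLine V l, fun b => by rw [subspaceLine_apply]; exact hl b⟩
      obtain ⟨s, hs⟩ := exists_nat_gt (1 / γ')
      rw [div_lt_iff₀ hγ'0] at hs
      obtain ⟨ι, hι, hA⟩ := claim' s
      exact ⟨ι, hι, fun A h1 h2 => hA A h1 h2 (by linarith)⟩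
  obtain ⟨r, hr⟩ := exists_nat_gt (1 / γ)
  rw [div_lt_iff₀ hγ0] at hr
  obtain ⟨ι, hι, hA⟩ := claim r
  exact ⟨ι, hι, fun A h1 => hA A h1 (by linarith)⟩

lemma dhj_unit : DHJ Unit := by
  intro δ hδ
  refine ⟨Unit, inferInstance, fun A hA => ?_⟩
  obtain ⟨y, hy⟩ := nonempty_of_dens_pos (hδ.trans_le hA)
  exact ⟨⟨fun _ => none, (), rfl⟩, fun a => by convert hy⟩

/-- The **density Hales-Jewett theorem**, for some alphabet of any given positive size. -/
theorem exists_dhj (k : ℕ) :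
    ∃ (α : Type) (_ : Finite α), Nonempty α ∧ Nat.card α = k + 1 ∧ DHJ α := by
  induction k with
  | zero => exact ⟨Unit, inferInstance, inferInstance, by simp, dhj_unit⟩
  | succ k ih =>
    obtain ⟨α, hα, hne, hcard, h⟩ := ih
    exact ⟨Option α, inferInstance, inferInstance, by rw [Finite.card_option, hcard], h.option⟩

end Increment

section Szemeredi

lemma Line.exists_sum_apply_eq {ι α : Type*} [Fintype ι] (l : Line α ι) (w : α → ℕ) :
    ∃ s r : ℕ, 1 ≤ r ∧ ∀ a, ∑ i, w (l a i) = s + r * w a := by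
  classical
  refine ⟨∑ i, (l.idxFun i).elim 0 w, #{i | l.idxFun i = none}, ?_, fun a => ?_⟩
  · obtain ⟨i, hi⟩ := l.proper
    exact card_pos.2 ⟨i, by simpa using hi⟩
  · rw [← smul_eq_mul, ← sum_const, sum_filter, ← sum_add_distrib]
    refine sum_congr rfl fun i _ => ?_
    cases h : l.idxFun i <;> simp [Line.coe_apply, h]

lemma dens_setOf {X : Type*} [Fintype X] (P : X → Prop) [DecidablePred P] :
    dens {x | P x} = #{x | P x} / Fintype.card X := by
  rw [dens, avg_eq_expect, Fintype.expect_eq_sum_div_card, card_filter]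
  push_cast
  congr 1
  refine sum_congr rfl fun x _ => ?_
  by_cases h : P x <;> simp [h]

lemma card_le_add_card_shift {n : ℕ} {A : Finset ℕ} (hA : A ⊆ Icc 1 n) (t : ℕ) :
    #A ≤ t + #{a : Fin n | (a : ℕ) + 1 + t ∈ A} := by
  have h : A ⊆ Icc 1 t ∪ image (fun a : Fin n => (a : ℕ) + 1 + t)
      (univ.filter fun a : Fin n => (a : ℕ) + 1 + t ∈ A) := by
    intro b hb
    have hb' := mem_Icc.1 (hA hb)
    rw [mem_union, mem_Icc, mem_image]
    refine or_iff_not_imp_left.2 fun hbt => ⟨⟨b - 1 - t, by lia⟩, ?_⟩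
    have : b - 1 - t + 1 + t = b := by lia
    simp [this, hb]
  calc #A ≤ _ := card_le_card h
    _ ≤ _ := card_union_le _ _
    _ ≤ _ := by
      rw [Nat.card_Icc]
      exact Nat.add_le_add (by lia) card_image_le

/-- Pairs of a base point and a step whose shifts along a line stay in `A` are at most as many as
the progressions in `A`. -/
lemma card_le_card_progressions {n D k s r : ℕ} {A : Finset ℕ} (hA : A ⊆ Icc 1 n) (hk : 2 ≤ k)
    (hr : 1 ≤ r) :
    #{p : Fin n × Fin D | ∀ i < k, (p.1 : ℕ) + 1 + (p.2 + 1) * (s + r * i) ∈ A} ≤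
      #{q ∈ Icc 1 n ×ˢ Icc 1 n | ∀ i < k, q.1 + i * q.2 ∈ A} := by
  refine card_le_card_of_injOn
    (fun p => ((p.1 : ℕ) + 1 + (p.2 + 1) * s, ((p.2 : ℕ) + 1) * r)) ?_ ?_
  · intro p hp
    simp only [coe_filter, mem_univ, true_and, Set.mem_ofPred_eq] at hp
    simp only [coe_filter, mem_product, mem_Icc, Set.mem_ofPred_eq]
    have h0 := mem_Icc.1 (hA (hp 0 (by lia)))
    have h1 := mem_Icc.1 (hA (hp 1 (by lia)))
    have h2 : 1 ≤ ((p.2 : ℕ) + 1) * r := Nat.mul_pos (by lia) hr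
    simp only [mul_zero, mul_one, add_zero, mul_add] at h0 h1
    refine ⟨⟨⟨by lia, by rw [mul_comm]; lia⟩, h2,
      (Nat.le_add_left _ _).trans ((Nat.le_add_left _ _).trans h1.2)⟩, fun i hi => ?_⟩
    convert hp i hi using 1
    ring
  · rintro ⟨a, d⟩ - ⟨a', d'⟩ - h
    simp only [Prod.mk.injEq] at h
    have hd : (d : ℕ) = d' := by
      have := Nat.eq_of_mul_eq_mul_right hr h.2
      lia
    have ha : (a : ℕ) = a' := by
      have := h.1
      rw [hd] at this
      lia
    exact Prod.ext (Fin.ext ha) (Fin.ext hd)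

lemma exists_mul_le_card_progressions {k : ℕ} (hk : 2 ≤ k) {δ : ℝ} (hδ : 0 < δ) :
    ∃ θ : ℝ, 0 < θ ∧ ∃ W : ℕ, ∀ n D : ℕ, 1 ≤ n → 1 ≤ D → (D * W : ℝ) ≤ δ / 2 * n →
      ∀ A : Finset ℕ, A ⊆ Icc 1 n → δ * n ≤ #A →
        θ * (n * D) ≤ #{q ∈ Icc 1 n ×ˢ Icc 1 n | ∀ i < k, q.1 + i * q.2 ∈ A} := by
  classical
  obtain ⟨α, hα, hne, hcard, hdhj⟩ := exists_dhj (k - 1)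
  have := Fintype.ofFinite α
  rw [Nat.sub_add_cancel (by lia), Nat.card_eq_fintype_card] at hcard
  let e : α ≃ Fin k := Fintype.equivFinOfCardEq hcard
  obtain ⟨ι, hι, hline⟩ := hdhj (δ / 4) (by positivity)
  have := Fintype.ofFinite ι
  refine ⟨δ / 4 / (Nat.card (Line α ι) + 1), by positivity, Fintype.card ι * k,
    fun n D hn hD hDW A hA hAn => ?_⟩
  have : NeZero n := ⟨by lia⟩
  have : NeZero D := ⟨by lia⟩
  have hn0 : (0 : ℝ) < n := by exact_mod_cast hn
  have hD0 : (0 : ℝ) < D := by exact_mod_cast hD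
  let wt : (ι → α) → ℕ := fun x => ∑ i, (e (x i) : ℕ)
  have hwt (x : ι → α) : wt x ≤ Fintype.card ι * k := by
    refine (sum_le_card_nsmul _ _ k fun i _ => (e (x i)).2.le).trans_eq ?_
    rw [card_univ, smul_eq_mul]
  obtain ⟨l, hl⟩ := exists_popular_line (by positivity) hline
    (fun p : Fin n × Fin D => {x : ι → α | (p.1 : ℕ) + 1 + (p.2 + 1) * wt x ∈ A}) (by
      rw [avg_dens_comm fun (p : Fin n × Fin D) (x : ι → α) =>
        (p.1 : ℕ) + 1 + (p.2 + 1) * wt x ∈ A, ← avg_const (X := ι → α) (2 * (δ / 4))]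
      refine avg_mono fun x => ?_
      rw [dens, avg_prod, avg_comm, ← avg_const (X := Fin D) (2 * (δ / 4))]
      refine avg_mono fun d => ?_
      change _ ≤ dens {a : Fin n | (a : ℕ) + 1 + (d + 1) * wt x ∈ A}
      rw [dens_setOf, Fintype.card_fin, le_div_iff₀ hn0]
      have h1 := Nat.cast_le (α := ℝ).2 (card_le_add_card_shift hA (((d : ℕ) + 1) * wt x))
      have h2 : (((d + 1) * wt x : ℕ) : ℝ) ≤ (D * (Fintype.card ι * k) : ℕ) := by
        exact_mod_cast Nat.mul_le_mul d.2 (hwt x)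
      push_cast at h1 h2 hDW
      linarith)
  obtain ⟨s, r, hr, hsr⟩ := Line.exists_sum_apply_eq l fun a => (e a : ℕ)
  have hset : {p : Fin n × Fin D | ∀ a, l a ∈ {x | (p.1 : ℕ) + 1 + (p.2 + 1) * wt x ∈ A}} =
      {p | ∀ i < k, (p.1 : ℕ) + 1 + (p.2 + 1) * (s + r * i) ∈ A} := by
    ext p
    simp only [Set.mem_ofPred_eq, wt, hsr]
    refine ⟨fun h i hi => ?_, fun h a => h _ (e a).2⟩
    simpa using h (e.symm ⟨i, hi⟩)
  rw [hset, dens_setOf, Fintype.card_prod, Fintype.card_fin, Fintype.card_fin, Nat.cast_mul,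
    le_div_iff₀ (by positivity)] at hl
  exact hl.trans (by exact_mod_cast card_le_card_progressions hA hk hr)

end Szemeredi

end DensityHalesJewett

theorem supersaturated_szemeredi :
    ∀ k : ℕ, 3 ≤ k → ∀ δ : ℝ, 0 < δ → ∃ ε : ℝ, 0 < ε ∧
      ∃ N : ℕ, ∀ n : ℕ, N ≤ n → ∀ A : Finset ℕ, A ⊆ Finset.Icc 1 n →
        δ * n ≤ (A.card : ℝ) →
          ε * n ^ 2 ≤
            ((((Finset.Icc 1 n) ×ˢ (Finset.Icc 1 n)).filter fun q =>
              ∀ i < k, q.1 + i * q.2 ∈ A).card : ℝ) := by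
  intro k hk δ hδ
  obtain ⟨θ, hθ, W, h⟩ :=
    DensityHalesJewett.exists_mul_le_card_progressions (k := k) (by lia) hδ
  obtain ⟨C, hC⟩ := exists_nat_gt (2 * W / δ)
  have hC0 : 0 < C := by
    have : (0 : ℝ) ≤ 2 * W / δ := by positivity
    exact_mod_cast this.trans_lt hC
  have hC0' : (0 : ℝ) < C := by exact_mod_cast hC0
  rw [div_lt_iff₀ hδ] at hC
  refine ⟨θ / (2 * C), by positivity, C, fun n hn A hA hAn => ?_⟩
  have hD : 1 ≤ n / C := (Nat.one_le_div_iff hC0).2 hn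
  have h1 : (C : ℝ) * (n / C : ℕ) ≤ n := by exact_mod_cast Nat.mul_div_le n C
  have h2 : (n : ℝ) ≤ 2 * C * (n / C : ℕ) := by
    have := Nat.lt_mul_div_succ n hC0
    have h3 : C ≤ C * (n / C) := Nat.le_mul_of_pos_right C hD
    have h4 : n ≤ 2 * C * (n / C) := by
      rw [mul_add] at this
      rw [mul_assoc]
      lia
    exact_mod_cast h4
  have h3 : ((n / C : ℕ) * W : ℝ) ≤ δ / 2 * n := by
    have := mul_le_mul_of_nonneg_right hC.le (Nat.cast_nonneg (α := ℝ) (n / C))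
    have := mul_le_mul_of_nonneg_left h1 hδ.le
    linarith
  refine le_trans ?_ (h n (n / C) (by lia) hD h3 A hA hAn)
  calc θ / (2 * C) * (n : ℝ) ^ 2 = θ / (2 * C) * n * n := by ring
    _ ≤ θ / (2 * C) * n * (2 * C * (n / C : ℕ)) := by gcongr
    _ = θ * (n * (n / C : ℕ)) := by field_simp
end
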